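/- Krivine-Stengle Positivstellensatz for trace polynomials, positive semidefinite case: Let S ∪ {a} be a finite subset of Sym TT_n. Then a(X) is positive semidefinite for every X ∈ K_S if and only if there exist t₁, t₂ ∈ T_S^tr and k ∈ ℕ such that a·t₁ = t₁·a = a^{2k} + t₂ in TT_n. -/

import Mathlib

noncomputable section

open Matrix

/-- The polynomial ring ℝ[ξ] in the g·n² commuting variables ξ_{jıȷ}. -/
abbrev PolyRing (n g : ℕ) : Type := MvPolynomial (Fin g × Fin n × Fin n) ℝ

/-- n×n matrices over ℝ[ξ]. -/
abbrev MatP (n g : ℕ) : Type := Matrix (Fin n) (Fin n) (PolyRing n g)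

/-- The generic matrices Ξ_j = (ξ_{jıȷ})_{ıȷ}. -/
def genMat (n g : ℕ) (j : Fin g) : MatP n g :=
  Matrix.of fun a b => MvPolynomial.X (j, a, b)

/-- The set of generic matrices together with their transposes. -/
def genSet (n g : ℕ) : Set (MatP n g) :=
  Set.range (genMat n g) ∪ Set.range (fun j => (genMat n g j)ᵀ)

/-- The trace ring TT_n: the ℝ-subalgebra of M_n(ℝ[ξ]) generated by the Ξ_j, their
transposes, and the scalar matrices tr(w)·1 for all products w of the Ξ_j, Ξ_jᵀ. -/
def traceRing (n g : ℕ) : Subalgebra ℝ (MatP n g) :=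
  Algebra.adjoin ℝ
    (genSet n g ∪
      {m | ∃ w ∈ Submonoid.closure (genSet n g), m = (Matrix.trace w) • (1 : MatP n g)})

/-- The center C_n of the trace ring: the scalar matrices in TT_n. -/
def centerSet (n g : ℕ) : Set (MatP n g) :=
  {c | c ∈ traceRing n g ∧ ∃ p : PolyRing n g, c = p • (1 : MatP n g)}

/-- Evaluation of a matrix of polynomials at a g-tuple X of n×n real matrices. -/
def evalMat (n g : ℕ) (X : Fin g → Matrix (Fin n) (Fin n) ℝ) (h : MatP n g) :
    Matrix (Fin n) (Fin n) ℝ :=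
  h.map (MvPolynomial.eval fun v => X v.1 v.2.1 v.2.2)

/-- The semialgebraic set K_S determined by S. -/
def KSet (n g : ℕ) (S : Set (MatP n g)) : Set (Fin g → Matrix (Fin n) (Fin n) ℝ) :=
  {X | ∀ s ∈ S, (evalMat n g X s).PosSemidef}

/-- Cyclic quadratic module in Sym TT_n. -/
def IsCyclicQM (n g : ℕ) (Q : Set (MatP n g)) : Prop :=
  (∀ q ∈ Q, q ∈ traceRing n g ∧ qᵀ = q) ∧
  (1 : MatP n g) ∈ Q ∧
  (∀ a ∈ Q, ∀ b ∈ Q, a + b ∈ Q) ∧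
  (∀ h ∈ traceRing n g, ∀ q ∈ Q, h * q * hᵀ ∈ Q) ∧
  (∀ q ∈ Q, (Matrix.trace q) • (1 : MatP n g) ∈ Q)

/-- Cyclic preordering: a cyclic quadratic module whose intersection with the center
is closed under multiplication. -/
def IsCyclicPreordering (n g : ℕ) (T : Set (MatP n g)) : Prop :=
  IsCyclicQM n g T ∧
  ∀ a ∈ T ∩ centerSet n g, ∀ b ∈ T ∩ centerSet n g, a * b ∈ T

/-- The smallest cyclic preordering T_S^tr containing S. -/
def TtrS (n g : ℕ) (S : Set (MatP n g)) : Set (MatP n g) :=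
  {a | ∀ T : Set (MatP n g), IsCyclicPreordering n g T → S ⊆ T → a ∈ T}

namespace TracePos

open Polynomial

section

/-- A preordering of a commutative ring. -/
structure IsPreord {A : Type*} [CommRing A] (T : Set A) : Prop where
  add : ∀ {x y}, x ∈ T → y ∈ T → x + y ∈ T
  mul : ∀ {x y}, x ∈ T → y ∈ T → x * y ∈ T
  sq : ∀ x, x * x ∈ T

namespace IsPreord
variable {A : Type*} [CommRing A] {T : Set A}

lemma one (h : IsPreord T) : (1 : A) ∈ T := by simpa using h.sq 1
lemma zero (h : IsPreord T) : (0 : A) ∈ T := by simpa using h.sq 0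
lemma pow_even (h : IsPreord T) (f : A) (k : ℕ) : f ^ (2 * k) ∈ T := by
  rw [two_mul, pow_add]; exact h.sq _

lemma adjoin (h : IsPreord T) (x : A) :
    IsPreord {z | ∃ p ∈ T, ∃ q ∈ T, z = p + x * q} where
  add := by
    rintro _ _ ⟨p, hp, q, hq, rfl⟩ ⟨p', hp', q', hq', rfl⟩
    exact ⟨p + p', h.add hp hp', q + q', h.add hq hq', by ring⟩
  mul := by
    rintro _ _ ⟨p, hp, q, hq, rfl⟩ ⟨p', hp', q', hq', rfl⟩
    exact ⟨p * p' + x * x * (q * q'), h.add (h.mul hp hp') (h.mul (h.sq x) (h.mul hq hq')),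
      p * q' + q * p', h.add (h.mul hp hq') (h.mul hq hp'), by ring⟩
  sq := fun y => ⟨y * y, h.sq y, 0, h.zero, by ring⟩

/-- A preordering avoiding all `-f ^ (2 * k)` is contained in a total one with prime support. -/
theorem exists_prime (hT : IsPreord T) (f : A) (hf : ∀ k : ℕ, -f ^ (2 * k) ∉ T) :
    ∃ P : Set A, T ⊆ P ∧ IsPreord P ∧ (∀ k : ℕ, -f ^ (2 * k) ∉ P) ∧ (∀ x, x ∈ P ∨ -x ∈ P) ∧
      ∀ x y, x * y ∈ P → -(x * y) ∈ P → (x ∈ P ∧ -x ∈ P) ∨ (y ∈ P ∧ -y ∈ P) := by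
  obtain ⟨P, hTP, hP⟩ := zorn_subset_nonempty
    {P : Set A | IsPreord P ∧ ∀ k : ℕ, -f ^ (2 * k) ∉ P} (by
      intro c hc hchain hne
      refine ⟨⋃₀ c, ⟨⟨?_, ?_, ?_⟩, ?_⟩, fun s hs => Set.subset_sUnion_of_mem hs⟩
      · rintro x y ⟨s, hs, hx⟩ ⟨t, ht, hy⟩
        rcases hchain.total hs ht with h | h
        · exact ⟨t, ht, (hc ht).1.add (h hx) hy⟩
        · exact ⟨s, hs, (hc hs).1.add hx (h hy)⟩
      · rintro x y ⟨s, hs, hx⟩ ⟨t, ht, hy⟩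
        rcases hchain.total hs ht with h | h
        · exact ⟨t, ht, (hc ht).1.mul (h hx) hy⟩
        · exact ⟨s, hs, (hc hs).1.mul hx (h hy)⟩
      · obtain ⟨s, hs⟩ := hne
        exact fun x => ⟨s, hs, (hc hs).1.sq x⟩
      · rintro k ⟨s, hs, hk⟩
        exact (hc hs).2 k hk) T ⟨hT, hf⟩
  have hpre := hP.prop.1
  have hav := hP.prop.2
  have key : ∀ x, x ∉ P → ∃ k : ℕ, ∃ p ∈ P, ∃ q ∈ P, -f ^ (2 * k) = p + x * q := by
    intro x hx
    by_contra! hcon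
    refine hx (hP.le_of_ge (y := {z | ∃ p ∈ P, ∃ q ∈ P, z = p + x * q})
      ⟨hpre.adjoin x, ?_⟩ ?_ ?_)
    · rintro k ⟨p, hp, q, hq, h⟩
      exact hcon k p hp q hq h
    · exact fun p hp => ⟨p, hp, 0, hpre.zero, by ring⟩
    · exact ⟨0, hpre.zero, 1, hpre.one, by ring⟩
  have htot : ∀ x, x ∈ P ∨ -x ∈ P := by
    intro x
    by_contra! hx
    obtain ⟨k, p, hp, q, hq, h1⟩ := key x hx.1
    obtain ⟨m, p', hp', q', hq', h2⟩ := key (-x) hx.2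
    apply hav (k + m)
    have e : -f ^ (2 * (k + m)) = x * x * (q * q') + f ^ (2 * k) * p' + p * f ^ (2 * m)
        + p * p' := by
      rw [mul_add, pow_add]
      linear_combination (f ^ (2 * m) + p') * h1 - x * q * h2
    rw [e]
    exact hpre.add (hpre.add (hpre.add (hpre.mul (hpre.sq x) (hpre.mul hq hq'))
      (hpre.mul (hpre.pow_even f k) hp')) (hpre.mul hp (hpre.pow_even f m))) (hpre.mul hp hp')
  have hneg : ∀ x y, -x ∉ P → -y ∉ P → -(x * y) ∉ P := by
    intro x y hx hy hxy
    obtain ⟨k, p, hp, q, hq, h1⟩ := key _ hx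
    obtain ⟨m, p', hp', q', hq', h2⟩ := key _ hy
    apply hav (k + m)
    have e : -f ^ (2 * (k + m)) = -(x * y) * (q * q') + f ^ (2 * k) * p' + p * f ^ (2 * m)
        + p * p' := by
      rw [mul_add, pow_add]
      linear_combination (f ^ (2 * m) + p') * h1 + x * q * h2
    rw [e]
    exact hpre.add (hpre.add (hpre.add (hpre.mul hxy (hpre.mul hq hq'))
      (hpre.mul (hpre.pow_even f k) hp')) (hpre.mul hp (hpre.pow_even f m))) (hpre.mul hp hp')
  refine ⟨P, hTP, hpre, hav, htot, ?_⟩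
  intro x y h1 h2
  by_contra! hcon
  obtain ⟨hx, hy⟩ := hcon
  by_cases hxP : x ∈ P <;> by_cases hyP : y ∈ P
  · exact hneg x y (hx hxP) (hy hyP) h2
  · exact hneg x (-y) (hx hxP) (by simpa using hyP) (by simpa using h1)
  · exact hneg (-x) y (by simpa using hxP) (hy hyP) (by simpa using h1)
  · exact hneg (-x) (-y) (by simpa using hxP) (by simpa using hyP) (by simpa using h2)

end IsPreord

/-- The set of nonnegative elements of an ordered subfield. -/
structure IsOrdCone {F : Type*} [Field F] (Q : Set F) : Prop where
  zero : (0 : F) ∈ Q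
  one : (1 : F) ∈ Q
  add : ∀ {x y}, x ∈ Q → y ∈ Q → x + y ∈ Q
  mul : ∀ {x y}, x ∈ Q → y ∈ Q → x * y ∈ Q
  inv : ∀ {x}, x ∈ Q → x⁻¹ ∈ Q
  neg_one : (-1 : F) ∉ Q
  total : ∀ {x y}, x ∈ Q → y ∈ Q → x - y ∈ Q ∨ y - x ∈ Q

namespace IsOrdCone
variable {F E : Type*} [Field F] [Field E] {Q : Set F}

lemma eq_zero (h : IsOrdCone Q) {x : F} (h1 : x ∈ Q) (h2 : -x ∈ Q) : x = 0 := by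
  by_contra hx
  have := h.mul h2 (h.inv h1)
  rw [neg_mul, mul_inv_cancel₀ hx] at this
  exact h.neg_one this

lemma map (h : IsOrdCone Q) (j : F →+* E) : IsOrdCone (j '' Q) where
  zero := ⟨0, h.zero, map_zero j⟩
  one := ⟨1, h.one, map_one j⟩
  add := by rintro _ _ ⟨x, hx, rfl⟩ ⟨y, hy, rfl⟩; exact ⟨_, h.add hx hy, map_add j _ _⟩
  mul := by rintro _ _ ⟨x, hx, rfl⟩ ⟨y, hy, rfl⟩; exact ⟨_, h.mul hx hy, map_mul j _ _⟩
  inv := by rintro _ ⟨x, hx, rfl⟩; exact ⟨_, h.inv hx, map_inv₀ j _⟩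
  neg_one := by
    rintro ⟨x, hx, h1⟩
    have : x = -1 := j.injective (by simpa using h1)
    exact h.neg_one (this ▸ hx)
  total := by
    rintro _ _ ⟨x, hx, rfl⟩ ⟨y, hy, rfl⟩
    rcases h.total hx hy with h | h
    · exact Or.inl ⟨_, h, map_sub j _ _⟩
    · exact Or.inr ⟨_, h, map_sub j _ _⟩

lemma exists_maximal (h : IsOrdCone Q) :
    ∃ Q', Q ⊆ Q' ∧ IsOrdCone Q' ∧ ∀ Q'', IsOrdCone Q'' → Q' ⊆ Q'' → Q'' ⊆ Q' := by
  obtain ⟨Q', hQ, hQ'⟩ := zorn_subset_nonempty {Q : Set F | IsOrdCone Q} (by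
    intro c hc hchain hne
    have two : ∀ {x y}, x ∈ ⋃₀ c → y ∈ ⋃₀ c → ∃ s ∈ c, x ∈ s ∧ y ∈ s := by
      rintro x y ⟨s, hs, hx⟩ ⟨t, ht, hy⟩
      rcases hchain.total hs ht with h | h
      · exact ⟨t, ht, h hx, hy⟩
      · exact ⟨s, hs, hx, h hy⟩
    obtain ⟨s₀, hs₀⟩ := hne
    refine ⟨⋃₀ c, ⟨⟨s₀, hs₀, (hc hs₀).zero⟩, ⟨s₀, hs₀, (hc hs₀).one⟩, ?_, ?_, ?_, ?_, ?_⟩,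
      fun s hs => Set.subset_sUnion_of_mem hs⟩
    · intro x y hx hy
      obtain ⟨s, hs, hx, hy⟩ := two hx hy
      exact ⟨s, hs, (hc hs).add hx hy⟩
    · intro x y hx hy
      obtain ⟨s, hs, hx, hy⟩ := two hx hy
      exact ⟨s, hs, (hc hs).mul hx hy⟩
    · rintro x ⟨s, hs, hx⟩
      exact ⟨s, hs, (hc hs).inv hx⟩
    · rintro ⟨s, hs, hx⟩
      exact (hc hs).neg_one hx
    · intro x y hx hy
      obtain ⟨s, hs, hx, hy⟩ := two hx hy
      exact ((hc hs).total hx hy).imp (fun h => ⟨s, hs, h⟩) (fun h => ⟨s, hs, h⟩)) Q h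
  exact ⟨Q', hQ, hQ'.prop, fun Q'' h1 h2 => hQ'.le_of_ge h1 h2⟩

/-- The ordered subfield with a given set of nonnegative elements. -/
def subfield (h : IsOrdCone Q) : Subfield F where
  carrier := {x | x ∈ Q ∨ -x ∈ Q}
  zero_mem' := Or.inl h.zero
  one_mem' := Or.inl h.one
  add_mem' := by
    rintro x y (hx | hx) (hy | hy)
    · exact Or.inl (h.add hx hy)
    · have := h.total hx hy
      simpa [sub_eq_add_neg, add_comm] using this
    · have := h.total hy hx
      simpa [sub_eq_add_neg, add_comm] using this
    · right; rw [neg_add]; exact h.add hx hy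
  neg_mem' := by
    rintro x (hx | hx)
    · right; simpa using hx
    · left; exact hx
  mul_mem' := by
    rintro x y (hx | hx) (hy | hy)
    · exact Or.inl (h.mul hx hy)
    · right; simpa using h.mul hx hy
    · right; simpa using h.mul hx hy
    · left; simpa using h.mul hx hy
  inv_mem' := by
    rintro x (hx | hx)
    · exact Or.inl (h.inv hx)
    · right; simpa [inv_neg] using h.inv hx

/-- The order on the subfield attached to a cone. -/
@[reducible] noncomputable def linearOrder (h : IsOrdCone Q) : LinearOrder h.subfield where
  le x y := (y - x : F) ∈ Q
  le_refl x := by simpa using h.zero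
  le_trans x y z hxy hyz := by
    have := h.add hxy hyz
    simpa using this
  le_antisymm x y hxy hyx := by
    have := h.eq_zero hxy (by simpa using hyx)
    exact Subtype.ext (sub_eq_zero.1 this).symm
  le_total x y := by
    rcases (y - x).2 with h1 | h1
    · exact Or.inl (by simpa using h1)
    · exact Or.inr (by simpa using h1)
  toDecidableLE := Classical.decRel _

lemma isStrictOrderedRing (h : IsOrdCone Q) :
    @IsStrictOrderedRing h.subfield _ h.linearOrder.toPartialOrder := by
  let := h.linearOrder
  have : IsOrderedAddMonoid h.subfield :=
    { add_le_add_left := fun a b hab c => by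
        change ((b + c : h.subfield) - (a + c : h.subfield) : F) ∈ Q
        have hab' : (b - a : F) ∈ Q := hab
        simpa using hab' }
  have : ZeroLEOneClass h.subfield :=
    ⟨by
      change ((1 : h.subfield) - (0 : h.subfield) : F) ∈ Q
      simpa using h.one⟩
  refine IsStrictOrderedRing.of_mul_pos (fun a b ha hb => ?_)
  have ha' : (a - (0 : h.subfield) : F) ∈ Q := ha.le
  have hb' : (b - (0 : h.subfield) : F) ∈ Q := hb.le
  refine lt_of_le_of_ne ?_ (mul_ne_zero ha.ne' hb.ne').symm
  change ((a * b : h.subfield) - (0 : h.subfield) : F) ∈ Q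
  have := h.mul ha' hb'
  simpa using this

end IsOrdCone

/-- The intermediate value property for polynomials. -/
def PolyIVT (K : Type*) [Field K] [LinearOrder K] : Prop :=
  ∀ (p : K[X]) (a b : K), a < b → p.eval a * p.eval b < 0 → ∃ c, a < c ∧ c < b ∧ p.eval c = 0

end

section

lemma IsPreord.isOrdCone {E : Type*} [Field E] {P : Set E} (h : IsPreord P)
    (htot : ∀ x, x ∈ P ∨ -x ∈ P) (h1 : (-1 : E) ∉ P) : IsOrdCone P where
  zero := h.zero
  one := h.one
  add := h.add
  mul := h.mul
  inv {x} hx := by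
    by_cases h0 : x = 0
    · simpa [h0] using h.zero
    · have := h.mul hx (h.sq x⁻¹)
      rwa [← mul_assoc, mul_inv_cancel₀ h0, one_mul] at this
  neg_one := h1
  total {x y} _ _ := by simpa using htot (x - y)

/-- Sums of `c * g ^ 2` with `c` in a given cone of scalars. -/
def weightedSq {K E : Type*} [Field K] [LinearOrder K] [Field E] [Algebra K E] :
    AddSubmonoid E :=
  AddSubmonoid.closure {e | ∃ q : K, 0 ≤ q ∧ ∃ g : E, e = algebraMap K E q * (g * g)}

lemma isPreord_weightedSq {K E : Type*} [Field K] [LinearOrder K] [IsStrictOrderedRing K]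
    [Field E] [Algebra K E] : IsPreord (weightedSq (K := K) (E := E) : Set E) where
  add := fun hx hy => add_mem hx hy
  mul := by
    intro x y hx hy
    rw [SetLike.mem_coe] at hx hy
    rw [SetLike.mem_coe]
    induction hx using AddSubmonoid.closure_induction with
    | zero => simp
    | add a b _ _ ha hb => rw [add_mul]; exact add_mem ha hb
    | mem a ha =>
      obtain ⟨q, hq, g, rfl⟩ := ha
      induction hy using AddSubmonoid.closure_induction with
      | zero => simp
      | add a b _ _ ha hb => rw [mul_add]; exact add_mem ha hb
      | mem b hb =>
        obtain ⟨q', hq', g', rfl⟩ := hb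
        refine AddSubmonoid.subset_closure ⟨q * q', mul_nonneg hq hq', g * g', ?_⟩
        rw [map_mul]; ring
  sq := fun x => AddSubmonoid.subset_closure ⟨1, zero_le_one, x, by simp⟩

lemma weightedSq_lift {K : Type*} [Field K] [LinearOrder K] [IsStrictOrderedRing K]
    (f : K[X]) [Fact (Irreducible f)] {e : AdjoinRoot f}
    (he : e ∈ weightedSq (K := K) (E := AdjoinRoot f)) :
    ∃ w : K[X], AdjoinRoot.mk f w = e ∧ w.natDegree + 2 ≤ 2 * f.natDegree ∧
      ∀ c, 0 ≤ w.eval c := by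
  have hirr : Irreducible f := Fact.out
  have hpos : 0 < f.natDegree := hirr.natDegree_pos
  induction he using AddSubmonoid.closure_induction with
  | zero => exact ⟨0, by simp, by simp; lia, by simp⟩
  | add a b _ _ ha hb =>
    obtain ⟨w, h1, h2, h3⟩ := ha
    obtain ⟨w', h1', h2', h3'⟩ := hb
    refine ⟨w + w', by simp [h1, h1'], ?_, fun c => by simpa using add_nonneg (h3 c) (h3' c)⟩
    have := natDegree_add_le w w'
    lia
  | mem a ha =>
    obtain ⟨q, hq, g, rfl⟩ := ha
    obtain ⟨g, rfl⟩ := AdjoinRoot.mk_surjective g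
    refine ⟨C q * ((g % f) * (g % f)), ?_, ?_, fun c => ?_⟩
    · have : AdjoinRoot.mk f (g % f) = AdjoinRoot.mk f g := by
        conv_rhs => rw [← EuclideanDomain.mod_add_div g f]
        simp
      rw [map_mul, map_mul, this]
      rfl
    · have h1 : (g % f).natDegree < f.natDegree := natDegree_mod_lt g hpos.ne'
      have h2 := natDegree_C_mul_le q ((g % f) * (g % f))
      have h3 := natDegree_mul_le (p := g % f) (q := g % f)
      lia
    · simp only [eval_mul, eval_C]
      exact mul_nonneg hq (mul_self_nonneg _)

lemma polyIVT_of_irreducible_case {K : Type*} [Field K] [LinearOrder K] [IsStrictOrderedRing K]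
    (H : ∀ f : K[X], Irreducible f → (hf : Fact (Irreducible f)) →
      (-1 : AdjoinRoot f) ∉ weightedSq (K := K) (E := AdjoinRoot f) → ∃ c, f.eval c = 0) :
    PolyIVT K := by
  intro p
  induction hn : p.natDegree using Nat.strong_induction_on generalizing p with
  | _ n ih =>
  intro a b hab hp
  have hp0 : p ≠ 0 := by rintro rfl; simp at hp
  by_cases hu : IsUnit p
  · obtain ⟨u, hu, rfl⟩ := Polynomial.isUnit_iff.1 hu
    simp only [eval_C] at hp
    exact absurd (mul_self_nonneg u) (not_le.2 hp)
  have split : ∀ q r : K[X], ¬IsUnit q → ¬IsUnit r → p = q * r →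
      ∃ c, a < c ∧ c < b ∧ p.eval c = 0 := by
    intro q r hq hr h
    have hq0 : q ≠ 0 := by rintro rfl; simp [h] at hp0
    have hr0 : r ≠ 0 := by rintro rfl; simp [h] at hp0
    have hqd : 0 < q.natDegree := by
      rw [Nat.pos_iff_ne_zero]
      exact fun h0 => hq ((Polynomial.isUnit_iff_degree_eq_zero).2
        (by rw [degree_eq_natDegree hq0, h0]; rfl))
    have hrd : 0 < r.natDegree := by
      rw [Nat.pos_iff_ne_zero]
      exact fun h0 => hr ((Polynomial.isUnit_iff_degree_eq_zero).2
        (by rw [degree_eq_natDegree hr0, h0]; rfl))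
    have hd : p.natDegree = q.natDegree + r.natDegree := by rw [h, natDegree_mul hq0 hr0]
    rcases lt_or_ge (q.eval a * q.eval b) 0 with h1 | h1
    · obtain ⟨c, h2, h3, h4⟩ := ih q.natDegree (by lia) q rfl a b hab h1
      exact ⟨c, h2, h3, by simp [h, h4]⟩
    · have h2 : r.eval a * r.eval b < 0 := by
        by_contra! h3
        have := mul_nonneg h1 h3
        rw [h] at hp
        simp only [eval_mul] at hp
        nlinarith
      obtain ⟨c, h2, h3, h4⟩ := ih r.natDegree (by lia) r rfl a b hab h2
      exact ⟨c, h2, h3, by simp [h, h4]⟩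
  by_cases hirr : Irreducible p
  swap
  · rw [irreducible_iff] at hirr
    push Not at hirr
    obtain ⟨q, r, h, hq, hr⟩ := hirr hu
    exact split q r hq hr h
  have hfact : Fact (Irreducible p) := ⟨hirr⟩
  have hpos : 0 < p.natDegree := hirr.natDegree_pos
  by_cases hT : (-1 : AdjoinRoot p) ∈ weightedSq (K := K) (E := AdjoinRoot p)
  · obtain ⟨w, hw1, hw2, hw3⟩ := weightedSq_lift p hT
    have hdvd : p ∣ w + 1 := by
      rw [← AdjoinRoot.mk_eq_zero]; simp [hw1]
    obtain ⟨h, hh⟩ := hdvd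
    have hw4 : ∀ c, 0 < (w + 1).eval c := fun c => by
      have := hw3 c
      simp; linarith
    have hh0 : h ≠ 0 := by
      rintro rfl
      have := hw4 0
      rw [hh] at this
      simp at this
    have hdeg : (w + 1).natDegree ≤ w.natDegree := by
      refine (natDegree_add_le _ _).trans (by simp)
    have hd : (w + 1).natDegree = p.natDegree + h.natDegree := by
      rw [hh, natDegree_mul hp0 hh0]
    have h1 : h.eval a * h.eval b < 0 := by
      have h2 := mul_pos (hw4 a) (hw4 b)
      rw [hh] at h2
      simp only [eval_mul] at h2
      by_contra! h3
      nlinarith [mul_nonneg h3 (neg_pos.2 hp).le]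
    obtain ⟨c, h2, h3, h4⟩ := ih h.natDegree (by lia) h rfl a b hab h1
    have := hw4 c
    rw [hh] at this
    simp [h4] at this
  · obtain ⟨c, hc⟩ := H p hirr hfact hT
    obtain ⟨r, hr⟩ := dvd_iff_isRoot.2 hc
    by_cases hru : IsUnit r
    · obtain ⟨u, hu, rfl⟩ := Polynomial.isUnit_iff.1 hru
      rw [hr] at hp
      simp only [eval_mul, eval_sub, eval_X, eval_C] at hp
      have hu2 : 0 < u * u := mul_self_pos.2 hu.ne_zero
      have h5 : (a - c) * (b - c) < 0 := by
        by_contra! h6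
        nlinarith [mul_nonneg h6 hu2.le]
      refine ⟨c, ?_, ?_, hc⟩
      · by_contra! h6
        nlinarith
      · by_contra! h6
        nlinarith
    · exact split _ r (not_isUnit_X_sub_C c) hru hr

lemma IsOrdCone.polyIVT {F : Type*} [Field F] [IsAlgClosed F] {Q : Set F} (h : IsOrdCone Q)
    (hmax : ∀ Q', IsOrdCone Q' → Q ⊆ Q' → Q' ⊆ Q) :
    @PolyIVT h.subfield _ h.linearOrder := by
  let := h.linearOrder
  have := h.isStrictOrderedRing
  refine polyIVT_of_irreducible_case (fun f hf _ hT => ?_)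
  obtain ⟨P, hTP, hP, hav, htot, -⟩ := isPreord_weightedSq.exists_prime (1 : AdjoinRoot f)
    (by simpa using hT)
  have hcone : IsOrdCone P := hP.isOrdCone htot (by simpa using hav 0)
  have hdeg : (f.map h.subfield.subtype).degree ≠ 0 := by
    rw [degree_map]
    exact (degree_pos_of_irreducible hf).ne'
  obtain ⟨β, hβ⟩ := IsAlgClosed.exists_root (f.map h.subfield.subtype) hdeg
  have hβ' : f.eval₂ h.subfield.subtype β = 0 := by
    rwa [IsRoot.def, eval_map] at hβ
  let j : AdjoinRoot f →+* F := AdjoinRoot.lift h.subfield.subtype β hβ'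
  have hQ := hmax _ (hcone.map j) (fun x hx => by
    refine ⟨AdjoinRoot.of f ⟨x, Or.inl hx⟩, hTP ?_, by simp [j]⟩
    refine AddSubmonoid.subset_closure ⟨⟨x, Or.inl hx⟩, ?_, 1, by simp⟩
    change (x - (0 : h.subfield) : F) ∈ Q
    simpa using hx)
  have hβm : β ∈ Q ∨ -β ∈ Q := by
    rcases htot (AdjoinRoot.root f) with h1 | h1
    · exact Or.inl (hQ ⟨_, h1, by simp [j]⟩)
    · exact Or.inr (hQ ⟨_, h1, by simp [j]⟩)
  refine ⟨⟨β, hβm⟩, ?_⟩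
  apply h.subfield.subtype.injective
  rw [map_zero, ← hβ']
  exact (hom_eval₂ f (RingHom.id _) h.subfield.subtype ⟨β, hβm⟩)

lemma isOrdCone_fractions {A Ω : Type*} [CommRing A] [Field Ω] {P : Set A} (hP : IsPreord P)
    (htot : ∀ x, x ∈ P ∨ -x ∈ P) (θ : A →+* Ω) (hθ : ∀ x, θ x = 0 ↔ x ∈ P ∧ -x ∈ P) :
    IsOrdCone {x | ∃ a ∈ P, ∃ b, θ b ≠ 0 ∧ x = θ a / (θ b * θ b)} := by
  have hsupp : ∀ b, θ b ≠ 0 → ∀ c, θ c ≠ 0 → θ (b * c) ≠ 0 := fun b hb c hc => by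
    rw [map_mul]; exact mul_ne_zero hb hc
  exact
    { zero := ⟨0, hP.zero, 1, by simp, by simp⟩
      one := ⟨1, hP.one, 1, by simp, by simp⟩
      add := by
        rintro _ _ ⟨a, ha, b, hb, rfl⟩ ⟨a', ha', b', hb', rfl⟩
        refine ⟨a * (b' * b') + a' * (b * b), hP.add (hP.mul ha (hP.sq _))
          (hP.mul ha' (hP.sq _)), b * b', hsupp _ hb _ hb', ?_⟩
        simp only [map_add, map_mul]
        field_simp
      mul := by
        rintro _ _ ⟨a, ha, b, hb, rfl⟩ ⟨a', ha', b', hb', rfl⟩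
        refine ⟨a * a', hP.mul ha ha', b * b', hsupp _ hb _ hb', ?_⟩
        simp only [map_mul]
        field_simp
      inv := by
        rintro _ ⟨a, ha, b, hb, rfl⟩
        by_cases h0 : θ a = 0
        · exact ⟨0, hP.zero, 1, by simp, by simp [h0]⟩
        · refine ⟨a * (b * b), hP.mul ha (hP.sq _), a, h0, ?_⟩
          simp only [map_mul]
          field_simp
      neg_one := by
        rintro ⟨a, ha, b, hb, h⟩
        have h2 : θ (a + b * b) = 0 := by
          rw [eq_div_iff (mul_ne_zero hb hb)] at h
          simp only [map_add, map_mul]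
          linear_combination -h
        have h3 := ((hθ _).1 h2).2
        have := (hθ (b * b)).2 ⟨hP.sq b, by simpa using hP.add h3 ha⟩
        rw [map_mul] at this
        exact mul_ne_zero hb hb this
      total := by
        rintro _ _ ⟨a, ha, b, hb, rfl⟩ ⟨a', ha', b', hb', rfl⟩
        rcases htot (a * (b' * b') - a' * (b * b)) with h | h
        · refine Or.inl ⟨_, h, b * b', hsupp _ hb _ hb', ?_⟩
          simp only [map_sub, map_mul]
          field_simp
        · refine Or.inr ⟨_, h, b * b', hsupp _ hb _ hb', ?_⟩
          simp only [map_sub, map_mul, map_neg]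
          field_simp
          ring }

/-- A preordering without a certificate for `0 ≤ f` has a point over a field with the
intermediate value property at which `f` is negative. -/
theorem IsPreord.exists_field {A : Type} [CommRing A] {T : Set A} (hT : IsPreord T) (f : A)
    (hf : ∀ t₁ ∈ T, ∀ t₂ ∈ T, ∀ k : ℕ, f * t₁ ≠ f ^ (2 * k) + t₂) :
    ∃ (K : Type) (_ : Field K) (_ : LinearOrder K) (_ : IsStrictOrderedRing K) (ψ : A →+* K),
      PolyIVT K ∧ (∀ t ∈ T, 0 ≤ ψ t) ∧ ψ f < 0 := by
  obtain ⟨P, hTP, hP, hav, htot, hprime⟩ := (hT.adjoin (-f)).exists_prime f (by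
    rintro k ⟨p, hp, q, hq, h⟩
    exact hf q hq p hp k (by linear_combination h))
  have hfP : -f ∈ P := hTP ⟨0, hT.zero, 1, hT.one, by ring⟩
  have h1P : (-1 : A) ∉ P := by simpa using hav 0
  let I : Ideal A :=
    { carrier := {x | x ∈ P ∧ -x ∈ P}
      zero_mem' := ⟨hP.zero, by simpa using hP.zero⟩
      add_mem' := fun {x y} hx hy => ⟨hP.add hx.1 hy.1, by
        rw [neg_add]; exact hP.add hx.2 hy.2⟩
      smul_mem' := fun c x hx => by
        rcases htot c with h | h
        · exact ⟨hP.mul h hx.1, by simpa using hP.mul h hx.2⟩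
        · exact ⟨by simpa using hP.mul h hx.2, by simpa using hP.mul h hx.1⟩ }
  have memI : ∀ x, x ∈ I ↔ x ∈ P ∧ -x ∈ P := fun x => Iff.rfl
  have hI : I.IsPrime := by
    refine ⟨fun h => h1P ?_, fun {x y} hxy => ?_⟩
    · have : (1 : A) ∈ I := h ▸ Submodule.mem_top
      exact ((memI _).1 this).2
    · exact hprime x y hxy.1 hxy.2
  let Ω := AlgebraicClosure (FractionRing (A ⧸ I))
  let θ : A →+* Ω := ((algebraMap (FractionRing (A ⧸ I)) Ω).comp
    (algebraMap (A ⧸ I) (FractionRing (A ⧸ I)))).comp (Ideal.Quotient.mk I)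
  have hθ : ∀ x, θ x = 0 ↔ x ∈ I := by
    intro x
    simp only [θ, RingHom.comp_apply]
    rw [map_eq_zero, IsFractionRing.to_map_eq_zero_iff, Ideal.Quotient.eq_zero_iff_mem]
  have hQ := isOrdCone_fractions hP htot θ (fun x => (hθ x).trans (memI x))
  obtain ⟨Q', hQQ, hQ', hmax⟩ := hQ.exists_maximal
  have hPQ : ∀ a ∈ P, θ a ∈ Q' := fun a ha => hQQ ⟨a, ha, 1, by simp, by simp⟩
  let ψ : A →+* hQ'.subfield := θ.codRestrict hQ'.subfield (fun x => by
    rcases htot x with h | h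
    · exact Or.inl (hPQ _ h)
    · exact Or.inr (by simpa using hPQ _ h))
  let := hQ'.linearOrder
  have := hQ'.isStrictOrderedRing
  have hψ : ∀ t ∈ P, 0 ≤ ψ t := fun t ht => by
    change (θ t - (0 : hQ'.subfield) : Ω) ∈ Q'
    simpa using hPQ t ht
  refine ⟨hQ'.subfield, inferInstance, hQ'.linearOrder, hQ'.isStrictOrderedRing, ψ,
    hQ'.polyIVT hmax, fun t ht => hψ t (hTP ⟨t, ht, 0, hT.zero, by ring⟩), ?_⟩
  refine lt_of_le_of_ne ?_ ?_
  · have := hψ _ hfP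
    rw [map_neg] at this
    linarith
  · intro h
    have h2 : θ f = 0 := congrArg Subtype.val h
    have h3 : f * f ∈ I := I.mul_mem_left _ ((hθ _).1 h2)
    exact hav 1 (by rw [mul_one, pow_two]; exact ((memI _).1 h3).2)

end

section

section OneField
variable {R : Type*} [Field R] [LinearOrder R] [IsStrictOrderedRing R]

lemma sign_eq_of_no_root (hR : PolyIVT R) {p : R[X]} {a b : R} (hab : a ≤ b)
    (h : ∀ x, a ≤ x → x ≤ b → p.eval x ≠ 0) :
    SignType.sign (p.eval a) = SignType.sign (p.eval b) := by
  rcases hab.eq_or_lt with rfl | hlt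
  · rfl
  by_contra hne
  have ha := h a le_rfl hab
  have hb := h b hab le_rfl
  have hneg : p.eval a * p.eval b < 0 := by
    rcases lt_or_gt_of_ne ha with h1 | h1 <;> rcases lt_or_gt_of_ne hb with h2 | h2
    · simp [sign_neg h1, sign_neg h2] at hne
    · exact mul_neg_of_neg_of_pos h1 h2
    · exact mul_neg_of_pos_of_neg h1 h2
    · simp [sign_pos h1, sign_pos h2] at hne
  obtain ⟨c, h1, h2, h3⟩ := hR p a b hlt hneg
  exact h c h1.le h2.le h3

lemma mul_pos_of_no_root (hR : PolyIVT R) {p : R[X]} {a b : R} (hab : a ≤ b)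
    (h : ∀ x, a ≤ x → x ≤ b → p.eval x ≠ 0) : 0 < p.eval a * p.eval b := by
  have h1 := sign_eq_of_no_root hR hab h
  rw [← sign_eq_one_iff, sign_mul, h1]
  have := h b hab le_rfl
  rcases lt_or_gt_of_ne this with h2 | h2
  · simp [sign_neg h2]
  · simp [sign_pos h2]

/-- Rolle's theorem for polynomials over a field with the intermediate value property. -/
lemma polyRolle (hR : PolyIVT R) {p : R[X]} (hp : p ≠ 0) {a b : R} (hab : a < b)
    (ha : p.eval a = 0) (hb : p.eval b = 0) :
    ∃ c, a < c ∧ c < b ∧ p.derivative.eval c = 0 := by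
  classical
  obtain ⟨b', hb', hmin⟩ := (p.roots.toFinset.filter (a < ·)).exists_min_image id
    ⟨b, by simp [hp, hb, hab]⟩
  simp only [Finset.mem_filter, Multiset.mem_toFinset, mem_roots hp, IsRoot.def, id] at hb' hmin
  obtain ⟨hb'0, hab'⟩ := hb'
  have hb'b : b' ≤ b := hmin b ⟨hb, hab⟩
  obtain ⟨g₁, hg₁, hg₁'⟩ := exists_eq_pow_rootMultiplicity_mul_and_not_dvd p hp a
  set m := p.rootMultiplicity a with hm
  have hm0 : m ≠ 0 := by
    have := (rootMultiplicity_pos hp).2 ha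
    exact this.ne'
  have hg₁0 : g₁ ≠ 0 := by rintro rfl; simp at hg₁'
  have hg₁b : g₁.eval b' = 0 := by
    rw [hg₁] at hb'0
    simpa [sub_eq_zero, hab'.ne', hm0] using hb'0
  obtain ⟨g, hg, hg'⟩ := exists_eq_pow_rootMultiplicity_mul_and_not_dvd g₁ hg₁0 b'
  set k := g₁.rootMultiplicity b' with hk
  have hk0 : k ≠ 0 := by
    have := (rootMultiplicity_pos hg₁0).2 hg₁b
    exact this.ne'
  have hpg : p = (X - C a) ^ m * ((X - C b') ^ k * g) := by rw [← hg, ← hg₁]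
  have hga : g.eval a ≠ 0 := by
    intro h
    apply hg₁'
    rw [hg]
    exact Dvd.dvd.mul_left (dvd_iff_isRoot.2 h) _
  have hgb : g.eval b' ≠ 0 := fun h => hg' (dvd_iff_isRoot.2 h)
  have hpos : 0 < g.eval a * g.eval b' := by
    refine mul_pos_of_no_root hR hab'.le (fun x h1 h2 h3 => ?_)
    rcases h1.eq_or_lt with rfl | h1
    · exact hga h3
    rcases h2.eq_or_lt with rfl | h2
    · exact hgb h3
    have := hmin x ⟨by rw [hpg]; simp [h3], h1⟩
    exact absurd h2 (not_lt.2 this)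
  obtain ⟨k', hk'⟩ := Nat.exists_eq_succ_of_ne_zero hk0
  obtain ⟨m', hm'⟩ := Nat.exists_eq_succ_of_ne_zero hm0
  rw [hk', hm'] at hpg
  set h : R[X] := (C (m' + 1 : R)) * (X - C b') * g + (C (k' + 1 : R)) * (X - C a) * g +
    (X - C a) * (X - C b') * derivative g with hh
  have hder : derivative p = (X - C a) ^ m' * (X - C b') ^ k' * h := by
    rw [hpg, hh]
    simp only [derivative_mul, derivative_pow, derivative_sub, derivative_X, derivative_C,
      sub_zero, mul_one, Nat.succ_eq_add_one, Nat.add_sub_cancel, Nat.cast_add, Nat.cast_one,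
      map_add, map_one, map_natCast]
    ring
  have h1 : h.eval a * h.eval b' < 0 := by
    have ea : h.eval a = (m' + 1) * (a - b') * g.eval a := by simp [hh]
    have eb : h.eval b' = (k' + 1) * (b' - a) * g.eval b' := by simp [hh]
    have : h.eval a * h.eval b' =
      -(((m' + 1) * (k' + 1)) * ((b' - a) * (b' - a)) * (g.eval a * g.eval b')) := by
      rw [ea, eb]; ring
    rw [this, neg_lt_zero]
    have : 0 < b' - a := sub_pos.2 hab'
    positivity
  obtain ⟨c, h2, h3, h4⟩ := hR h a b' hab' h1
  exact ⟨c, h2, h3.trans_le hb'b, by rw [hder]; simp [h4]⟩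

lemma sign_change_of_root (hR : PolyIVT R) {p : R[X]} (hp : p ≠ 0) {a x b : R} (hax : a < x)
    (hxb : x < b) (hx : p.eval x = 0)
    (hder : ∀ z, a < z → z < b → p.derivative.eval z ≠ 0) : p.eval a * p.eval b < 0 := by
  have hroot : ∀ z, a ≤ z → z ≤ b → p.eval z = 0 → z = x := by
    intro z h1 h2 h3
    by_contra hne
    rcases lt_or_gt_of_ne hne with h | h
    · obtain ⟨c, h4, h5, h6⟩ := polyRolle hR hp h h3 hx
      exact hder c (h1.trans_lt h4) (h5.trans hxb) h6
    · obtain ⟨c, h4, h5, h6⟩ := polyRolle hR hp h hx h3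
      exact hder c (hax.trans h4) (h5.trans_le h2) h6
  obtain ⟨g, rfl⟩ := dvd_iff_isRoot.2 hx
  have hgx : g.eval x ≠ 0 := by
    have := hder x hax hxb
    simpa [derivative_mul] using this
  have hpos : 0 < g.eval a * g.eval b := by
    refine mul_pos_of_no_root hR (hax.trans hxb).le (fun z h1 h2 h3 => ?_)
    have := hroot z h1 h2 (by simp [h3])
    exact hgx (this ▸ h3)
  simp only [eval_mul, eval_sub, eval_X, eval_C]
  have h1 : 0 < x - a := sub_pos.2 hax
  have h2 : 0 < b - x := sub_pos.2 hxb
  have := mul_pos (mul_pos h1 h2) hpos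
  nlinarith

lemma exists_bound_atTop (p : R[X]) (hp : p ≠ 0) :
    ∃ M c : R, 0 < c ∧ ∀ x, M ≤ x → c ≤ p.leadingCoeff * p.eval x := by
  induction hn : p.natDegree generalizing p with
  | zero =>
    obtain ⟨a, rfl⟩ := natDegree_eq_zero.1 hn
    have ha : a ≠ 0 := by rintro rfl; simp at hp
    exact ⟨0, a * a, mul_self_pos.2 ha, fun x _ => by simp⟩
  | succ n ih =>
    have hX := p.divX_mul_X_add
    have hdeg : p.divX.natDegree = n := by rw [natDegree_divX_eq_natDegree_tsub_one, hn]; rfl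
    have hq : p.divX ≠ 0 := by
      intro h
      rw [h] at hX
      rw [← hX] at hn
      simp at hn
    have hlc : p.leadingCoeff = p.divX.leadingCoeff := by
      rw [leadingCoeff, leadingCoeff, hdeg, hn, coeff_divX, add_comm]
    obtain ⟨M, c, hc, h⟩ := ih p.divX hq hdeg
    refine ⟨max (max M 0) ((1 + |p.coeff 0 * p.leadingCoeff|) / c), 1, one_pos, fun x hx => ?_⟩
    have h1 : M ≤ x := (le_max_left _ _).trans ((le_max_left _ _).trans hx)
    have h2 : 0 ≤ x := (le_max_right _ _).trans ((le_max_left _ _).trans hx)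
    have h3 : (1 + |p.coeff 0 * p.leadingCoeff|) / c ≤ x := (le_max_right _ _).trans hx
    rw [div_le_iff₀ hc] at h3
    have h4 := mul_le_mul_of_nonneg_left (h x h1) h2
    have h5 := neg_abs_le (p.coeff 0 * p.leadingCoeff)
    have h6 : p.eval x = p.divX.eval x * x + p.coeff 0 := by
      conv_lhs => rw [← hX]
      simp
    rw [h6]
    rw [← hlc] at h4
    nlinarith

lemma exists_sign_atTop (p : R[X]) :
    ∃ M : R, ∀ x, M ≤ x → SignType.sign (p.eval x) = SignType.sign p.leadingCoeff := by
  by_cases hp : p = 0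
  · exact ⟨0, fun x _ => by simp [hp]⟩
  obtain ⟨M, c, hc, h⟩ := exists_bound_atTop p hp
  refine ⟨M, fun x hx => ?_⟩
  have h1 := hc.trans_le (h x hx)
  rcases pos_and_pos_or_neg_and_neg_of_mul_pos h1 with ⟨h2, h3⟩ | ⟨h2, h3⟩
  · rw [sign_pos h2, sign_pos h3]
  · rw [sign_neg h2, sign_neg h3]

lemma exists_sign_ends (p : R[X]) :
    ∃ M : R, ∀ N, M ≤ N → (∀ x, N ≤ x → SignType.sign (p.eval x) = SignType.sign p.leadingCoeff) ∧
      ∀ x, x ≤ -N → SignType.sign (p.eval x) =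
        SignType.sign ((-1) ^ p.natDegree * p.leadingCoeff) := by
  obtain ⟨M, hM⟩ := exists_sign_atTop p
  obtain ⟨M', hM'⟩ := exists_sign_atTop (p.comp (-X))
  refine ⟨max M M', fun N hN => ⟨fun x hx => hM x ((le_max_left _ _).trans (hN.trans hx)),
    fun x hx => ?_⟩⟩
  have := hM' (-x) ((le_max_right _ _).trans (hN.trans (by linarith)))
  rw [comp_neg_X_leadingCoeff_eq] at this
  simpa using this

end OneField

section Closure
variable {A : Type*} [CommRing A]

lemma exists_pseudoRem (g : A[X]) (hg : 0 < g.natDegree) (f : A[X]) :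
    ∃ (k : ℕ) (q r : A[X]), C (g.leadingCoeff ^ (2 * k)) * f = q * g + r ∧
      r.natDegree < g.natDegree := by
  induction hn : f.natDegree using Nat.strong_induction_on generalizing f with
  | _ n ih =>
  by_cases hlt : f.natDegree < g.natDegree
  · exact ⟨0, 0, f, by simp, hlt⟩
  push Not at hlt
  set f' := C (g.leadingCoeff ^ 2) * f -
    C (g.leadingCoeff * f.leadingCoeff) * X ^ (f.natDegree - g.natDegree) * g with hf'
  have hle : f'.natDegree ≤ f.natDegree := by
    refine (natDegree_sub_le _ _).trans (max_le (natDegree_C_mul_le _ _) ?_)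
    refine natDegree_mul_le.trans ?_
    have := natDegree_C_mul_X_pow_le (g.leadingCoeff * f.leadingCoeff) (f.natDegree - g.natDegree)
    lia
  have hc : f'.coeff f.natDegree = 0 := by
    have h1 : (g * X ^ (f.natDegree - g.natDegree)).coeff f.natDegree = g.leadingCoeff := by
      have := coeff_mul_X_pow g (f.natDegree - g.natDegree) g.natDegree
      rwa [Nat.add_sub_cancel' hlt] at this
    rw [hf', coeff_sub, coeff_C_mul, mul_assoc, coeff_C_mul, mul_comm (X ^ _) g, h1]
    simp only [leadingCoeff]
    ring
  have hlt' : f'.natDegree < f.natDegree := by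
    refine lt_of_le_of_ne hle (fun h => ?_)
    rw [← h] at hc
    have : f' = 0 := leadingCoeff_eq_zero.1 hc
    rw [this, natDegree_zero] at h
    lia
  obtain ⟨k, q, r, h1, h2⟩ := ih f'.natDegree (by lia) f' rfl
  refine ⟨k + 1, q + C (g.leadingCoeff ^ (2 * k)) *
    (C (g.leadingCoeff * f.leadingCoeff) * X ^ (f.natDegree - g.natDegree)), r, ?_, h2⟩
  rw [hf'] at h1
  rw [mul_add, pow_add, map_mul]
  linear_combination h1

lemma exists_closed_finset [DecidableEq A[X]] (op : A[X] → A[X] → Finset A[X])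
    (hop : ∀ f g, ∀ h ∈ op f g, 0 < g.natDegree → h.natDegree < g.natDegree) (m : ℕ) :
    ∀ F : Finset A[X], (∀ f ∈ F, ∀ g ∈ F, m < g.natDegree → g.natDegree ≤ f.natDegree →
      op f g ⊆ F) → ∃ F', F ⊆ F' ∧ ∀ f ∈ F', ∀ g ∈ F', 0 < g.natDegree →
        g.natDegree ≤ f.natDegree → op f g ⊆ F' := by
  induction m with
  | zero => exact fun F hF => ⟨F, subset_rfl, hF⟩
  | succ m ih =>
    intro F hF
    let N : Finset A[X] := (F ×ˢ F).biUnion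
      (fun fg => if fg.2.natDegree = m + 1 then op fg.1 fg.2 else ∅)
    have hN : ∀ h ∈ N, h.natDegree < m + 1 := by
      intro h hh
      simp only [N, Finset.mem_biUnion] at hh
      obtain ⟨fg, -, hh⟩ := hh
      split_ifs at hh with h1
      · have := hop _ _ h hh (by lia); lia
      · simp at hh
    obtain ⟨F', h1, h2⟩ := ih (F ∪ N) (by
      intro f hf g hg hm hle
      have hf' : f ∈ F := by
        rcases Finset.mem_union.1 hf with h | h
        · exact h
        · have := hN _ h; lia
      have hg' : g ∈ F := by
        rcases Finset.mem_union.1 hg with h | h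
        · exact h
        · have := hN _ h; lia
      by_cases hm' : g.natDegree = m + 1
      · intro h hh
        refine Finset.mem_union_right _ (Finset.mem_biUnion.2 ⟨(f, g), by simp [hf', hg'], ?_⟩)
        simp [hm', hh]
      · exact (hF f hf' g hg' (by lia) hle).trans Finset.subset_union_left)
    exact ⟨F', Finset.subset_union_left.trans h1, h2⟩

/-- A finite set of polynomials closed under the operations needed to compute sign tables. -/
structure SignClosed (F : Finset A[X]) : Prop where
  der : ∀ g ∈ F, 0 < g.natDegree → derivative g ∈ F
  erase : ∀ g ∈ F, 0 < g.natDegree → g.eraseLead ∈ F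
  rem : ∀ f ∈ F, ∀ g ∈ F, 0 < g.natDegree → g.natDegree ≤ f.natDegree →
    ∃ (k : ℕ) (q r : A[X]), C (g.leadingCoeff ^ (2 * k)) * f = q * g + r ∧
      r.natDegree < g.natDegree ∧ r ∈ F

lemma exists_signClosed (F : Finset A[X]) : ∃ F', F ⊆ F' ∧ SignClosed F' := by
  classical
  choose k q r h1 h2 using fun (g : {g : A[X] // 0 < g.natDegree}) => exists_pseudoRem g.1 g.2
  obtain ⟨F', hF, h⟩ := exists_closed_finset
    (fun f g => {derivative g, g.eraseLead} ∪
      if hg : 0 < g.natDegree then {r ⟨g, hg⟩ f} else ∅) (by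
      intro f g h hh hg
      simp only [hg, dif_pos, Finset.mem_union, Finset.mem_insert, Finset.mem_singleton] at hh
      rcases hh with (rfl | rfl) | rfl
      · exact natDegree_derivative_lt hg.ne'
      · rcases eraseLead_natDegree_lt_or_eraseLead_eq_zero g with h | h
        · exact h
        · rw [h]; simpa using hg
      · exact h2 ⟨g, hg⟩ f) (F.sup natDegree) F (by
      intro f hf g hg hm
      exact absurd (Finset.le_sup (f := natDegree) hg) (not_le.2 hm))
  refine ⟨F', hF, fun g hg hd => h g hg g hg hd le_rfl (by simp),
    fun g hg hd => h g hg g hg hd le_rfl (by simp),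
    fun f hf g hg hd hle => ⟨_, _, _, h1 ⟨g, hd⟩ f, h2 ⟨g, hd⟩ f, h f hf g hg hd hle ?_⟩⟩
  simp [hd]

end Closure

end

section

section Compat
variable {R₁ R₂ : Type*} [LinearOrder R₁] [LinearOrder R₂]

/-- `y` and `y'` have the same position relative to the pairs in `P`. -/
def Compat (P : Finset (R₁ × R₂)) (y : R₁) (y' : R₂) : Prop := ∀ s ∈ P, cmp s.1 y = cmp s.2 y'

lemma Compat.mono {P P' : Finset (R₁ × R₂)} (h : P ⊆ P') {y y'} (hc : Compat P' y y') :
    Compat P y y' := fun s hs => hc s (h hs)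

/-- Exchange the two coordinates. -/
def swapPairs (P : Finset (R₁ × R₂)) : Finset (R₂ × R₁) := P.map (Equiv.prodComm R₁ R₂).toEmbedding

omit [LinearOrder R₁] [LinearOrder R₂] in
lemma mem_swapPairs {P : Finset (R₁ × R₂)} {s : R₂ × R₁} : s ∈ swapPairs P ↔ (s.2, s.1) ∈ P := by
  simp [swapPairs, Prod.swap]

lemma Compat.swap {P : Finset (R₁ × R₂)} {y y'} (hc : Compat P y y') :
    Compat (swapPairs P) y' y := fun s hs => (hc (s.2, s.1) (mem_swapPairs.1 hs)).symm

omit [LinearOrder R₂] in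
lemma exists_gap (P : Finset (R₁ × R₂)) {y : R₁} (hy : ∀ s ∈ P, s.1 ≠ y)
    {l : R₁ × R₂} (hl : l ∈ P) (hly : l.1 < y) {h : R₁ × R₂} (hh : h ∈ P) (hyh : y < h.1) :
    ∃ q ∈ P, ∃ r ∈ P, q.1 < y ∧ y < r.1 ∧ ∀ s ∈ P, s.1 ≤ q.1 ∨ r.1 ≤ s.1 := by
  obtain ⟨q, hq, hqmax⟩ := (P.filter (·.1 < y)).exists_max_image Prod.fst ⟨l, by simp [hl, hly]⟩
  obtain ⟨r, hr, hrmin⟩ := (P.filter (y < ·.1)).exists_min_image Prod.fst ⟨h, by simp [hh, hyh]⟩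
  simp only [Finset.mem_filter] at hq hr hqmax hrmin
  refine ⟨q, hq.1, r, hr.1, hq.2, hr.2, fun s hs => ?_⟩
  rcases lt_or_gt_of_ne (hy s hs) with h | h
  · exact Or.inl (hqmax s ⟨hs, h⟩)
  · exact Or.inr (hrmin s ⟨hs, h⟩)

lemma le_iff_le_of_cmp_eq {a b : R₁} {c d : R₂} (h : cmp a b = cmp c d) : a ≤ b ↔ c ≤ d := by
  rw [← not_lt, ← not_lt, lt_iff_lt_of_cmp_eq_cmp (cmp_eq_cmp_symm.1 h)]

lemma compat_of_gap {P : Finset (R₁ × R₂)} (iso : ∀ q ∈ P, Compat P q.1 q.2)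
    {q r : R₁ × R₂} (hq : q ∈ P) (hr : r ∈ P) (hgap : ∀ s ∈ P, s.1 ≤ q.1 ∨ r.1 ≤ s.1)
    {z : R₁} {z' : R₂} (h1 : q.1 < z) (h2 : z < r.1) (h3 : q.2 < z') (h4 : z' < r.2) :
    Compat P z z' := by
  intro s hs
  rcases hgap s hs with h | h
  · have h' : s.2 ≤ q.2 := (le_iff_le_of_cmp_eq (iso q hq s hs)).1 h
    rw [(cmp_eq_lt_iff _ _).2 (h.trans_lt h1), (cmp_eq_lt_iff _ _).2 (h'.trans_lt h3)]
  · have h' : r.2 ≤ s.2 := (le_iff_le_of_cmp_eq (iso s hs r hr)).1 h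
    rw [(cmp_eq_gt_iff _ _).2 (h2.trans_le h), (cmp_eq_gt_iff _ _).2 (h4.trans_le h')]

lemma cmp_eq_of_lt_iff {a b : R₁} {c d : R₂} (h1 : a < b ↔ c < d) (h2 : b < a ↔ d < c) :
    cmp a b = cmp c d := by
  rcases lt_trichotomy a b with h | h | h
  · rw [(cmp_eq_lt_iff _ _).2 h, (cmp_eq_lt_iff _ _).2 (h1.1 h)]
  · have h3 : ¬ c < d := fun h' => (h1.2 h').ne h
    have h4 : ¬ d < c := fun h' => (h2.2 h').ne h.symm
    rw [(cmp_eq_eq_iff _ _).2 h, (cmp_eq_eq_iff _ _).2 (le_antisymm (not_lt.1 h4) (not_lt.1 h3))]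
  · rw [(cmp_eq_gt_iff _ _).2 h, (cmp_eq_gt_iff _ _).2 (h2.1 h)]

end Compat

section Transfer
variable {A : Type*} [CommRing A] {R₁ R₂ : Type*} [Field R₁] [LinearOrder R₁]
  [IsStrictOrderedRing R₁] [Field R₂] [LinearOrder R₂] [IsStrictOrderedRing R₂]

/-- The induction invariant for the comparison of sign tables. -/
structure SignInv (φ₁ : A →+* R₁) (φ₂ : A →+* R₂) (F G : Finset A[X]) (P : Finset (R₁ × R₂)) :
    Prop where
  iso : ∀ q ∈ P, Compat P q.1 q.2
  roots₁ : ∀ g ∈ G, g.map φ₁ ≠ 0 → ∀ x, (g.map φ₁).eval x = 0 → ∃ q ∈ P, q.1 = x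
  roots₂ : ∀ g ∈ G, g.map φ₂ ≠ 0 → ∀ x, (g.map φ₂).eval x = 0 → ∃ q ∈ P, q.2 = x
  sgn : ∀ g ∈ G, ∀ y y', Compat P y y' →
    SignType.sign ((g.map φ₁).eval y) = SignType.sign ((g.map φ₂).eval y')
  src : ∀ q ∈ P,
    (∀ f ∈ F, SignType.sign ((f.map φ₁).eval q.1) = SignType.sign ((f.map φ₂).eval q.2)) ∨
    ∃ g ∈ G, 0 < g.natDegree ∧ φ₁ g.leadingCoeff ≠ 0 ∧ φ₂ g.leadingCoeff ≠ 0 ∧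
      (g.map φ₁).eval q.1 = 0 ∧ (g.map φ₂).eval q.2 = 0
  lo : ∃ l ∈ P, ∀ f ∈ F, ∀ y ≤ l.1, ∀ y' ≤ l.2,
    SignType.sign ((f.map φ₁).eval y) = SignType.sign ((f.map φ₂).eval y') ∧
    (f.map φ₁ ≠ 0 → (f.map φ₁).eval y ≠ 0) ∧ (f.map φ₂ ≠ 0 → (f.map φ₂).eval y' ≠ 0)
  hi : ∃ l ∈ P, ∀ f ∈ F, ∀ y, l.1 ≤ y → ∀ y', l.2 ≤ y' →
    SignType.sign ((f.map φ₁).eval y) = SignType.sign ((f.map φ₂).eval y') ∧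
    (f.map φ₁ ≠ 0 → (f.map φ₁).eval y ≠ 0) ∧ (f.map φ₂ ≠ 0 → (f.map φ₂).eval y' ≠ 0)

variable {φ₁ : A →+* R₁} {φ₂ : A →+* R₂} {F G : Finset A[X]} {P : Finset (R₁ × R₂)}

omit [IsStrictOrderedRing R₁] [IsStrictOrderedRing R₂] in
lemma SignInv.swap (h : SignInv φ₁ φ₂ F G P) : SignInv φ₂ φ₁ F G (swapPairs P) where
  iso q hq := (h.iso _ (mem_swapPairs.1 hq)).swap
  roots₁ g hg h0 x hx := by
    obtain ⟨q, hq, rfl⟩ := h.roots₂ g hg h0 x hx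
    exact ⟨(q.2, q.1), mem_swapPairs.2 hq, rfl⟩
  roots₂ g hg h0 x hx := by
    obtain ⟨q, hq, rfl⟩ := h.roots₁ g hg h0 x hx
    exact ⟨(q.2, q.1), mem_swapPairs.2 hq, rfl⟩
  sgn g hg y y' hy := (h.sgn g hg y' y (fun s hs =>
    (hy (s.2, s.1) (mem_swapPairs.2 hs)).symm)).symm
  src q hq := by
    rcases h.src _ (mem_swapPairs.1 hq) with h1 | ⟨g, hg, h1, h2, h3, h4, h5⟩
    · exact Or.inl fun f hf => (h1 f hf).symm
    · exact Or.inr ⟨g, hg, h1, h3, h2, h5, h4⟩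
  lo := by
    obtain ⟨l, hl, h1⟩ := h.lo
    refine ⟨(l.2, l.1), mem_swapPairs.2 hl, fun f hf y hy y' hy' => ?_⟩
    obtain ⟨h2, h3, h4⟩ := h1 f hf y' hy' y hy
    exact ⟨h2.symm, h4, h3⟩
  hi := by
    obtain ⟨l, hl, h1⟩ := h.hi
    refine ⟨(l.2, l.1), mem_swapPairs.2 hl, fun f hf y hy y' hy' => ?_⟩
    obtain ⟨h2, h3, h4⟩ := h1 f hf y' hy' y hy
    exact ⟨h2.symm, h4, h3⟩

lemma sign_pow_mul {R : Type*} [Field R] [LinearOrder R] [IsStrictOrderedRing R] {a : R}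
    (ha : a ≠ 0) (k : ℕ) (x : R) : SignType.sign (a ^ (2 * k) * x) = SignType.sign x := by
  rw [sign_mul, sign_pos ((even_two_mul k).pow_pos ha), one_mul]

/-- Signs agree at the pairs of `P` for the next polynomial. -/
lemma SignInv.sign_next (h : SignInv φ₁ φ₂ F G P) (hF : SignClosed F) (hGF : G ⊆ F) {p : A[X]}
    (hp : p ∈ F) (hlow : ∀ f ∈ F, f.natDegree < p.natDegree → f ∈ G)
    (hhigh : ∀ f ∈ G, f.natDegree ≤ p.natDegree) {q : R₁ × R₂} (hq : q ∈ P) :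
    SignType.sign ((p.map φ₁).eval q.1) = SignType.sign ((p.map φ₂).eval q.2) := by
  rcases h.src q hq with h1 | ⟨g, hg, hd, hl1, hl2, hr1, hr2⟩
  · exact h1 p hp
  obtain ⟨k, u, r, h1, h2, h3⟩ := hF.rem p hp g (hGF hg) hd (hhigh g hg)
  have hrG := hlow r h3 (h2.trans_le (hhigh g hg))
  have e1 : φ₁ g.leadingCoeff ^ (2 * k) * (p.map φ₁).eval q.1 = (r.map φ₁).eval q.1 := by
    have := congrArg (fun f => (f.map φ₁).eval q.1) h1
    simpa [hr1] using this
  have e2 : φ₂ g.leadingCoeff ^ (2 * k) * (p.map φ₂).eval q.2 = (r.map φ₂).eval q.2 := by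
    have := congrArg (fun f => (f.map φ₂).eval q.2) h1
    simpa [hr2] using this
  rw [← sign_pow_mul hl1 k, ← sign_pow_mul hl2 k, e1, e2]
  exact h.sgn r hrG _ _ (h.iso q hq)

/-- Facts about `p` and its derivative relative to a root table of lower degree polynomials. -/
lemma SignInv.exists_root (hR₁ : PolyIVT R₁) (hR₂ : PolyIVT R₂) (h : SignInv φ₁ φ₂ F G P)
    (hF : SignClosed F) (hGF : G ⊆ F) {p : A[X]}
    (hp : p ∈ F) (hlow : ∀ f ∈ F, f.natDegree < p.natDegree → f ∈ G)
    (hhigh : ∀ f ∈ G, f.natDegree ≤ p.natDegree) (hd : 0 < p.natDegree)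
    (hlc : φ₁ p.leadingCoeff ≠ 0) {x : R₁} (hx : (p.map φ₁).eval x = 0)
    (hxP : ∀ s ∈ P, s.1 ≠ x) :
    ∃ x', (p.map φ₂).eval x' = 0 ∧ Compat P x x' := by
  have hp0 : p.map φ₁ ≠ 0 := by
    intro h0
    have := congrArg (fun f => f.coeff p.natDegree) h0
    simp only [coeff_map, coeff_zero] at this
    exact hlc this
  have hder : (derivative p).map φ₁ ≠ 0 := by
    rw [← derivative_map]
    intro h0
    have := derivative_eq_zero.1 h0
    rw [natDegree_map_of_leadingCoeff_ne_zero _ hlc] at this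
    lia
  have hdG := hlow _ (hF.der p hp hd) (natDegree_derivative_lt hd.ne')
  obtain ⟨l, hl, hlo⟩ := h.lo
  obtain ⟨u, hu, hhi⟩ := h.hi
  have hlx : l.1 < x := by
    by_contra! hcon
    exact (hlo p hp x hcon l.2 le_rfl).2.1 hp0 hx
  have hxu : x < u.1 := by
    by_contra! hcon
    exact (hhi p hp x hcon u.2 le_rfl).2.1 hp0 hx
  obtain ⟨q, hq, r, hr, hqx, hxr, hgap⟩ := exists_gap P hxP hl hlx hu hxu
  have hneg := sign_change_of_root hR₁ hp0 hqx hxr hx (fun z h1 h2 h3 => by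
    rw [derivative_map] at h3
    obtain ⟨s, hs, rfl⟩ := h.roots₁ _ hdG hder z h3
    rcases hgap s hs with h4 | h4
    · exact absurd h1 (not_lt.2 h4)
    · exact absurd h2 (not_lt.2 h4))
  have hneg' : (p.map φ₂).eval q.2 * (p.map φ₂).eval r.2 < 0 := by
    rw [← sign_eq_neg_one_iff, sign_mul] at hneg ⊢
    rwa [h.sign_next hF hGF hp hlow hhigh hq, h.sign_next hF hGF hp hlow hhigh hr] at hneg
  have hqr : q.2 < r.2 := (lt_iff_lt_of_cmp_eq_cmp (h.iso r hr q hq)).1 (hqx.trans hxr)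
  obtain ⟨x', h1, h2, h3⟩ := hR₂ _ _ _ hqr hneg'
  exact ⟨x', h3, compat_of_gap h.iso hq hr hgap hqx hxr h1 h2⟩

omit [IsStrictOrderedRing R₂] in
/-- Between two roots of `p` lies a point of the table. -/
lemma SignInv.exists_between (hR₁ : PolyIVT R₁) (h : SignInv φ₁ φ₂ F G P) {p : A[X]}
    (hp0 : p.map φ₁ ≠ 0) (hdG : derivative p ∈ G) (hder : (derivative p).map φ₁ ≠ 0)
    {x z : R₁} (hxz : x < z)
    (hx : (p.map φ₁).eval x = 0) (hz : (p.map φ₁).eval z = 0) : ∃ s ∈ P, x < s.1 ∧ s.1 < z := by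
  obtain ⟨c, h1, h2, h3⟩ := polyRolle hR₁ hp0 hxz hx hz
  rw [derivative_map] at h3
  obtain ⟨s, hs, rfl⟩ := h.roots₁ _ hdG hder c h3
  exact ⟨s, hs, h1, h2⟩

lemma map_ne_zero_of_lc {R : Type*} [Field R] [CharZero R] (φ : A →+* R) {p : A[X]}
    (hd : 0 < p.natDegree)
    (hlc : φ p.leadingCoeff ≠ 0) : p.map φ ≠ 0 ∧ (derivative p).map φ ≠ 0 := by
  constructor
  · intro h0
    have := congrArg (fun f => f.coeff p.natDegree) h0
    simp only [coeff_map, coeff_zero] at this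
    exact hlc this
  · rw [← derivative_map]
    intro h0
    have := derivative_eq_zero.1 h0
    rw [natDegree_map_of_leadingCoeff_ne_zero _ hlc] at this
    lia

open Classical in
lemma SignInv.insert_main (hR₁ : PolyIVT R₁) (hR₂ : PolyIVT R₂) (h : SignInv φ₁ φ₂ F G P)
    (hF : SignClosed F) (hGF : G ⊆ F) {p : A[X]}
    (hp : p ∈ F) (hlow : ∀ f ∈ F, f.natDegree < p.natDegree → f ∈ G)
    (hhigh : ∀ f ∈ G, f.natDegree ≤ p.natDegree) (hd : 0 < p.natDegree)
    (hlc₁ : φ₁ p.leadingCoeff ≠ 0) (hlc₂ : φ₂ p.leadingCoeff ≠ 0) :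
    ∃ P', SignInv φ₁ φ₂ F (insert p G) P' := by
  obtain ⟨hp1, hder1⟩ := map_ne_zero_of_lc φ₁ hd hlc₁
  obtain ⟨hp2, hder2⟩ := map_ne_zero_of_lc φ₂ hd hlc₂
  have hdG := hlow _ (hF.der p hp hd) (natDegree_derivative_lt hd.ne')
  set N := ((p.map φ₁).roots.toFinset ×ˢ (p.map φ₂).roots.toFinset).filter
    (fun s => Compat P s.1 s.2) with hN
  have memN : ∀ s, s ∈ N ↔
      ((p.map φ₁).eval s.1 = 0 ∧ (p.map φ₂).eval s.2 = 0) ∧ Compat P s.1 s.2 := by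
    intro s
    simp [hN, hp1, hp2]
  have hPN : P ⊆ P ∪ N := Finset.subset_union_left
  have sub : ∀ g ∈ G, g ∈ insert p G := fun g hg => Finset.mem_insert_of_mem hg
  have lt_of_lt₁ : ∀ s ∈ N, ∀ t ∈ N, s.1 < t.1 → s.2 < t.2 := by
    intro s hs t ht hst
    rw [memN] at hs ht
    obtain ⟨u, hu, h1, h2⟩ := h.exists_between hR₁ hp1 hdG hder1 hst hs.1.1 ht.1.1
    exact ((lt_iff_lt_of_cmp_eq_cmp (cmp_eq_cmp_symm.1 (hs.2 u hu))).1 h1).trans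
      ((lt_iff_lt_of_cmp_eq_cmp (ht.2 u hu)).1 h2)
  have lt_of_lt₂ : ∀ s ∈ N, ∀ t ∈ N, s.2 < t.2 → s.1 < t.1 := by
    intro s hs t ht hst
    rw [memN] at hs ht
    obtain ⟨u, hu, h1, h2⟩ := h.swap.exists_between hR₂ hp2 hdG hder2 hst hs.1.2 ht.1.2
    rw [mem_swapPairs] at hu
    exact ((lt_iff_lt_of_cmp_eq_cmp (cmp_eq_cmp_symm.1 (hs.2 _ hu))).2 h1).trans
      ((lt_iff_lt_of_cmp_eq_cmp (ht.2 _ hu)).2 h2)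
  have iso : ∀ q ∈ P ∪ N, Compat (P ∪ N) q.1 q.2 := by
    intro q hq s hs
    rcases Finset.mem_union.1 hq with hq | hq <;> rcases Finset.mem_union.1 hs with hs | hs
    · exact h.iso q hq s hs
    · exact cmp_eq_cmp_symm.1 (((memN s).1 hs).2 q hq)
    · exact ((memN q).1 hq).2 s hs
    · exact cmp_eq_of_lt_iff ⟨lt_of_lt₁ _ hs _ hq, lt_of_lt₂ _ hs _ hq⟩
        ⟨lt_of_lt₁ _ hq _ hs, lt_of_lt₂ _ hq _ hs⟩
  have hroots₁ : ∀ x, (p.map φ₁).eval x = 0 → ∃ q ∈ P ∪ N, q.1 = x := by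
    intro x hx
    by_cases hxP : ∃ q ∈ P, q.1 = x
    · obtain ⟨q, hq, rfl⟩ := hxP
      exact ⟨q, hPN hq, rfl⟩
    · push Not at hxP
      obtain ⟨x', h1, h2⟩ := h.exists_root hR₁ hR₂ hF hGF hp hlow hhigh hd hlc₁ hx hxP
      exact ⟨(x, x'), Finset.mem_union_right _ ((memN _).2 ⟨⟨hx, h1⟩, h2⟩), rfl⟩
  have hroots₂ : ∀ x, (p.map φ₂).eval x = 0 → ∃ q ∈ P ∪ N, q.2 = x := by
    intro x hx
    by_cases hxP : ∃ q ∈ P, q.2 = x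
    · obtain ⟨q, hq, rfl⟩ := hxP
      exact ⟨q, hPN hq, rfl⟩
    · push Not at hxP
      obtain ⟨x', h1, h2⟩ := h.swap.exists_root hR₂ hR₁ hF hGF hp hlow hhigh hd hlc₂ hx
        (fun s hs => hxP _ (mem_swapPairs.1 hs))
      refine ⟨(x', x), Finset.mem_union_right _ ((memN _).2 ⟨⟨h1, hx⟩, fun s hs => ?_⟩), rfl⟩
      exact (h2 (s.2, s.1) (mem_swapPairs.2 hs)).symm
  have sgnP : ∀ q ∈ P ∪ N,
      SignType.sign ((p.map φ₁).eval q.1) = SignType.sign ((p.map φ₂).eval q.2) := by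
    intro q hq
    rcases Finset.mem_union.1 hq with hq | hq
    · exact h.sign_next hF hGF hp hlow hhigh hq
    · rw [((memN q).1 hq).1.1, ((memN q).1 hq).1.2]
      simp
  refine ⟨P ∪ N, iso, ?_, ?_, ?_, ?_, ?_, ?_⟩
  · intro g hg hg0 x hx
    rcases Finset.mem_insert.1 hg with rfl | hg
    · exact hroots₁ x hx
    · obtain ⟨q, hq, h1⟩ := h.roots₁ g hg hg0 x hx
      exact ⟨q, hPN hq, h1⟩
  · intro g hg hg0 x hx
    rcases Finset.mem_insert.1 hg with rfl | hg
    · exact hroots₂ x hx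
    · obtain ⟨q, hq, h1⟩ := h.roots₂ g hg hg0 x hx
      exact ⟨q, hPN hq, h1⟩
  · intro g hg y y' hy
    rcases Finset.mem_insert.1 hg with rfl | hg
    swap
    · exact h.sgn g hg y y' (hy.mono hPN)
    obtain ⟨l, hl, hlo⟩ := h.lo
    obtain ⟨u, hu, hhi⟩ := h.hi
    by_cases hyl : y ≤ l.1
    · exact (hlo g hp y hyl y' ((le_iff_le_of_cmp_eq (cmp_eq_cmp_symm.1 (hy l (hPN hl)))).1 hyl)).1
    by_cases hyu : u.1 ≤ y
    · exact (hhi g hp y hyu y' ((le_iff_le_of_cmp_eq (hy u (hPN hu))).1 hyu)).1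
    by_cases hyP : ∃ q ∈ P ∪ N, q.1 = y
    · obtain ⟨q, hq, rfl⟩ := hyP
      have : q.2 = y' := (eq_iff_eq_of_cmp_eq_cmp (hy q hq)).1 rfl
      rw [← this]
      exact sgnP q hq
    push Not at hyl hyu hyP
    obtain ⟨q, hq, r, hr, hqy, hyr, hgap⟩ := exists_gap _ hyP (hPN hl) hyl (hPN hu) hyu
    have hqy' : q.2 < y' := (lt_iff_lt_of_cmp_eq_cmp (hy q hq)).1 hqy
    have hyr' : y' < r.2 := (lt_iff_lt_of_cmp_eq_cmp (cmp_eq_cmp_symm.1 (hy r hr))).1 hyr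
    have noroot₁ : ∀ x, q.1 < x → x < r.1 → (g.map φ₁).eval x ≠ 0 := by
      intro x h1 h2 h3
      obtain ⟨s, hs, rfl⟩ := hroots₁ x h3
      rcases hgap s hs with h4 | h4
      · exact absurd h1 (not_lt.2 h4)
      · exact absurd h2 (not_lt.2 h4)
    have noroot₂ : ∀ x, q.2 < x → x < r.2 → (g.map φ₂).eval x ≠ 0 := by
      intro x h1 h2 h3
      obtain ⟨s, hs, rfl⟩ := hroots₂ x h3
      rcases hgap s hs with h4 | h4
      · exact absurd h1 (not_lt.2 ((le_iff_le_of_cmp_eq (iso q hq s hs)).1 h4))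
      · exact absurd h2 (not_lt.2 ((le_iff_le_of_cmp_eq (iso s hs r hr)).1 h4))
    by_cases hq0 : (g.map φ₁).eval q.1 = 0
    · have hr0 : (g.map φ₁).eval r.1 ≠ 0 := by
        intro hr0
        obtain ⟨s, hs, h1, h2⟩ := h.exists_between hR₁ hp1 hdG hder1 (hqy.trans hyr) hq0 hr0
        rcases hgap s (hPN hs) with h4 | h4
        · exact absurd h1 (not_lt.2 h4)
        · exact absurd h2 (not_lt.2 h4)
      have hr0' : (g.map φ₂).eval r.2 ≠ 0 := by
        rw [← sign_ne_zero, ← sgnP r hr]; simpa using hr0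
      rw [sign_eq_of_no_root hR₁ hyr.le, sign_eq_of_no_root hR₂ hyr'.le, sgnP r hr]
      · intro x h1 h2
        rcases h2.eq_or_lt with rfl | h2
        · exact hr0'
        · exact noroot₂ x (hqy'.trans_le h1) h2
      · intro x h1 h2
        rcases h2.eq_or_lt with rfl | h2
        · exact hr0
        · exact noroot₁ x (hqy.trans_le h1) h2
    · have hq0' : (g.map φ₂).eval q.2 ≠ 0 := by
        rw [← sign_ne_zero, ← sgnP q hq]; simpa using hq0
      rw [← sign_eq_of_no_root hR₁ hqy.le, ← sign_eq_of_no_root hR₂ hqy'.le, sgnP q hq]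
      · intro x h1 h2
        rcases h1.eq_or_lt with rfl | h1
        · exact hq0'
        · exact noroot₂ x h1 (h2.trans_lt hyr')
      · intro x h1 h2
        rcases h1.eq_or_lt with rfl | h1
        · exact hq0
        · exact noroot₁ x h1 (h2.trans_lt hyr)
  · intro q hq
    rcases Finset.mem_union.1 hq with hq | hq
    · refine (h.src q hq).imp id ?_
      rintro ⟨g, hg, h1⟩
      exact ⟨g, sub g hg, h1⟩
    · exact Or.inr ⟨p, Finset.mem_insert_self _ _, hd, hlc₁, hlc₂, ((memN q).1 hq).1⟩
  · obtain ⟨l, hl, h1⟩ := h.lo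
    exact ⟨l, hPN hl, h1⟩
  · obtain ⟨l, hl, h1⟩ := h.hi
    exact ⟨l, hPN hl, h1⟩

open Classical in
lemma SignInv.insert_step (hR₁ : PolyIVT R₁) (hR₂ : PolyIVT R₂) (h : SignInv φ₁ φ₂ F G P)
    (hF : SignClosed F) (hGF : G ⊆ F)
    (hcoeff : ∀ f ∈ F, ∀ i, SignType.sign (φ₁ (f.coeff i)) = SignType.sign (φ₂ (f.coeff i)))
    {p : A[X]} (hp : p ∈ F) (hlow : ∀ f ∈ F, f.natDegree < p.natDegree → f ∈ G)
    (hhigh : ∀ f ∈ G, f.natDegree ≤ p.natDegree) :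
    ∃ P', SignInv φ₁ φ₂ F (insert p G) P' := by
  have trivial_case : (∀ y y', Compat P y y' →
      SignType.sign ((p.map φ₁).eval y) = SignType.sign ((p.map φ₂).eval y')) →
      (p.map φ₁ ≠ 0 → ∀ x, (p.map φ₁).eval x = 0 → ∃ q ∈ P, q.1 = x) →
      (p.map φ₂ ≠ 0 → ∀ x, (p.map φ₂).eval x = 0 → ∃ q ∈ P, q.2 = x) →
      SignInv φ₁ φ₂ F (insert p G) P := by
    intro h1 h2 h3
    refine ⟨h.iso, ?_, ?_, ?_, ?_, h.lo, h.hi⟩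
    · intro g hg
      rcases Finset.mem_insert.1 hg with rfl | hg
      · exact h2
      · exact h.roots₁ g hg
    · intro g hg
      rcases Finset.mem_insert.1 hg with rfl | hg
      · exact h3
      · exact h.roots₂ g hg
    · intro g hg
      rcases Finset.mem_insert.1 hg with rfl | hg
      · exact h1
      · exact h.sgn g hg
    · intro q hq
      refine (h.src q hq).imp id ?_
      rintro ⟨g, hg, h1⟩
      exact ⟨g, Finset.mem_insert_of_mem hg, h1⟩
  by_cases hd : 0 < p.natDegree
  swap
  · obtain ⟨c, rfl⟩ := natDegree_eq_zero.1 (Nat.eq_zero_of_not_pos hd)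
    refine ⟨P, trivial_case ?_ ?_ ?_⟩
    · intro y y' _
      simpa using hcoeff _ hp 0
    · intro h1 x hx
      simp only [map_C, eval_C] at hx
      simp [hx] at h1
    · intro h1 x hx
      simp only [map_C, eval_C] at hx
      simp [hx] at h1
  have hsgn := hcoeff p hp p.natDegree
  by_cases hlc : φ₁ p.leadingCoeff = 0
  · have hlc2 : φ₂ p.leadingCoeff = 0 := by
      rw [← sign_eq_zero_iff]
      rw [← sign_eq_zero_iff] at hlc
      exact hsgn.symm.trans hlc
    have hE : p.eraseLead ∈ G := by
      refine hlow _ (hF.erase p hp hd) ?_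
      rcases eraseLead_natDegree_lt_or_eraseLead_eq_zero p with h | h
      · exact h
      · rw [h]; simpa using hd
    have e1 : p.map φ₁ = p.eraseLead.map φ₁ := by
      have := congrArg (map φ₁) (eraseLead_add_C_mul_X_pow p)
      rw [Polynomial.map_add, Polynomial.map_mul, map_C, hlc, map_zero, zero_mul, add_zero] at this
      exact this.symm
    have e2 : p.map φ₂ = p.eraseLead.map φ₂ := by
      have := congrArg (map φ₂) (eraseLead_add_C_mul_X_pow p)
      rw [Polynomial.map_add, Polynomial.map_mul, map_C, hlc2, map_zero, zero_mul, add_zero] at this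
      exact this.symm
    refine ⟨P, trivial_case ?_ ?_ ?_⟩
    · rw [e1, e2]; exact h.sgn _ hE
    · rw [e1]; exact h.roots₁ _ hE
    · rw [e2]; exact h.roots₂ _ hE
  · have hlc2 : φ₂ p.leadingCoeff ≠ 0 := by
      intro h0
      rw [← sign_eq_zero_iff] at h0 hlc
      exact hlc (hsgn.trans h0)
    exact h.insert_main hR₁ hR₂ hF hGF hp hlow hhigh hd hlc hlc2

omit [IsStrictOrderedRing R₁] [IsStrictOrderedRing R₂] in
lemma natDegree_map_eq_of_sign (φ₁ : A →+* R₁) (φ₂ : A →+* R₂) {f : A[X]}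
    (hcoeff : ∀ i, SignType.sign (φ₁ (f.coeff i)) = SignType.sign (φ₂ (f.coeff i))) :
    (f.map φ₁).natDegree = (f.map φ₂).natDegree := by
  have key : ∀ i, (f.map φ₁).coeff i = 0 ↔ (f.map φ₂).coeff i = 0 := by
    intro i
    rw [coeff_map, coeff_map, ← sign_eq_zero_iff, hcoeff i, sign_eq_zero_iff]
  apply le_antisymm
  · exact natDegree_le_iff_coeff_eq_zero.2 fun N hN =>
      (key N).2 (coeff_eq_zero_of_natDegree_lt hN)
  · exact natDegree_le_iff_coeff_eq_zero.2 fun N hN =>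
      (key N).1 (coeff_eq_zero_of_natDegree_lt hN)

lemma exists_common_bound {R : Type*} [Field R] [LinearOrder R] [IsStrictOrderedRing R]
    (φ : A →+* R) (F : Finset A[X]) : ∃ M : R, 0 < M ∧ ∀ f ∈ F,
      (∀ x, M ≤ x → SignType.sign ((f.map φ).eval x) =
        SignType.sign (f.map φ).leadingCoeff) ∧
      ∀ x, x ≤ -M → SignType.sign ((f.map φ).eval x) =
        SignType.sign ((-1) ^ (f.map φ).natDegree * (f.map φ).leadingCoeff) := by
  classical
  choose M hM using fun f : A[X] => exists_sign_ends (f.map φ)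
  obtain ⟨N, hN⟩ := (F.image M).exists_le
  refine ⟨max N 1, by simp, fun f hf => hM f _ ?_⟩
  exact (hN _ (Finset.mem_image_of_mem M hf)).trans (le_max_left _ _)

lemma exists_initial_signInv
    (hcoeff : ∀ f ∈ F, ∀ i, SignType.sign (φ₁ (f.coeff i)) = SignType.sign (φ₂ (f.coeff i))) :
    ∃ P, SignInv φ₁ φ₂ F ∅ P := by
  classical
  obtain ⟨M₁, hM₁0, hM₁⟩ := exists_common_bound φ₁ F
  obtain ⟨M₂, hM₂0, hM₂⟩ := exists_common_bound φ₂ F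
  have hlc : ∀ f ∈ F, SignType.sign (f.map φ₁).leadingCoeff =
      SignType.sign (f.map φ₂).leadingCoeff := by
    intro f hf
    rw [leadingCoeff, leadingCoeff, natDegree_map_eq_of_sign φ₁ φ₂ (hcoeff f hf), coeff_map,
      coeff_map]
    exact hcoeff f hf _
  have hlo : ∀ f ∈ F, ∀ y ≤ -M₁, ∀ y' ≤ -M₂,
      SignType.sign ((f.map φ₁).eval y) = SignType.sign ((f.map φ₂).eval y') ∧
      (f.map φ₁ ≠ 0 → (f.map φ₁).eval y ≠ 0) ∧ (f.map φ₂ ≠ 0 → (f.map φ₂).eval y' ≠ 0) := by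
    intro f hf y hy y' hy'
    have e1 := (hM₁ f hf).2 y hy
    have e2 := (hM₂ f hf).2 y' hy'
    refine ⟨?_, fun h => ?_, fun h => ?_⟩
    · rw [e1, e2, natDegree_map_eq_of_sign φ₁ φ₂ (hcoeff f hf), sign_mul, sign_mul, hlc f hf,
        sign_pow, sign_pow]
      simp
    · rw [← sign_ne_zero, e1]
      simp [h]
    · rw [← sign_ne_zero, e2]
      simp [h]
  have hhi : ∀ f ∈ F, ∀ y, M₁ ≤ y → ∀ y', M₂ ≤ y' →
      SignType.sign ((f.map φ₁).eval y) = SignType.sign ((f.map φ₂).eval y') ∧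
      (f.map φ₁ ≠ 0 → (f.map φ₁).eval y ≠ 0) ∧ (f.map φ₂ ≠ 0 → (f.map φ₂).eval y' ≠ 0) := by
    intro f hf y hy y' hy'
    have e1 := (hM₁ f hf).1 y hy
    have e2 := (hM₂ f hf).1 y' hy'
    refine ⟨?_, fun h => ?_, fun h => ?_⟩
    · rw [e1, e2, hlc f hf]
    · rw [← sign_ne_zero, e1]
      simp [h]
    · rw [← sign_ne_zero, e2]
      simp [h]
  refine ⟨{(-M₁, -M₂), (M₁, M₂)}, ?_, by simp, by simp, by simp, ?_,
    ⟨(-M₁, -M₂), by simp, hlo⟩, ⟨(M₁, M₂), by simp, hhi⟩⟩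
  · have h1 : -M₁ < M₁ := by linarith
    have h2 : -M₂ < M₂ := by linarith
    intro q hq s hs
    simp only [Finset.mem_insert, Finset.mem_singleton] at hq hs
    rcases hq with rfl | rfl <;> rcases hs with rfl | rfl
    · simp
    · rw [(cmp_eq_gt_iff _ _).2 h1, (cmp_eq_gt_iff _ _).2 h2]
    · rw [(cmp_eq_lt_iff _ _).2 h1, (cmp_eq_lt_iff _ _).2 h2]
    · simp
  · intro q hq
    left
    simp only [Finset.mem_insert, Finset.mem_singleton] at hq
    rcases hq with rfl | rfl
    · exact fun f hf => (hlo f hf _ le_rfl _ le_rfl).1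
    · exact fun f hf => (hhi f hf _ le_rfl _ le_rfl).1

/-- One-variable transfer for a closed family. -/
lemma exists_same_signs (hR₁ : PolyIVT R₁) (hR₂ : PolyIVT R₂) (hF : SignClosed F)
    (hcoeff : ∀ f ∈ F, ∀ i, SignType.sign (φ₁ (f.coeff i)) = SignType.sign (φ₂ (f.coeff i)))
    (y : R₁) : ∃ y' : R₂, ∀ f ∈ F,
      SignType.sign ((f.map φ₁).eval y) = SignType.sign ((f.map φ₂).eval y') := by
  classical
  have main : ∀ G : Finset A[X], G ⊆ F →
      (∀ f ∈ F, ∀ g ∈ G, f.natDegree < g.natDegree → f ∈ G) → ∃ P, SignInv φ₁ φ₂ F G P := by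
    intro G
    refine Finset.induction_on_max_value natDegree G
      (fun _ _ => exists_initial_signInv hcoeff) ?_
    · intro a s has hmax ih hsF hdown
      obtain ⟨P, hP⟩ := ih ((Finset.subset_insert _ _).trans hsF) (by
        intro f hf g hg hfg
        have := hdown f hf g (Finset.mem_insert_of_mem hg) hfg
        rcases Finset.mem_insert.1 this with rfl | h
        · exact absurd (hmax g hg) (not_le.2 hfg)
        · exact h)
      obtain ⟨P', hP'⟩ := hP.insert_step hR₁ hR₂ hF ((Finset.subset_insert _ _).trans hsF) hcoeff
        (hsF (Finset.mem_insert_self a s)) (by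
          intro f hf hfa
          rcases Finset.mem_insert.1 (hdown f hf a (Finset.mem_insert_self a s) hfa) with rfl | h
          · exact absurd hfa (lt_irrefl _)
          · exact h) hmax
      exact ⟨P', by convert hP'⟩
  obtain ⟨P, hP⟩ := main F subset_rfl (fun f hf _ _ _ => hf)
  obtain ⟨y', hy'⟩ := Order.PartialIso.exists_across
    (⟨P, fun p hp q hq => hP.iso q hq p hp⟩ : Order.PartialIso R₁ R₂) y
  exact ⟨y', fun f hf => hP.sgn f hf y y' fun s hs => hy' s hs⟩

end Transfer

/-- One-variable transfer: finitely many base conditions control the sign vectors attained. -/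
lemma exists_transfer_base {A : Type*} [CommRing A] (F : Finset A[X]) :
    ∃ B : Finset A, ∀ (R₁ R₂ : Type) [Field R₁] [LinearOrder R₁] [IsStrictOrderedRing R₁]
      [Field R₂] [LinearOrder R₂] [IsStrictOrderedRing R₂] (_ : PolyIVT R₁) (_ : PolyIVT R₂)
      (φ₁ : A →+* R₁) (φ₂ : A →+* R₂),
      (∀ b ∈ B, SignType.sign (φ₁ b) = SignType.sign (φ₂ b)) → ∀ y : R₁, ∃ y' : R₂, ∀ f ∈ F,
        SignType.sign (f.eval₂ φ₁ y) = SignType.sign (f.eval₂ φ₂ y') := by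
  classical
  obtain ⟨F', hFF', hF'⟩ := exists_signClosed F
  refine ⟨F'.biUnion (fun f => f.coeffs ∪ {0}), ?_⟩
  intro R₁ R₂ _ _ _ _ _ _ hR₁ hR₂ φ₁ φ₂ hB y
  obtain ⟨y', hy'⟩ := exists_same_signs (φ₁ := φ₁) (φ₂ := φ₂) hR₁ hR₂ hF' (by
    intro f hf i
    apply hB
    rw [Finset.mem_biUnion]
    refine ⟨f, hf, ?_⟩
    by_cases h0 : f.coeff i = 0
    · simp [h0]
    · exact Finset.mem_union_left _ (coeff_mem_coeffs h0)) y
  refine ⟨y', fun f hf => ?_⟩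
  rw [← eval_map, ← eval_map]
  exact hy' f (hFF' hf)

end

section

lemma eval₂Hom_cons {A R : Type*} [CommRing A] [CommRing R] {k : ℕ} (φ : A →+* R) (y : R)
    (x : Fin k → R) (f : MvPolynomial (Fin (k + 1)) A) :
    MvPolynomial.eval₂Hom φ (Fin.cons y x : Fin (k + 1) → R) f =
      (MvPolynomial.finSuccEquiv A k f).eval₂ (MvPolynomial.eval₂Hom φ x) y := by
  have : MvPolynomial.eval₂Hom φ (Fin.cons y x : Fin (k + 1) → R) =
      (Polynomial.eval₂RingHom (MvPolynomial.eval₂Hom φ x) y).comp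
        (MvPolynomial.finSuccEquiv A k : MvPolynomial (Fin (k + 1)) A →+* _) := by
    apply MvPolynomial.ringHom_ext
    · intro a
      simp [MvPolynomial.finSuccEquiv_apply]
    · intro i
      refine Fin.cases ?_ (fun j => ?_) i
      · simp [MvPolynomial.finSuccEquiv_apply]
      · simp [MvPolynomial.finSuccEquiv_apply]
  rw [this]
  rfl

lemma exists_transfer_base_mv {A : Type*} [CommRing A] (k : ℕ)
    (F : Finset (MvPolynomial (Fin k) A)) :
    ∃ B : Finset A, ∀ (R₁ R₂ : Type) [Field R₁] [LinearOrder R₁] [IsStrictOrderedRing R₁]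
      [Field R₂] [LinearOrder R₂] [IsStrictOrderedRing R₂] (_ : PolyIVT R₁) (_ : PolyIVT R₂)
      (φ₁ : A →+* R₁) (φ₂ : A →+* R₂),
      (∀ b ∈ B, SignType.sign (φ₁ b) = SignType.sign (φ₂ b)) → ∀ x : Fin k → R₁,
        ∃ x' : Fin k → R₂, ∀ f ∈ F, SignType.sign (MvPolynomial.eval₂Hom φ₁ x f) =
          SignType.sign (MvPolynomial.eval₂Hom φ₂ x' f) := by
  classical
  induction k with
  | zero =>
    refine ⟨F.image (fun f => f.coeff 0), ?_⟩
    intro R₁ R₂ _ _ _ _ _ _ _ _ φ₁ φ₂ hB x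
    refine ⟨Fin.elim0, fun f hf => ?_⟩
    have := hB _ (Finset.mem_image_of_mem _ hf)
    rw [MvPolynomial.eq_C_of_isEmpty f]
    simpa using this
  | succ k ih =>
    obtain ⟨B', hB'⟩ := exists_transfer_base (F.image (MvPolynomial.finSuccEquiv A k))
    obtain ⟨B, hB⟩ := ih B'
    refine ⟨B, ?_⟩
    intro R₁ R₂ _ _ _ _ _ _ hR₁ hR₂ φ₁ φ₂ hφ x
    obtain ⟨x', hx'⟩ := hB R₁ R₂ hR₁ hR₂ φ₁ φ₂ hφ (Fin.tail x)
    obtain ⟨y', hy'⟩ := hB' R₁ R₂ hR₁ hR₂ _ _ hx' (x 0)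
    refine ⟨Fin.cons y' x', fun f hf => ?_⟩
    rw [← Fin.cons_self_tail x, eval₂Hom_cons, eval₂Hom_cons]
    exact hy' _ (Finset.mem_image_of_mem _ hf)

lemma polyIVT_real : PolyIVT ℝ := by
  intro p a b hab h
  rcases mul_neg_iff.1 h with ⟨h1, h2⟩ | ⟨h1, h2⟩
  · obtain ⟨c, hc, h3⟩ := intermediate_value_Ioo' hab.le p.continuousOn ⟨h2, h1⟩
    exact ⟨c, hc.1, hc.2, h3⟩
  · obtain ⟨c, hc, h3⟩ := intermediate_value_Ioo hab.le p.continuousOn ⟨h1, h2⟩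
    exact ⟨c, hc.1, hc.2, h3⟩

lemma sign_ringHom_real {K : Type*} [Field K] [LinearOrder K] [IsStrictOrderedRing K]
    (φ : ℝ →+* K) (r : ℝ) : SignType.sign (φ r) = SignType.sign r := by
  have pos : ∀ r : ℝ, 0 < r → 0 < φ r := by
    intro r hr
    rw [← Real.mul_self_sqrt hr.le, map_mul]
    exact mul_self_pos.2 ((map_ne_zero φ).2 (Real.sqrt_pos.2 hr).ne')
  rcases lt_trichotomy r 0 with h | rfl | h
  · have := pos (-r) (by linarith)
    rw [map_neg, neg_pos] at this
    rw [sign_neg h, sign_neg this]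
  · simp
  · rw [sign_pos h, sign_pos (pos r h)]

/-- Transfer of solutions of polynomial sign conditions to the reals. -/
theorem exists_real_point {K : Type} [Field K] [LinearOrder K] [IsStrictOrderedRing K]
    (hK : PolyIVT K) (φ : ℝ →+* K) {ι : Type*} [Finite ι] (F : Finset (MvPolynomial ι ℝ))
    (x : ι → K) : ∃ x' : ι → ℝ, ∀ f ∈ F,
      SignType.sign (MvPolynomial.eval x' f) = SignType.sign (MvPolynomial.eval₂Hom φ x f) := by
  classical
  obtain ⟨k, ⟨e⟩⟩ := Finite.exists_equiv_fin ι
  obtain ⟨B, hB⟩ := exists_transfer_base_mv k (F.image (MvPolynomial.rename e))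
  obtain ⟨x', hx'⟩ := hB K ℝ hK polyIVT_real φ (RingHom.id ℝ)
    (fun b _ => by simpa using sign_ringHom_real φ b) (x ∘ e.symm)
  refine ⟨x' ∘ e, fun f hf => ?_⟩
  have := hx' _ (Finset.mem_image_of_mem _ hf)
  simp only [MvPolynomial.coe_eval₂Hom, MvPolynomial.eval₂_rename, Function.comp_assoc,
    Equiv.symm_comp_self, Function.comp_id] at this
  rw [MvPolynomial.coe_eval₂Hom, this]
  rfl

lemma sign_intCast_eq {K L : Type*} [Field K] [LinearOrder K] [IsStrictOrderedRing K]
    [Field L] [LinearOrder L] [IsStrictOrderedRing L] (φ : ℤ →+* K) (φ' : ℤ →+* L) (r : ℤ) :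
    SignType.sign (φ r) = SignType.sign (φ' r) := by
  rw [eq_intCast, eq_intCast]
  rcases lt_trichotomy r 0 with h | rfl | h
  · rw [sign_neg (Int.cast_lt_zero.2 h), sign_neg (Int.cast_lt_zero.2 h)]
  · simp
  · rw [sign_pos (Int.cast_pos.2 h), sign_pos (Int.cast_pos.2 h)]

lemma mapMatrix_smul' {A R m : Type*} [CommRing A] [CommRing R] [Fintype m] [DecidableEq m]
    (η : A →+* R) (a : A) (M : Matrix m m A) :
    η.mapMatrix (a • M) = η a • η.mapMatrix M := by
  ext i j; simp

/-- The matrix of multiplication by `a + b i`. -/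
def rotMat {A : Type*} [CommRing A] (a b : A) : Matrix (Fin 2) (Fin 2) A := !![a, -b; b, a]

lemma exists_rotMat_root {K : Type} [Field K] [LinearOrder K] [IsStrictOrderedRing K]
    (hK : PolyIVT K) (p : K[X]) (hp : p.Monic) (hd : 0 < p.natDegree) :
    ∃ a b : K, aeval (rotMat a b) p = 0 := by
  classical
  set d := p.natDegree
  let A := MvPolynomial (Fin d) ℤ
  let J : Matrix (Fin 2) (Fin 2) (MvPolynomial (Fin 2) A) :=
    rotMat (MvPolynomial.X 0) (MvPolynomial.X 1)
  let P : Matrix (Fin 2) (Fin 2) (MvPolynomial (Fin 2) A) :=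
    J ^ d + ∑ i : Fin d, (MvPolynomial.C (MvPolynomial.X i : A) : MvPolynomial (Fin 2) A) •
      J ^ (i : ℕ)
  have hP : ∀ {R : Type} [CommRing R] (φ : ℤ →+* R) (c : Fin d → R) (z : Fin 2 → R),
      (MvPolynomial.eval₂Hom (MvPolynomial.eval₂Hom φ c) z).mapMatrix P =
        (rotMat (z 0) (z 1)) ^ d + ∑ i : Fin d, c i • (rotMat (z 0) (z 1)) ^ (i : ℕ) := by
    intro R _ φ c z
    have hJ : (MvPolynomial.eval₂Hom (MvPolynomial.eval₂Hom φ c) z).mapMatrix J =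
        rotMat (z 0) (z 1) := by
      ext i j
      fin_cases i <;> fin_cases j <;> simp [J, rotMat]
    simp only [P]
    rw [map_add, map_sum, map_pow, hJ]
    congr 1
    refine Finset.sum_congr rfl fun i _ => ?_
    rw [mapMatrix_smul', map_pow, hJ]
    simp
  obtain ⟨B, hB⟩ := exists_transfer_base_mv 2
    (Finset.univ.image (fun ij : Fin 2 × Fin 2 => P ij.1 ij.2))
  obtain ⟨B₀, hB₀⟩ := exists_transfer_base_mv d B
  obtain ⟨c', hc'⟩ := hB₀ K ℝ hK polyIVT_real (Int.castRingHom K) (Int.castRingHom ℝ)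
    (fun b _ => sign_intCast_eq _ _ b) (fun i => p.coeff i)
  let p' : ℝ[X] := X ^ d + ∑ i : Fin d, C (c' i) * X ^ (i : ℕ)
  have hdeg : p'.degree ≠ 0 := by
    have h1 : (∑ i : Fin d, C (c' i) * X ^ (i : ℕ)).degree < (d : WithBot ℕ) :=
      degree_sum_fin_lt _
    have h2 : p'.degree = d := by
      simp only [p']
      rw [degree_add_eq_left_of_degree_lt (by rwa [degree_X_pow]), degree_X_pow]
    rw [h2]
    exact_mod_cast hd.ne'
  obtain ⟨z, hz⟩ := IsAlgClosed.exists_aeval_eq_zero ℂ p' hdeg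
  have hz' : aeval (rotMat z.re z.im) p' = 0 := by
    have := congrArg (Algebra.leftMulMatrix Complex.basisOneI) hz
    rw [← aeval_algHom_apply, Algebra.leftMulMatrix_complex, map_zero] at this
    exact this
  have hz2 : (rotMat z.re z.im) ^ d + ∑ i : Fin d, c' i • (rotMat z.re z.im) ^ (i : ℕ) = 0 := by
    rw [← hz']
    simp [p', Algebra.smul_def]
  obtain ⟨y, hy⟩ := hB ℝ K polyIVT_real hK (MvPolynomial.eval₂Hom (Int.castRingHom ℝ) c')
    (MvPolynomial.eval₂Hom (Int.castRingHom K) (fun i : Fin d => p.coeff i))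
    (fun b hb => (hc' b hb).symm) ![z.re, z.im]
  refine ⟨y 0, y 1, ?_⟩
  have e1 := hP (Int.castRingHom ℝ) c' ![z.re, z.im]
  have e2 := hP (Int.castRingHom K) (fun i : Fin d => p.coeff i) y
  have e3 : aeval (rotMat (y 0) (y 1)) p = (rotMat (y 0) (y 1)) ^ d +
      ∑ i : Fin d, p.coeff i • (rotMat (y 0) (y 1)) ^ (i : ℕ) := by
    conv_lhs => rw [hp.as_sum]
    rw [Finset.sum_range]
    simp [Algebra.smul_def, d]
  rw [e3, ← e2]
  ext i j
  have h4 := hy _ (Finset.mem_image_of_mem (fun ij : Fin 2 × Fin 2 => P ij.1 ij.2)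
    (Finset.mem_univ (i, j)))
  have h5 := congrFun (congrFun (e1.trans hz2) i) j
  simp only [RingHom.mapMatrix_apply, Matrix.map_apply, Matrix.zero_apply] at h5 ⊢
  rw [h5, sign_zero] at h4
  exact sign_eq_zero_iff.1 h4.symm

theorem monic_quadratic {K : Type} [Field K] (a b : K) :
    ((X - C a) ^ 2 + C (b ^ 2)).Monic ∧ ((X - C a) ^ 2 + C (b ^ 2)).natDegree = 2 := by
  have h : (X - C a) ^ 2 + C (b ^ 2) = X ^ 2 + (C (-2 * a) * X + C (a ^ 2 + b ^ 2)) := by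
    simp only [map_add, map_mul, map_pow, map_neg, map_ofNat]; ring
  have hdlt : (C (-2 * a) * X + C (a ^ 2 + b ^ 2) : K[X]).degree < ((2 : ℕ) : WithBot ℕ) :=
    degree_linear_le.trans_lt (by norm_num)
  rw [h]
  refine ⟨monic_X_pow_add hdlt, natDegree_eq_of_degree_eq_some ?_⟩
  rw [degree_add_eq_left_of_degree_lt (by rwa [degree_X_pow]), degree_X_pow]

/-- Every nonconstant polynomial has a root or a quadratic factor without roots. -/
theorem exists_root_or_quadratic {K : Type} [Field K] [LinearOrder K] [IsStrictOrderedRing K]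
    (hK : PolyIVT K) (p : K[X]) (hp : p.Monic) (hd : 0 < p.natDegree) :
    (∃ a, p.eval a = 0) ∨ ∃ a b : K, b ≠ 0 ∧ ((X - C a) ^ 2 + C (b ^ 2)) ∣ p := by
  obtain ⟨a, b, h⟩ := exists_rotMat_root hK p hp hd
  set q : K[X] := (X - C a) ^ 2 + C (b ^ 2) with hq
  obtain ⟨hqm, hqd⟩ : q.Monic ∧ q.natDegree = 2 := monic_quadratic a b
  have hqJ : aeval (rotMat a b) q = 0 := by
    simp only [hq, map_add, map_pow, map_sub, aeval_X, aeval_C]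
    ext i j
    fin_cases i <;> fin_cases j <;>
      simp [rotMat, Matrix.algebraMap_matrix_apply, pow_two, Matrix.mul_apply, Fin.sum_univ_two]
  have hr := modByMonic_add_div p q
  have hrdeg : (p %ₘ q).natDegree ≤ 1 := by
    have := natDegree_modByMonic_lt p hqm (by
      intro h1; rw [h1] at hqd; simp at hqd)
    lia
  obtain ⟨c, e, hce⟩ := exists_eq_X_add_C_of_natDegree_le_one hrdeg
  have hrJ : aeval (rotMat a b) (p %ₘ q) = 0 := by
    have := congrArg (aeval (rotMat a b)) hr
    rwa [map_add, map_mul, hqJ, zero_mul, add_zero, h] at this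
  rw [hce] at hrJ
  simp only [map_add, map_mul, aeval_X, aeval_C] at hrJ
  have h00 := congrFun (congrFun hrJ 0) 0
  have h10 := congrFun (congrFun hrJ 1) 0
  simp [rotMat, Matrix.algebraMap_matrix_apply, Matrix.mul_apply] at h00 h10
  by_cases hb : b = 0
  · left
    refine ⟨a, ?_⟩
    rw [← hr, hce]
    simp [hq, hb, h00]
  · right
    refine ⟨a, b, hb, ?_⟩
    have hc : c = 0 := by tauto
    have he : e = 0 := by simpa [hc] using h00
    rw [hc, he, C_0, zero_mul, zero_add] at hce
    rw [← hr, hce, zero_add]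
    exact dvd_mul_right _ _

end

section

section Newton

variable {ι : Type} [Fintype ι] [DecidableEq ι] {R : Type} [CommRing R]

/-- Jacobi's formula for the derivative of a determinant of polynomials. -/
theorem derivative_det (N : Matrix ι ι R[X]) :
    derivative N.det = (N.adjugate * N.map derivative).trace := by
  have h1 : (N.adjugate * N.map derivative).trace =
      ∑ i, (N.updateCol i fun k => derivative (N k i)).det := by
    refine Finset.sum_congr rfl fun i _ => ?_
    rw [← Matrix.cramer_apply, Matrix.cramer_eq_adjugate_mulVec]
    rfl
  rw [h1, Matrix.det_apply', map_sum]
  simp only [Matrix.det_apply']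
  rw [Finset.sum_comm]
  refine Finset.sum_congr rfl fun σ _ => ?_
  rw [← Finset.mul_sum, derivative_intCast_mul, derivative_prod_finset]
  congr 1
  refine Finset.sum_congr rfl fun i _ => ?_
  rw [← Finset.prod_erase_mul _ _ (Finset.mem_univ i)]
  congr 1
  · refine Finset.prod_congr rfl fun j hj => ?_
    rw [Matrix.updateCol_ne (Finset.ne_of_mem_erase hj)]
  · simp

/-- Newton's identities for the reverse characteristic polynomial. -/
theorem charpolyRev_coeff_succ (M : Matrix ι ι R) (k : ℕ) :
    (k + 1 : R) * M.charpolyRev.coeff (k + 1) =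
      - ∑ i ∈ Finset.range (k + 1), (M ^ (i + 1)).trace * M.charpolyRev.coeff (k - i) := by
  set N : Matrix ι ι R[X] := 1 - (X : R[X]) • M.map C with hN
  have hD : M.charpolyRev = N.det := rfl
  let B : ℕ → Matrix ι ι R := fun k => N.adjugate.map (fun p => p.coeff k)
  have hadj := N.adjugate_mul
  rw [hN, mul_sub, mul_one, ← hN, ← hD, Matrix.mul_smul] at hadj
  have hmul : ∀ k, (N.adjugate * M.map C).map (fun p => p.coeff k) = B k * M := by
    intro k
    ext i j
    simp [B, Matrix.mul_apply]
  have hB0 : B 0 = M.charpolyRev.coeff 0 • (1 : Matrix ι ι R) := by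
    ext i j
    have := congrArg (fun p => p.coeff 0) (congrFun (congrFun hadj i) j)
    simp only [Matrix.sub_apply, Matrix.smul_apply, coeff_sub, smul_eq_mul, coeff_X_mul_zero,
      sub_zero] at this
    simp only [B, Matrix.map_apply, this, Matrix.smul_apply, Matrix.one_apply]
    split <;> simp
  have hBs : ∀ k, B (k + 1) = B k * M + M.charpolyRev.coeff (k + 1) • (1 : Matrix ι ι R) := by
    intro k
    rw [← hmul]
    ext i j
    have := congrArg (fun p => p.coeff (k + 1)) (congrFun (congrFun hadj i) j)
    simp only [Matrix.sub_apply, Matrix.smul_apply, coeff_sub, smul_eq_mul, coeff_X_mul,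
      sub_eq_iff_eq_add] at this
    simp only [B, Matrix.map_apply, this, Matrix.smul_apply, Matrix.one_apply, Matrix.add_apply]
    rw [add_comm]
    split <;> simp
  have hB : ∀ k, B k = ∑ i ∈ Finset.range (k + 1), M.charpolyRev.coeff (k - i) • M ^ i := by
    intro k
    induction k with
    | zero => simp [hB0]
    | succ k ih =>
      rw [hBs, ih, Finset.sum_range_succ' _ (k + 1), Finset.sum_mul]
      simp [pow_succ]
  have h2 := derivative_det N
  have h3 : N.map derivative = - M.map C := by
    ext i j
    by_cases h : i = j <;> simp [hN, h]
  rw [← hD, h3, mul_neg, Matrix.trace_neg] at h2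
  have h4 := congrArg (fun p => p.coeff k) h2
  simp only [coeff_derivative, coeff_neg] at h4
  have h5 : (N.adjugate * M.map C).trace.coeff k = (B k * M).trace := by
    rw [← hmul]
    simp [Matrix.trace]
  rw [h5, hB] at h4
  rw [mul_comm, h4, Finset.sum_mul, Matrix.trace_sum]
  congr 1
  refine Finset.sum_congr rfl fun i _ => ?_
  rw [Matrix.smul_mul, Matrix.trace_smul, pow_succ, smul_eq_mul, mul_comm]

end Newton

end

section

/-- The determinant of a skew-symmetric matrix over a field is a square. -/
theorem exists_sq_eq_det_of_skew {L : Type} [Field L] (h2 : (2 : L) ≠ 0) (m : ℕ) :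
    ∀ (ι : Type) [Fintype ι] [DecidableEq ι] (A : Matrix ι ι L), Fintype.card ι = m →
      A.transpose = -A → ∃ x, A.det = x ^ 2 := by
  induction m using Nat.strong_induction_on with
  | _ m ih =>
    intro ι _ _ A hm hA
    have hA' : ∀ i j, A j i = - A i j := fun i j => congrFun (congrFun hA i) j
    have hd : ∀ i, A i i = 0 := fun i => by
      have := hA' i i
      have h3 : 2 * A i i = 0 := by linear_combination this
      exact (mul_eq_zero.1 h3).resolve_left h2
    by_cases h : ∃ i j, A i j ≠ 0
    · obtain ⟨i, j, hij⟩ := h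
      have hne : i ≠ j := by rintro rfl; exact hij (hd i)
      let f : Fin 2 → ι := ![i, j]
      have hf : Function.Injective f := by
        intro a b
        fin_cases a <;> fin_cases b <;> simp [f, hne, hne.symm]
      let p : ι → Prop := fun x => x ∈ Set.range f
      classical
      let e : Fin 2 ⊕ {x // ¬ p x} ≃ ι :=
        (Equiv.sumCongr (Equiv.ofInjective f hf) (Equiv.refl _)).trans (Equiv.sumCompl p)
      have hcard : Fintype.card {x // ¬ p x} + 2 = m := by
        have := Fintype.card_congr e
        rw [Fintype.card_sum, Fintype.card_fin] at this
        lia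
      let B := A.submatrix e e
      have hB : ∀ x y, B y x = - B x y := fun x y => hA' (e x) (e y)
      have hBd : ∀ x, B x x = 0 := fun x => hd _
      have hdet : B.det = A.det := Matrix.det_submatrix_equiv_self e A
      have h01 : B.toBlocks₁₁ 0 1 = A i j := rfl
      have hdet1 : B.toBlocks₁₁.det = (A i j) ^ 2 := by
        rw [Matrix.det_fin_two, ← h01]
        have a1 : B.toBlocks₁₁ 0 0 = 0 := hBd _
        have a2 : B.toBlocks₁₁ 1 0 = - B.toBlocks₁₁ 0 1 := hB _ _
        rw [a1, a2]; ring
      have hunit : IsUnit B.toBlocks₁₁ := by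
        rw [Matrix.isUnit_iff_isUnit_det, hdet1]
        exact (pow_ne_zero 2 hij).isUnit
      let _ := hunit.invertible
      have t11 : B.toBlocks₁₁.transpose = - B.toBlocks₁₁ := by ext x y; exact hB _ _
      have t22 : B.toBlocks₂₂.transpose = - B.toBlocks₂₂ := by ext x y; exact hB _ _
      have t12 : B.toBlocks₁₂.transpose = - B.toBlocks₂₁ := by ext x y; exact hB _ _
      have t21 : B.toBlocks₂₁.transpose = - B.toBlocks₁₂ := by ext x y; exact hB _ _
      obtain ⟨x, hx⟩ := ih _ (by lia) {x // ¬ p x}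
        (B.toBlocks₂₂ - B.toBlocks₂₁ * B.toBlocks₁₁⁻¹ * B.toBlocks₁₂) rfl (by
          rw [Matrix.transpose_sub, Matrix.transpose_mul, Matrix.transpose_mul,
            Matrix.transpose_nonsing_inv, t11, t22, t12, t21]
          have : (-B.toBlocks₁₁)⁻¹ = - B.toBlocks₁₁⁻¹ := by
            apply Matrix.inv_eq_right_inv
            rw [neg_mul_neg]
            exact Matrix.mul_nonsing_inv _ ((Matrix.isUnit_iff_isUnit_det _).1 hunit)
          rw [this]
          simp [Matrix.mul_assoc]; abel)
      refine ⟨A i j * x, ?_⟩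
      rw [← hdet, ← Matrix.fromBlocks_toBlocks B, Matrix.det_fromBlocks₁₁, hdet1,
        Matrix.invOf_eq_nonsing_inv, hx]
      ring
    · push Not at h
      rcases isEmpty_or_nonempty ι with hι | ⟨⟨i⟩⟩
      · exact ⟨1, by simp⟩
      · refine ⟨0, ?_⟩
        rw [Matrix.det_eq_zero_of_row_eq_zero i (fun j => h i j)]
        simp

theorem exists_sq_eq_det_one_add_skew_mul_skew_field {L : Type} [Field L] (h2 : (2 : L) ≠ 0)
    {ι : Type} [Fintype ι] [DecidableEq ι] (s t : Matrix ι ι L) (hs : s.transpose = -s)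
    (ht : t.transpose = -t) : ∃ x, (1 + t * s).det = x ^ 2 := by
  let W : Matrix (ι ⊕ ι) (ι ⊕ ι) L := Matrix.fromBlocks s 1 (-1) t
  let J : Matrix (ι ⊕ ι) (ι ⊕ ι) L := Matrix.fromBlocks 0 (-1) 1 0
  let U : Matrix (ι ⊕ ι) (ι ⊕ ι) L := Matrix.fromBlocks 1 0 (-s) 1
  obtain ⟨x, hx⟩ := exists_sq_eq_det_of_skew h2 _ _ W rfl (by
    simp [W, Matrix.fromBlocks_transpose, hs, ht, Matrix.fromBlocks_neg])
  obtain ⟨y, hy⟩ := exists_sq_eq_det_of_skew h2 _ _ J rfl (by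
    simp [J, Matrix.fromBlocks_transpose, Matrix.fromBlocks_neg])
  have hU : U.det = 1 := by simp [U]
  have hWUJ : W * U * J = Matrix.fromBlocks 1 0 t (1 + t * s) := by
    simp only [W, U, J, Matrix.fromBlocks_multiply]
    congr 1 <;> simp [add_comm]
  refine ⟨x * y, ?_⟩
  have := congrArg Matrix.det hWUJ
  rw [Matrix.det_mul, Matrix.det_mul, hx, hy, hU, Matrix.det_fromBlocks_zero₁₂, Matrix.det_one,
    one_mul] at this
  rw [← this]; ring

theorem exists_sq_eq_det_one_add_skew_mul_skew {R : Type} [CommRing R] [IsDomain R]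
    [IsIntegrallyClosed R] (h2 : (2 : R) ≠ 0)
    {ι : Type} [Fintype ι] [DecidableEq ι] (s t : Matrix ι ι R) (hs : s.transpose = -s)
    (ht : t.transpose = -t) : ∃ x, (1 + t * s).det = x ^ 2 := by
  let φ := algebraMap R (FractionRing R)
  have hφ : Function.Injective φ := IsFractionRing.injective R (FractionRing R)
  obtain ⟨x, hx⟩ := exists_sq_eq_det_one_add_skew_mul_skew_field (L := FractionRing R)
    (by
      have := (map_ne_zero_iff φ hφ).2 h2
      rwa [map_ofNat] at this) (s.map φ) (t.map φ)
    (by rw [← Matrix.transpose_map, hs]; ext; simp)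
    (by rw [← Matrix.transpose_map, ht]; ext; simp)
  have h1 : φ (1 + t * s).det = x ^ 2 := by
    rw [← hx, RingHom.map_det]
    congr 1
    change φ.mapMatrix (1 + t * s) = 1 + φ.mapMatrix t * φ.mapMatrix s
    rw [map_add, map_one, map_mul]
  obtain ⟨q, hq⟩ := IsIntegrallyClosed.exists_algebraMap_eq_of_isIntegral_pow (R := R)
    (x := x) (n := 2) (by norm_num) (by rw [← h1]; exact isIntegral_algebraMap)
  refine ⟨q, hφ ?_⟩
  rw [h1, map_pow, ← hq]

/-- The reverse characteristic polynomial of a product of two skew matrices is a square. -/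
theorem exists_sq_eq_charpolyRev {R : Type} [CommRing R] [IsDomain R]
    [IsIntegrallyClosed R[X]] (h2 : (2 : R) ≠ 0)
    {ι : Type} [Fintype ι] [DecidableEq ι] (s t : Matrix ι ι R) (hs : s.transpose = -s)
    (ht : t.transpose = -t) : ∃ q, (s * t).charpolyRev = q ^ 2 := by
  obtain ⟨q, hq⟩ := exists_sq_eq_det_one_add_skew_mul_skew (R := R[X])
    (by
      have := (map_ne_zero_iff (C : R →+* R[X]) C_injective).2 h2
      rwa [map_ofNat] at this) (t.map C) (-((X : R[X]) • s.map C))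
    (by rw [← Matrix.transpose_map, ht]; ext; simp)
    (by rw [Matrix.transpose_neg, Matrix.transpose_smul, ← Matrix.transpose_map, hs]; ext; simp)
  refine ⟨q, ?_⟩
  rw [← hq, Matrix.charpolyRev]
  congr 1
  rw [neg_mul, Matrix.smul_mul, ← Matrix.map_mul, sub_eq_add_neg]

end

section

section PosTrace

variable {K : Type} [Field K] [LinearOrder K] [IsStrictOrderedRing K]

/-- An algebra with anti-involution and a positive definite invariant trace. -/
structure PosTrace (K 𝔸 : Type) [Field K] [LinearOrder K] [IsStrictOrderedRing K] [Ring 𝔸]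
    [Algebra K 𝔸] where
  star : 𝔸 →ₗ[K] 𝔸
  tr : 𝔸 →ₗ[K] K
  star_mul : ∀ x y, star (x * y) = star y * star x
  star_star : ∀ x, star (star x) = x
  tr_mul_comm : ∀ x y, tr (x * y) = tr (y * x)
  tr_star : ∀ x, tr (star x) = tr x
  tr_pos : ∀ x, x ≠ 0 → 0 < tr (star x * x)

namespace PosTrace

variable {𝔸 : Type} [Ring 𝔸] [Algebra K 𝔸] (t : PosTrace K 𝔸)
include t

theorem star_one : t.star 1 = 1 := by
  have h := t.star_mul 1 (t.star 1)
  rw [one_mul, t.star_star, one_mul] at h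
  exact h.symm

theorem tr_nonneg (x : 𝔸) : 0 ≤ t.tr (t.star x * x) := by
  by_cases h : x = 0
  · simp [h]
  · exact (t.tr_pos x h).le

theorem eq_zero_of_tr {x : 𝔸} (h : t.tr (t.star x * x) = 0) : x = 0 := by
  by_contra hx
  exact (t.tr_pos x hx).ne' h

theorem star_aeval {s : 𝔸} (hs : t.star s = s) (p : K[X]) :
    t.star (aeval s p) = aeval s p := by
  induction p using Polynomial.induction_on with
  | C a => rw [aeval_C, Algebra.algebraMap_eq_smul_one, map_smul, t.star_one]
  | add p q hp hq => rw [map_add, map_add, hp, hq]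
  | monomial n a h =>
    rw [pow_succ, ← mul_assoc, map_mul, t.star_mul, h, aeval_X, hs]
    have : aeval s (X * (C a * X ^ n)) = aeval s (C a * X ^ n * X) := by rw [mul_comm]
    rwa [map_mul, map_mul _ (C a * X ^ n), aeval_X] at this

omit [LinearOrder K] [IsStrictOrderedRing K] t in
theorem aeval_mul_of_eigen {s w : 𝔸} {a : K} (h : s * w = a • w) (p : K[X]) :
    aeval s p * w = p.eval a • w := by
  induction p using Polynomial.induction_on with
  | C a => rw [aeval_C, eval_C, Algebra.algebraMap_eq_smul_one, smul_mul_assoc, one_mul]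
  | add p q hp hq => rw [map_add, add_mul, hp, hq, eval_add, add_smul]
  | monomial n c ih =>
    rw [pow_succ, ← mul_assoc, map_mul, aeval_X, mul_assoc, h, mul_smul_comm, ih, smul_smul]
    congr 1
    rw [eval_mul (p := C c * X ^ n), eval_X, mul_comm]

theorem eq_zero_of_quadratic {s w : 𝔸} (hs : t.star s = s) {a b : K} (hb : b ≠ 0)
    (h : aeval s ((X - C a) ^ 2 + C (b ^ 2)) * w = 0) : w = 0 := by
  apply t.eq_zero_of_tr
  set d := s - algebraMap K 𝔸 a with hd
  have hds : t.star d = d := by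
    have := t.star_aeval hs (X - C a)
    simpa [hd] using this
  have h1 : aeval s ((X - C a) ^ 2 + C (b ^ 2)) = d * d + (b ^ 2) • (1 : 𝔸) := by
    rw [map_add, map_pow, map_sub, aeval_X, aeval_C, aeval_C, pow_two, ← hd,
      Algebra.algebraMap_eq_smul_one (b ^ 2)]
  rw [h1] at h
  have h2 : t.tr (t.star w * ((d * d + (b ^ 2) • (1 : 𝔸)) * w)) = 0 := by simp [h]
  have h3 : t.star w * ((d * d + (b ^ 2) • (1 : 𝔸)) * w) =
      t.star (d * w) * (d * w) + (b ^ 2) • (t.star w * w) := by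
    rw [t.star_mul, hds, add_mul, mul_add, smul_mul_assoc, one_mul, mul_smul_comm]
    simp only [mul_assoc]
  rw [h3, map_add, map_smul, smul_eq_mul] at h2
  have h4 := t.tr_nonneg (d * w)
  have h5 := t.tr_nonneg w
  have h6 : 0 < b ^ 2 := by positivity
  nlinarith [mul_nonneg h6.le h5, mul_eq_zero.1 (le_antisymm (by linarith) (mul_nonneg h6.le h5) :
    b ^ 2 * t.tr (t.star w * w) = 0)]

/-- A symmetric element whose conjugates have nonnegative trace is annihilated by a product of
linear factors with nonnegative roots. -/
theorem exists_nonneg_roots (hK : PolyIVT K) {s : 𝔸} (hs : t.star s = s) (hIntegral : IsIntegral K s)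
    (hpos : ∀ r : K[X], 0 ≤ t.tr (t.star (aeval s r) * (s * aeval s r))) :
    ∃ L : Multiset K, (∀ x ∈ L, 0 ≤ x) ∧ aeval s (L.map fun x => X - C x).prod = 0 := by
  have key : ∀ (d : ℕ) (p g : K[X]), p.Monic → p.natDegree = d → aeval s (p * g) = 0 →
      (∃ L : Multiset K, (∀ x ∈ L, 0 ≤ x) ∧ g = (L.map fun x => X - C x).prod) →
      ∃ L : Multiset K, (∀ x ∈ L, 0 ≤ x) ∧ aeval s (L.map fun x => X - C x).prod = 0 := by
    intro d
    induction d using Nat.strong_induction_on with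
    | _ d ih =>
      rintro p g hp hpd hpg ⟨L, hL, rfl⟩
      rcases Nat.eq_zero_or_pos d with hd | hd
      · have : p = 1 := hp.natDegree_eq_zero.1 (hpd.trans hd)
        rw [this, one_mul] at hpg
        exact ⟨L, hL, hpg⟩
      · rcases exists_root_or_quadratic hK p hp (by lia) with ⟨a, ha⟩ | ⟨a, b, hb, q, hq⟩
        · obtain ⟨q, hq⟩ := dvd_iff_isRoot.2 ha
          have hqm : q.Monic := (monic_X_sub_C a).of_mul_monic_left (hq ▸ hp)
          have hqd : q.natDegree + 1 = d := by
            rw [← hpd, hq, (monic_X_sub_C a).natDegree_mul hqm, natDegree_X_sub_C, add_comm]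
          by_cases hw : aeval s (q * (L.map fun x => X - C x).prod) = 0
          · exact ih _ (by lia) q _ hqm rfl hw ⟨L, hL, rfl⟩
          · refine ih _ (by lia) q ((X - C a) * (L.map fun x => X - C x).prod) hqm rfl
              (by rw [← hpg, hq]; congr 1; ring) ⟨a ::ₘ L, ?_, by simp⟩
            intro x hx
            rcases Multiset.mem_cons.1 hx with rfl | hx
            · set w := aeval s (q * (L.map fun x => X - C x).prod) with hwd
              have h1 : s * w = x • w := by
                rw [hq, mul_assoc, map_mul, ← hwd, map_sub, aeval_X, aeval_C, sub_mul,
                  sub_eq_zero, ← Algebra.smul_def] at hpg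
                exact hpg
              have h2 := hpos (q * (L.map fun x => X - C x).prod)
              rw [← hwd, h1, mul_smul_comm, map_smul, smul_eq_mul] at h2
              exact (mul_nonneg_iff_of_pos_right (t.tr_pos w hw)).1 h2
            · exact hL x hx
        · set u : K[X] := (X - C a) ^ 2 + C (b ^ 2) with hu
          obtain ⟨hum, hun⟩ : u.Monic ∧ u.natDegree = 2 := monic_quadratic a b
          have hqm : q.Monic := hum.of_mul_monic_left (hq ▸ hp)
          have hqd : q.natDegree + 2 = d := by
            rw [← hpd, hq, hum.natDegree_mul hqm, hun, add_comm]
          refine ih _ (by lia) q _ hqm rfl ?_ ⟨L, hL, rfl⟩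
          apply t.eq_zero_of_quadratic hs hb
          rw [← map_mul, ← hu, ← mul_assoc, ← hq]
          exact hpg
  obtain ⟨p, hp, hps⟩ := hIntegral
  exact key _ p 1 hp rfl (by rw [mul_one]; exact hps) ⟨0, by simp, by simp⟩

/-- Minimal symmetric idempotents. -/
def IsMin (e : 𝔸) : Prop :=
  t.star e = e ∧ e * e = e ∧ e ≠ 0 ∧ ∀ f, t.star f = f → f * f = f → f * e = f → f = 0 ∨ f = e

variable {t}

theorem IsMin.tr_pos {e : 𝔸} (he : t.IsMin e) : 0 < t.tr e := by
  have := t.tr_pos e he.2.2.1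
  rwa [he.1, he.2.1] at this

/-- Symmetric elements in a minimal corner are scalars. -/
theorem IsMin.exists_smul (hK : PolyIVT K) {e s : 𝔸} (he : t.IsMin e) (hs : t.star s = s)
    (hIntegral : IsIntegral K s) (hse : s * e = s) : ∃ c : K, s = c • e := by
  obtain ⟨hes, hee, he0, hmin⟩ := he
  have hes' : e * s = s := by
    have := congrArg t.star hse
    rwa [t.star_mul, hs, hes] at this
  have hcomm : ∀ p : K[X], e * aeval s p = aeval s p * e := by
    intro p
    induction p using Polynomial.induction_on with
    | C a => rw [aeval_C, Algebra.commutes]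
    | add p q hp hq => rw [map_add, mul_add, add_mul, hp, hq]
    | monomial n a h =>
      rw [pow_succ, ← mul_assoc, map_mul, ← mul_assoc, h, aeval_X, mul_assoc, mul_assoc, hes', hse]
  have key : ∀ (d : ℕ) (p : K[X]), p.Monic → p.natDegree = d → aeval s p * e = 0 →
      ∃ c : K, s = c • e := by
    intro d
    induction d using Nat.strong_induction_on with
    | _ d ih =>
      intro p hp hpd hpe
      rcases Nat.eq_zero_or_pos d with hd | hd
      · have : p = 1 := hp.natDegree_eq_zero.1 (hpd.trans hd)
        rw [this, map_one, one_mul] at hpe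
        exact absurd hpe he0
      · rcases exists_root_or_quadratic hK p hp (by lia) with ⟨a, ha⟩ | ⟨a, b, hb, q, hq⟩
        · obtain ⟨q, hq⟩ := dvd_iff_isRoot.2 ha
          have hqm : q.Monic := (monic_X_sub_C a).of_mul_monic_left (hq ▸ hp)
          have hqd : q.natDegree + 1 = d := by
            rw [← hpd, hq, (monic_X_sub_C a).natDegree_mul hqm, natDegree_X_sub_C, add_comm]
          by_cases hw : aeval s q * e = 0
          · exact ih _ (by lia) q hqm rfl hw
          · set w := aeval s q * e with hwd
            have hsw : s * w = a • w := by
              rw [hq, map_mul, mul_assoc, ← hwd, map_sub, aeval_X, aeval_C, sub_mul,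
                sub_eq_zero, ← Algebra.smul_def] at hpe
              exact hpe
            have hws : t.star w = w := by
              rw [hwd, t.star_mul, hes, t.star_aeval hs, hcomm]
            have hwe : w * e = w := by rw [hwd, mul_assoc, hee]
            have hew : e * w = w := by rw [hwd, ← mul_assoc, hcomm, mul_assoc, hee]
            have hww : w * w = q.eval a • w := by
              conv_lhs => rw [hwd]
              rw [mul_assoc, ← hwd, hew]
              exact aeval_mul_of_eigen hsw q
            have hqa : q.eval a ≠ 0 := by
              intro h0
              apply hw
              apply t.eq_zero_of_tr
              rw [hws, hww, h0, zero_smul, map_zero]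
            rcases hmin ((q.eval a)⁻¹ • w) (by rw [map_smul, hws])
              (by rw [smul_mul_smul_comm, hww, smul_smul, mul_assoc, inv_mul_cancel₀ hqa, mul_one])
              (by rw [smul_mul_assoc, hwe]) with h | h
            · exact absurd ((smul_eq_zero.1 h).resolve_left (inv_ne_zero hqa)) hw
            · refine ⟨a, ?_⟩
              rw [← hse, ← h, mul_smul_comm, hsw, smul_comm]
        · have hq' := hq
          set u : K[X] := (X - C a) ^ 2 + C (b ^ 2) with hu
          obtain ⟨hum, hun⟩ : u.Monic ∧ u.natDegree = 2 := monic_quadratic a b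
          have hqm : q.Monic := hum.of_mul_monic_left (hq ▸ hp)
          have hqd : q.natDegree + 2 = d := by
            rw [← hpd, hq, hum.natDegree_mul hqm, hun, add_comm]
          refine ih _ (by lia) q hqm rfl ?_
          apply t.eq_zero_of_quadratic hs hb
          rw [← hu, ← mul_assoc, ← map_mul, ← hq]
          exact hpe
  obtain ⟨p, hp, hps⟩ := hIntegral
  refine key _ p hp rfl ?_
  have : aeval s p = 0 := hps
  rw [this, zero_mul]

end PosTrace

end PosTrace

end

section

theorem exists_mul_self_of_pos {K : Type} [Field K] [LinearOrder K] [IsStrictOrderedRing K]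
    (hK : PolyIVT K) {a : K} (ha : 0 < a) : ∃ c, 0 < c ∧ c * c = a := by
  obtain ⟨c, h1, -, h3⟩ := hK (X ^ 2 - C a) 0 (a + 1) (by linarith) (by
    simp only [eval_sub, eval_pow, eval_X, eval_C]
    nlinarith [mul_pos ha ha, mul_pos (mul_pos ha ha) ha])
  refine ⟨c, h1, ?_⟩
  simp only [eval_sub, eval_pow, eval_X, eval_C] at h3
  linear_combination h3

namespace PosTrace

variable {K : Type} [Field K] [LinearOrder K] [IsStrictOrderedRing K]
variable {𝔸 : Type} [Ring 𝔸] [Algebra K 𝔸] (t : PosTrace K 𝔸)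

/-- Integrality of symmetric elements and of the traces of idempotents. -/
structure IsIntegralTrace : Prop where
  int : ∀ s, t.star s = s → IsIntegral K s
  nat : ∀ e, t.star e = e → e * e = e → ∃ m : ℕ, t.tr e = m
  two : ∀ e i, t.star e = e → e * e = e → t.star i = -i → i * i = -e →
    ∃ m : ℕ, t.tr e = (2 * m : ℕ)
  four : ∀ e i j, t.star e = e → e * e = e → t.star i = -i → t.star j = -j → i * i = -e →
    j * j = -e → i * j = -(j * i) → ∃ m : ℕ, t.tr e = (4 * m : ℕ)

/-- An orthogonal family with constant norm, total in the corner `f𝔸e`. -/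
structure IsFrame {β : Type} [DecidableEq β] (f e : 𝔸) (c : K) (b : β → 𝔸) : Prop where
  left : ∀ k, f * b k = b k
  right : ∀ k, b k * e = b k
  ortho : ∀ k l, t.tr (t.star (b k) * b l) = if k = l then c else 0
  total : ∀ x, f * x = x → x * e = x → (∀ k, t.tr (t.star (b k) * x) = 0) → x = 0

variable {t}

theorem IsMin.skew_of_tr_zero (hK : PolyIVT K) (H : t.IsIntegralTrace) {e x : 𝔸}
    (he : t.IsMin e) (h1 : e * x = x) (h2 : x * e = x) (hx : t.tr x = 0) : t.star x = -x := by
  have hs : t.star (x + t.star x) = x + t.star x := by rw [map_add, t.star_star, add_comm]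
  have h3 : t.star x * e = t.star x := by
    conv_rhs => rw [← h1, t.star_mul, he.1]
  obtain ⟨c, hc⟩ := he.exists_smul hK hs (H.int _ hs) (by rw [add_mul, h2, h3])
  have h4 := congrArg t.tr hc
  rw [map_add, t.tr_star, hx, map_smul, smul_eq_mul, add_zero] at h4
  have h5 : c = 0 := (mul_eq_zero.1 h4.symm).resolve_right he.tr_pos.ne'
  rw [h5, zero_smul] at hc
  exact eq_neg_of_add_eq_zero_right hc

theorem IsMin.anticomm (hK : PolyIVT K) (H : t.IsIntegralTrace) {e x i : 𝔸}
    (he : t.IsMin e) (h2 : x * e = x) (hx : t.star x = -x)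
    (hi2 : i * e = i) (hi : t.star i = -i) (h : t.tr (t.star i * x) = 0) : x * i = -(i * x) := by
  have hs : t.star (x * i + i * x) = x * i + i * x := by
    rw [map_add, t.star_mul, t.star_mul, hx, hi, neg_mul_neg, neg_mul_neg, add_comm]
  obtain ⟨c, hc⟩ := he.exists_smul hK hs (H.int _ hs)
    (by rw [add_mul, mul_assoc, mul_assoc, h2, hi2])
  have h4 := congrArg t.tr hc
  rw [hi, neg_mul, map_neg, neg_eq_zero] at h
  rw [map_add, t.tr_mul_comm x i, h, map_smul, smul_eq_mul, add_zero] at h4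
  have h5 : c = 0 := (mul_eq_zero.1 h4.symm).resolve_right he.tr_pos.ne'
  rw [h5, zero_smul] at hc
  exact eq_neg_of_add_eq_zero_left hc

theorem tr_skew {x : 𝔸} (hx : t.star x = -x) : t.tr x = 0 := by
  have := t.tr_star x
  rw [hx, map_neg] at this
  linarith

theorem IsMin.exists_unit_skew (hK : PolyIVT K) (H : t.IsIntegralTrace) {e s : 𝔸}
    (he : t.IsMin e) (h2 : s * e = s) (hs : t.star s = -s) (h0 : s ≠ 0) :
    ∃ c : K, c ≠ 0 ∧ (c • s) * (c • s) = -e := by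
  have hss : t.star (s * s) = s * s := by rw [t.star_mul, hs, neg_mul_neg]
  obtain ⟨c, hc⟩ := he.exists_smul hK hss (H.int _ hss) (by rw [mul_assoc, h2])
  have h1 := t.tr_pos s h0
  rw [hs, neg_mul, hc, map_neg, map_smul, smul_eq_mul] at h1
  have h3 : 0 < -c := by
    by_contra hcon
    nlinarith [mul_nonneg (by linarith : 0 ≤ c) he.tr_pos.le]
  obtain ⟨d, hd, hdc⟩ := exists_mul_self_of_pos hK (inv_pos.2 h3)
  refine ⟨d, hd.ne', ?_⟩
  rw [smul_mul_smul_comm, hc, smul_smul, hdc, inv_neg, neg_mul,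
    inv_mul_cancel₀ (by linarith), neg_smul, one_smul]

/-- The corner at a minimal idempotent has dimension one, two or four. -/
theorem IsMin.exists_corner_frame (hK : PolyIVT K) (H : t.IsIntegralTrace) {e : 𝔸}
    (he : t.IsMin e) : ∃ (d : ℕ) (b : Fin d → 𝔸) (m : ℕ), t.IsFrame e e (t.tr e) b ∧
      0 < d ∧ t.tr e = (m * d : ℕ) := by
  have hee := he.2.1
  have left_of_skew : ∀ x, x * e = x → t.star x = -x → e * x = x := by
    intro x h1 h2
    have := congrArg t.star h1
    rwa [t.star_mul, he.1, h2, mul_neg, neg_inj] at this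
  by_cases h1 : ∃ s, s * e = s ∧ t.star s = -s ∧ s ≠ 0
  · obtain ⟨s, hse, hs, hs0⟩ := h1
    obtain ⟨i, hie, hi, hii⟩ : ∃ i, i * e = i ∧ t.star i = -i ∧ i * i = -e := by
      obtain ⟨c, hc, h⟩ := he.exists_unit_skew hK H hse hs hs0
      exact ⟨c • s, by rw [smul_mul_assoc, hse], by rw [map_smul, hs, smul_neg], h⟩
    have hei := left_of_skew i hie hi
    have tri : t.tr i = 0 := tr_skew hi
    by_cases h2 : ∃ s, s * e = s ∧ t.star s = -s ∧ s * i = -(i * s) ∧ s ≠ 0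
    · obtain ⟨s', hse', hs', hsi', hs0'⟩ := h2
      obtain ⟨j, hje, hj, hji, hjj⟩ : ∃ j, j * e = j ∧ t.star j = -j ∧ j * i = -(i * j) ∧
          j * j = -e := by
        obtain ⟨c, hc, h⟩ := he.exists_unit_skew hK H hse' hs' hs0'
        exact ⟨c • s', by rw [smul_mul_assoc, hse'], by rw [map_smul, hs', smul_neg],
          by rw [smul_mul_assoc, hsi', smul_neg, mul_smul_comm], h⟩
      have hej := left_of_skew j hje hj
      have trj : t.tr j = 0 := tr_skew hj
      obtain ⟨k, hk⟩ : ∃ k, k = i * j := ⟨_, rfl⟩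
      have hij : i * j = k := hk.symm
      have hji : j * i = -k := by rw [hji, hij]
      have hks : t.star k = -k := by rw [hk, t.star_mul, hi, hj, neg_mul_neg, hji, hk]
      have hke : k * e = k := by rw [hk, mul_assoc, hje]
      have hek := left_of_skew k hke hks
      have trk : t.tr k = 0 := tr_skew hks
      have hik : i * k = -j := by rw [hk, ← mul_assoc, hii, neg_mul, hej]
      have hkj : k * j = -i := by rw [hk, mul_assoc, hjj, mul_neg, hie]
      have hjk : j * k = i := by
        rw [← neg_inj, ← mul_neg, ← hji, ← mul_assoc, hjj, neg_mul, hei]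
      have hki : k * i = j := by
        rw [← neg_inj, ← neg_mul, ← hji, mul_assoc, hii, mul_neg, hje]
      have hkk : k * k = -e := by
        conv_lhs => rw [hk, mul_assoc]
        rw [hij, hjk, hii]
      obtain ⟨m, hm⟩ := H.four e i j he.1 hee hi hj hii hjj (by rw [hji, hij, neg_neg])
      refine ⟨4, ![e, i, j, k], m, ⟨?_, ?_, ?_, ?_⟩, by norm_num, by rw [hm, mul_comm]⟩
      · intro l; fin_cases l <;> simp [hee, hei, hej, hek]
      · intro l; fin_cases l <;> simp [hee, hie, hje, hke]
      · intro l l'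
        fin_cases l <;> fin_cases l' <;>
          simp [he.1, hi, hj, hks, hee, hei, hej, hek, hie, hje, hke, hii, hij, hik, hji, hjj, hjk,
            hki, hkj, hkk, tri, trj, trk]
      · intro x hex hxe hx
        have x0 : t.tr (t.star e * x) = 0 := hx 0
        have x1 : t.tr (t.star i * x) = 0 := hx 1
        have x2 : t.tr (t.star j * x) = 0 := hx 2
        have x3 : t.tr (t.star k * x) = 0 := hx 3
        rw [he.1, hex] at x0
        have hxs := he.skew_of_tr_zero hK H hex hxe x0
        have a1 := he.anticomm hK H hxe hxs hie hi x1
        have a2 := he.anticomm hK H hxe hxs hje hj x2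
        have a3 := he.anticomm hK H hxe hxs hke hks x3
        have a4 : x * k = k * x := by
          rw [hk, ← mul_assoc, a1, neg_mul, mul_assoc, a2, mul_neg, neg_neg, mul_assoc]
        have a5 : (2 : K) • (k * x) = 0 := by
          rw [two_smul]
          nth_rewrite 1 [← a4]
          rw [a3, neg_add_cancel]
        have a6 : k * x = 0 := (smul_eq_zero.1 a5).resolve_left two_ne_zero
        rw [← hex, ← neg_eq_zero, ← neg_mul, ← hkk, mul_assoc, a6, mul_zero]
    · obtain ⟨m, hm⟩ := H.two e i he.1 hee hi hii
      refine ⟨2, ![e, i], m, ⟨?_, ?_, ?_, ?_⟩, by norm_num, by rw [hm, mul_comm]⟩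
      · intro l; fin_cases l <;> simp [hee, hei]
      · intro l; fin_cases l <;> simp [hee, hie]
      · intro l l'
        fin_cases l <;> fin_cases l' <;> simp [he.1, hi, hee, hei, hie, hii, tri]
      · intro x hex hxe hx
        have x0 : t.tr (t.star e * x) = 0 := hx 0
        have x1 : t.tr (t.star i * x) = 0 := hx 1
        rw [he.1, hex] at x0
        have hxs := he.skew_of_tr_zero hK H hex hxe x0
        have a1 := he.anticomm hK H hxe hxs hie hi x1
        by_contra hne
        exact h2 ⟨x, hxe, hxs, a1, hne⟩
  · obtain ⟨m, hm⟩ := H.nat e he.1 hee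
    refine ⟨1, ![e], m, ⟨?_, ?_, ?_, ?_⟩, by norm_num, by rw [hm, mul_one]⟩
    · intro l; fin_cases l; simp [hee]
    · intro l; fin_cases l; simp [hee]
    · intro l l'
      fin_cases l; fin_cases l'; simp [he.1, hee]
    · intro x hex hxe hx
      have x0 : t.tr (t.star e * x) = 0 := hx 0
      rw [he.1, hex] at x0
      have hxs := he.skew_of_tr_zero hK H hex hxe x0
      by_contra hne
      exact h1 ⟨x, hxe, hxs, hne⟩

/-- Two minimal idempotents are linked by a partial isometry as soon as their mixed corner is
nonzero. -/
theorem IsMin.exists_isometry (hK : PolyIVT K) (H : t.IsIntegralTrace) {f e x : 𝔸}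
    (hf : t.IsMin f) (he : t.IsMin e) (h1 : f * x = x) (h2 : x * e = x) (hx : x ≠ 0) :
    ∃ u, t.star u * u = e ∧ u * t.star u = f := by
  have hs : t.star (t.star x * x) = t.star x * x := by rw [t.star_mul, t.star_star]
  obtain ⟨c, hc⟩ := he.exists_smul hK hs (H.int _ hs) (by rw [mul_assoc, h2])
  have h3 := t.tr_pos x hx
  rw [hc, map_smul, smul_eq_mul] at h3
  have h4 : 0 < c := (pos_iff_pos_of_mul_pos h3).2 he.tr_pos
  obtain ⟨d, hd, hdc⟩ := exists_mul_self_of_pos hK (inv_pos.2 h4)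
  have hu : t.star (d • x) * (d • x) = e := by
    rw [map_smul, smul_mul_smul_comm, hc, smul_smul, hdc, inv_mul_cancel₀ h4.ne', one_smul]
  have hue : (d • x) * e = d • x := by rw [smul_mul_assoc, h2]
  have hfu : f * (d • x) = d • x := by rw [mul_smul_comm, h1]
  refine ⟨d • x, hu, ?_⟩
  set u := d • x
  have h5 : t.star u * f = t.star u := by
    have := congrArg t.star hfu
    rwa [t.star_mul, hf.1] at this
  rcases hf.2.2.2 (u * t.star u) (by rw [t.star_mul, t.star_star])
    (by rw [mul_assoc, ← mul_assoc (t.star u), hu, ← mul_assoc, hue])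
    (by rw [mul_assoc, h5]) with h | h
  · exfalso
    have : e * e = 0 := by
      conv_lhs => rw [← hu, mul_assoc, ← mul_assoc u, h, zero_mul, mul_zero]
    exact he.2.2.1 (he.2.1 ▸ this)
  · exact h

theorem IsFrame.transport {f e u : 𝔸} {β : Type} [DecidableEq β] {c : K} {b : β → 𝔸}
    (h : t.IsFrame e e c b) (h1 : t.star u * u = e) (h2 : u * t.star u = f) :
    t.IsFrame f e c (fun k => u * b k) where
  left k := by
    rw [← mul_assoc]
    nth_rewrite 1 [← h2]
    rw [mul_assoc, mul_assoc, ← mul_assoc (t.star u), h1, h.left]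
  right k := by rw [mul_assoc, h.right]
  ortho k l := by
    rw [t.star_mul, mul_assoc, ← mul_assoc (t.star u), h1, h.left, h.ortho]
  total x hx1 hx2 hx := by
    have h3 : t.star u * x = 0 := by
      refine h.total _ ?_ (by rw [mul_assoc, hx2]) fun k => ?_
      · rw [← h1, mul_assoc, ← mul_assoc u, h2, hx1]
      · rw [← mul_assoc, ← t.star_mul, hx]
    rw [← hx1, ← h2, mul_assoc, h3, mul_zero]

theorem IsFrame.eq_sum {f e x : 𝔸} {β : Type} [Fintype β] [DecidableEq β] {c : K} {b : β → 𝔸}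
    (hc : c ≠ 0) (h : t.IsFrame f e c b) (h1 : f * x = x) (h2 : x * e = x) :
    x = ∑ k, (c⁻¹ * t.tr (t.star (b k) * x)) • b k := by
  rw [← sub_eq_zero]
  refine h.total _ ?_ ?_ fun k => ?_
  · simp only [mul_sub, h1, Finset.mul_sum, mul_smul_comm, h.left]
  · simp only [sub_mul, h2, Finset.sum_mul, smul_mul_assoc, h.right]
  · simp only [mul_sub, Finset.mul_sum, mul_smul_comm, map_sub, map_sum, map_smul, h.ortho,
      smul_eq_mul, mul_ite, mul_zero, Finset.sum_ite_eq, Finset.mem_univ, if_true]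
    field_simp
    ring

end PosTrace

end

section

namespace PosTrace

variable {K : Type} [Field K] [LinearOrder K] [IsStrictOrderedRing K]
variable {𝔸 : Type} [Ring 𝔸] [Algebra K 𝔸] {t : PosTrace K 𝔸}

theorem tr_idem_pos {e : 𝔸} (h1 : t.star e = e) (h2 : e * e = e) (h0 : e ≠ 0) : 0 < t.tr e := by
  have := t.tr_pos e h0
  rwa [h1, h2] at this

/-- Symmetric idempotents decompose into orthogonal minimal ones. -/
theorem IsIntegralTrace.exists_decomposition (H : t.IsIntegralTrace) (m : ℕ) :
    ∀ e : 𝔸, t.star e = e → e * e = e → t.tr e = m →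
      ∃ (ι : Type) (_ : Fintype ι) (_ : DecidableEq ι) (v : ι → 𝔸), (∀ i, t.IsMin (v i)) ∧
        (∀ i j, i ≠ j → v i * v j = 0) ∧ ∑ i, v i = e := by
  induction m using Nat.strong_induction_on with
  | _ m ih =>
    intro e h1 h2 hm
    by_cases h0 : e = 0
    · exact ⟨Empty, inferInstance, inferInstance, Empty.elim, fun i => i.elim, fun i => i.elim,
        by simp [h0]⟩
    by_cases hmin : t.IsMin e
    · exact ⟨Unit, inferInstance, inferInstance, fun _ => e, fun _ => hmin,
        fun i j h => absurd (Subsingleton.elim i j) h, by simp⟩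
    have hex : ∃ f, t.star f = f ∧ f * f = f ∧ f * e = f ∧ f ≠ 0 ∧ f ≠ e := by
      by_contra hcon
      push Not at hcon
      refine hmin ⟨h1, h2, h0, fun f a b c => ?_⟩
      by_cases hf : f = 0
      · exact Or.inl hf
      · exact Or.inr (hcon f a b c hf)
    obtain ⟨f, f1, f2, f3, f4, f5⟩ := hex
    have f6 : e * f = f := by
      have := congrArg t.star f3
      rwa [t.star_mul, f1, h1] at this
    have g1 : t.star (e - f) = e - f := by rw [map_sub, h1, f1]
    have g2 : (e - f) * (e - f) = e - f := by
      rw [mul_sub, sub_mul, sub_mul, h2, f3, f6, f2, sub_self, sub_zero]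
    obtain ⟨p, hp⟩ := H.nat f f1 f2
    obtain ⟨q, hq⟩ := H.nat _ g1 g2
    have p0 : 0 < p := by
      have := tr_idem_pos f1 f2 f4
      rw [hp] at this
      exact_mod_cast this
    have q0 : 0 < q := by
      have := tr_idem_pos g1 g2 (sub_ne_zero.2 f5.symm)
      rw [hq] at this
      exact_mod_cast this
    have hpq : p + q = m := by
      have : ((p + q : ℕ) : K) = m := by rw [← hm, Nat.cast_add, ← hp, ← hq, map_sub]; ring
      exact_mod_cast this
    obtain ⟨ι₁, _, _, v₁, a1, a2, a3⟩ := ih p (by lia) f f1 f2 hp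
    obtain ⟨ι₂, _, _, v₂, b1, b2, b3⟩ := ih q (by lia) _ g1 g2 hq
    have c1 : ∀ i, v₁ i * f = v₁ i := by
      intro i
      rw [← a3, Finset.mul_sum, Finset.sum_eq_single i (fun j _ hj => a2 i j hj.symm) (by simp),
        (a1 i).2.1]
    have c1' : ∀ i, f * v₁ i = v₁ i := by
      intro i
      rw [← a3, Finset.sum_mul, Finset.sum_eq_single i (fun j _ hj => a2 j i hj) (by simp),
        (a1 i).2.1]
    have c2 : ∀ i, (e - f) * v₂ i = v₂ i := by
      intro i
      rw [← b3, Finset.sum_mul, Finset.sum_eq_single i (fun j _ hj => b2 j i hj) (by simp),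
        (b1 i).2.1]
    have c2' : ∀ i, v₂ i * (e - f) = v₂ i := by
      intro i
      rw [← b3, Finset.mul_sum, Finset.sum_eq_single i (fun j _ hj => b2 i j hj.symm) (by simp),
        (b1 i).2.1]
    refine ⟨ι₁ ⊕ ι₂, inferInstance, inferInstance, Sum.elim v₁ v₂, ?_, ?_, ?_⟩
    · rintro (i | i)
      · exact a1 i
      · exact b1 i
    · rintro (i | i) (j | j) hij
      · exact a2 i j fun h => hij (by rw [h])
      · change v₁ i * v₂ j = 0
        rw [← c1, ← c2, mul_assoc, ← mul_assoc f, mul_sub, f3, f2, sub_self, zero_mul, mul_zero]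
      · change v₂ i * v₁ j = 0
        rw [← c1', ← c2', mul_assoc, ← mul_assoc (e - f), sub_mul, f6, f2, sub_self, zero_mul,
          mul_zero]
      · exact b2 i j fun h => hij (by rw [h])
    · rw [Fintype.sum_sum_type]
      simp only [Sum.elim_inl, Sum.elim_inr]
      rw [a3, b3, add_sub_cancel]

/-- Left multiplication in the coordinates of a frame. -/
theorem IsFrame.exists_rep {e : 𝔸} {β : Type} [Fintype β] [DecidableEq β] {c : K} {b : β → 𝔸}
    (hc : c ≠ 0) (h : t.IsFrame 1 e c b) :
    ∃ ρ : 𝔸 →ₐ[K] Matrix β β K, (∀ a k l, ρ a k l = c⁻¹ * t.tr (t.star (b k) * (a * b l))) ∧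
      ∀ a, ρ (t.star a) = (ρ a).transpose := by
  let L : 𝔸 →ₗ[K] Matrix β β K :=
    { toFun := fun a => Matrix.of fun k l => c⁻¹ * t.tr (t.star (b k) * (a * b l))
      map_add' := fun x y => by ext; simp [add_mul, mul_add]
      map_smul' := fun r x => by ext; simp; ring }
  have hL : ∀ a k l, L a k l = c⁻¹ * t.tr (t.star (b k) * (a * b l)) := fun _ _ _ => rfl
  refine ⟨AlgHom.ofLinearMap L ?_ ?_, fun a k l => rfl, ?_⟩
  · ext k l
    rw [hL, one_mul, h.ortho, Matrix.one_apply]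
    split <;> simp [hc]
  · intro x y
    ext k l
    rw [Matrix.mul_apply, hL]
    have := h.eq_sum hc (x := y * b l) (one_mul _) (by rw [mul_assoc, h.right])
    conv_lhs => rw [mul_assoc, this]
    simp only [hL, Finset.mul_sum, mul_smul_comm, map_sum, map_smul, smul_eq_mul]
    exact Finset.sum_congr rfl fun i _ => by ring
  · intro a
    ext k l
    change L _ k l = L _ l k
    rw [hL, hL, ← t.tr_star (t.star (b l) * _), t.star_mul, t.star_mul, t.star_star, mul_assoc]

theorem tr_ext {ι : Type} [Fintype ι] [DecidableEq ι] (hK : PolyIVT K) (H : t.IsIntegralTrace)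
    {v : ι → 𝔸} (hv : ∀ i, t.IsMin (v i)) (hsum : ∑ i, v i = 1) (T : 𝔸 →ₗ[K] K)
    (hT1 : ∀ x y, T (x * y) = T (y * x)) (hT2 : ∀ x, T (t.star x) = T x)
    (hT : ∀ i, T (v i) = t.tr (v i)) (a : 𝔸) : T a = t.tr a := by
  have key : ∀ i, T (v i * a) = t.tr (v i * a) := by
    intro i
    have hx : v i * a = v i * (v i * a) := by rw [← mul_assoc, (hv i).2.1]
    rw [hx, hT1, t.tr_mul_comm]
    set x := v i * a * v i with hxd
    have h1 : x * v i = x := by rw [hxd, mul_assoc, (hv i).2.1]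
    have h2 : t.star x * v i = t.star x := by
      rw [hxd, t.star_mul, t.star_mul, (hv i).1, mul_assoc, mul_assoc, (hv i).2.1]
    have hs : t.star (x + t.star x) = x + t.star x := by rw [map_add, t.star_star, add_comm]
    obtain ⟨c, hc⟩ := (hv i).exists_smul hK hs (H.int _ hs) (by rw [add_mul, h1, h2])
    have h3 := congrArg T hc
    have h4 := congrArg t.tr hc
    rw [map_add, hT2, map_smul, hT] at h3
    rw [map_add, t.tr_star, map_smul, ← h3] at h4
    linarith
  rw [← one_mul a, ← hsum, Finset.sum_mul, map_sum, map_sum]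
  exact Finset.sum_congr rfl fun i _ => key i

/-- An algebra with integral positive trace is represented by matrices, the trace becoming the
matrix trace and the involution the transpose. -/
theorem IsIntegralTrace.exists_matrix_rep (hK : PolyIVT K) (H : t.IsIntegralTrace) {n : ℕ}
    (hn : t.tr 1 = n) :
    ∃ ρ : 𝔸 →ₐ[K] Matrix (Fin n) (Fin n) K, (∀ a, ρ (t.star a) = (ρ a).transpose) ∧
      ∀ a, (ρ a).trace = t.tr a := by
  classical
  obtain ⟨ι, _, _, v, hmin, horth, hsum⟩ :=
    H.exists_decomposition n 1 t.star_one (one_mul 1) hn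
  have hc : ∀ i, t.tr (v i) ≠ 0 := fun i => (hmin i).tr_pos.ne'
  let S : Setoid ι :=
    { r := fun i j => ∃ u, t.star u * u = v i ∧ u * t.star u = v j
      iseqv :=
        { refl := fun i => ⟨v i, by rw [(hmin i).1, (hmin i).2.1], by rw [(hmin i).1, (hmin i).2.1]⟩
          symm := fun {i j} ⟨u, h1, h2⟩ => ⟨t.star u, by rw [t.star_star, h2], by
            rw [t.star_star, h1]⟩
          trans := fun {i j k} ⟨u, h1, h2⟩ ⟨w, h3, h4⟩ => ⟨w * u, by
            rw [t.star_mul, mul_assoc, ← mul_assoc (t.star w), h3, ← h2, mul_assoc, h1,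
              ← mul_assoc, h1, (hmin i).2.1], by
            rw [t.star_mul, mul_assoc, ← mul_assoc u, h2, ← h3, mul_assoc, h4,
              ← mul_assoc, h4, (hmin k).2.1]⟩ } }
  choose d b₀ m hb₀ hd htr using fun i => (hmin i).exists_corner_frame hK H
  let D : ι → ι → ℕ := fun i j => if S.r i j then d i else 0
  have hex : ∀ i j, ∃ b : Fin (D i j) → 𝔸, t.IsFrame (v j) (v i) (t.tr (v i)) b := by
    intro i j
    by_cases hij : S.r i j
    · obtain ⟨u, h1, h2⟩ := hij
      have hD : D i j = d i := if_pos ⟨u, h1, h2⟩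
      rw [hD]
      exact ⟨_, (hb₀ i).transport h1 h2⟩
    · have hD : D i j = 0 := if_neg hij
      rw [hD]
      refine ⟨Fin.elim0, fun k => k.elim0, fun k => k.elim0, fun k => k.elim0, ?_⟩
      intro x hx1 hx2 _
      by_contra hx
      exact hij ((hmin j).exists_isometry hK H (hmin i) hx1 hx2 hx)
  choose b hb using hex
  have hframe : ∀ i, t.IsFrame 1 (v i) (t.tr (v i)) (fun p : Σ j, Fin (D i j) => b i p.1 p.2) := by
    intro i
    refine ⟨fun _ => one_mul _, fun p => (hb i p.1).right _, ?_, ?_⟩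
    · rintro ⟨j, k⟩ ⟨j', k'⟩
      by_cases hj : j = j'
      · subst hj
        rw [(hb i j).ortho]
        simp
      · have h1 : t.star (b i j k) * b i j' k' = 0 := by
          rw [← (hb i j).left k, ← (hb i j').left k', t.star_mul, (hmin j).1, mul_assoc,
            ← mul_assoc (v j), horth j j' hj, zero_mul, mul_zero]
        rw [h1, map_zero, if_neg]
        intro h
        exact hj (congrArg Sigma.fst h)
    · intro x _ hx hx2
      have h1 : ∀ j, v j * x = 0 := by
        intro j
        refine (hb i j).total _ (by rw [← mul_assoc, (hmin j).2.1]) (by rw [mul_assoc, hx]) ?_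
        intro k
        have h2 : t.star (b i j k) * v j = t.star (b i j k) := by
          conv_rhs => rw [← (hb i j).left k, t.star_mul, (hmin j).1]
        rw [← mul_assoc, h2]
        exact hx2 ⟨j, k⟩
      rw [← one_mul x, ← hsum, Finset.sum_mul]
      exact Finset.sum_eq_zero fun j _ => h1 j
  choose ρ hρ hρt using fun i => (hframe i).exists_rep (hc i)
  have hρv : ∀ i j, (ρ i (v j)).trace = D i j := by
    intro i j
    have h1 : ∀ p : Σ j, Fin (D i j), ρ i (v j) p p = if p.1 = j then 1 else 0 := by
      rintro ⟨j', k⟩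
      rw [hρ]
      change _ * t.tr (t.star (b i j' k) * (v j * b i j' k)) = _
      by_cases hj : j' = j
      · subst hj
        rw [(hb i j').left, (hb i j').ortho]
        simp [hc]
      · rw [← (hb i j').left k, ← mul_assoc (v j), horth j j' fun h => hj h.symm]
        simp [hj]
    simp only [Matrix.trace, Matrix.diag_apply, h1]
    rw [Fintype.sum_sigma, Finset.sum_eq_single j]
    · simp
    · intro j' _ hj
      simp [hj]
    · simp
  let r : ι → ι := fun i => (Quotient.mk S i).out
  have hr : ∀ i, S.r (r i) i := fun i => Quotient.exact (Quotient.out_eq _)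
  have hr2 : ∀ i j, S.r i j → r i = r j := by
    intro i j h
    have : Quotient.mk S i = Quotient.mk S j := Quotient.sound h
    simp only [r, this]
  let c : ι → ℕ := fun i => if r i = i then m i else 0
  let κ := Σ i, Fin (c i)
  let B : 𝔸 →ₐ[K] Matrix (Σ p : κ, Σ j, Fin (D p.1 j)) (Σ p : κ, Σ j, Fin (D p.1 j)) K :=
    AlgHom.ofLinearMap
      { toFun := fun a => Matrix.blockDiagonal' fun p : κ => ρ p.1 a
        map_add' := fun x y => by
          rw [← Matrix.blockDiagonal'_add]; congr 1; ext; simp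
        map_smul' := fun s x => by
          rw [RingHom.id_apply, ← Matrix.blockDiagonal'_smul]; congr 1; ext; simp }
      (by
        rw [← Matrix.blockDiagonal'_one]
        change (Matrix.blockDiagonal' fun p : κ => ρ p.1 1) = _
        congr 1; ext; simp)
      (fun x y => by
        change (Matrix.blockDiagonal' fun p : κ => ρ p.1 (x * y)) =
          (Matrix.blockDiagonal' fun p : κ => ρ p.1 x) * Matrix.blockDiagonal' fun p : κ => ρ p.1 y
        rw [← Matrix.blockDiagonal'_mul]; congr 1; ext; simp)
  have hB : ∀ a, B a = Matrix.blockDiagonal' fun p : κ => ρ p.1 a := fun _ => rfl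
  have hBt : ∀ a, B (t.star a) = (B a).transpose := by
    intro a
    rw [hB, hB, Matrix.blockDiagonal'_transpose]
    simp only [hρt]
  have hBtr0 : ∀ a, (B a).trace = ∑ i, (c i : K) * (ρ i a).trace := by
    intro a
    rw [hB, Matrix.trace_blockDiagonal', Fintype.sum_sigma]
    refine Finset.sum_congr rfl fun i _ => ?_
    rw [← nsmul_eq_mul]
    have h := Finset.sum_const (s := (Finset.univ : Finset (Fin (c i)))) (ρ i a).trace
    rw [Finset.card_univ, Fintype.card_fin] at h
    exact h
  have hBtr : ∀ a, (B a).trace = t.tr a := by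
    refine tr_ext hK H hmin hsum ((Matrix.traceLinearMap _ K K).comp B.toLinearMap) ?_ ?_ ?_
    · intro x y
      simp [Matrix.trace_mul_comm (B x)]
    · intro x
      simp [hBt]
    · intro j
      change (B (v j)).trace = _
      rw [hBtr0, Finset.sum_eq_single (r j)]
      · have h1 : r (r j) = r j := hr2 _ _ (hr j)
        rw [hρv]
        simp only [c, D, if_pos h1, if_pos (hr j)]
        obtain ⟨u, hu1, hu2⟩ := hr j
        rw [← hu2, t.tr_mul_comm, hu1, htr]
        push_cast
        rfl
      · intro i _ hi
        rw [hρv]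
        by_cases h1 : r i = i
        · have h2 : ¬ S.r i j := fun h => hi (h1.symm.trans (hr2 _ _ h))
          simp [D, h2]
        · simp [c, h1]
      · simp
  have hcard : Fintype.card (Σ p : κ, Σ j, Fin (D p.1 j)) = n := by
    have h1 := hBtr 1
    rw [map_one, Matrix.trace_one, hn] at h1
    exact_mod_cast h1
  let e := Fintype.equivFinOfCardEq hcard
  refine ⟨(Matrix.reindexAlgEquiv K K e).toAlgHom.comp B, ?_, ?_⟩
  · intro a
    simp [hBt]
  · intro a
    rw [← hBtr]
    simp [Matrix.trace, ← Equiv.sum_comp e.symm]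

end PosTrace

end

section

/-- Polynomial solutions of `(1 + X²) F' = c X F` exist only for even `c`. -/
theorem exists_even_of_ode {K : Type} [Field K] [CharZero K] {F : K[X]} (hF : F ≠ 0) {c : K}
    (h : (1 + X ^ 2) * derivative F = C c * X * F) : ∃ m : ℕ, c = (2 * m : ℕ) := by
  have h1 : F.coeff 1 = 0 := by
    have := congrArg (fun p => coeff p 0) h
    simpa [mul_assoc, mul_coeff_zero, coeff_derivative] using this
  have h2 : ∀ k : ℕ, (k + 2 : K) * F.coeff (k + 2) = (c - k) * F.coeff k := by
    intro k
    have := congrArg (fun p => coeff p (k + 1)) h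
    rw [add_mul, one_mul, pow_two, mul_assoc, mul_assoc] at this
    simp only [coeff_add, coeff_X_mul, coeff_C_mul, coeff_derivative] at this
    rcases k with _ | k
    · simp only [mul_coeff_zero, coeff_X_zero, zero_mul] at this
      push_cast at this ⊢
      linear_combination this
    · rw [coeff_X_mul, coeff_derivative] at this
      push_cast at this ⊢
      linear_combination this
  have hodd : ∀ m : ℕ, F.coeff (2 * m + 1) = 0 := by
    intro m
    induction m with
    | zero => simpa using h1
    | succ m ih =>
      have := h2 (2 * m + 1)
      rw [ih, mul_zero] at this
      rcases mul_eq_zero.1 this with h3 | h3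
      · exfalso
        have : ((2 * m + 1 + 2 : ℕ) : K) = 0 := by push_cast at h3 ⊢; exact h3
        exact absurd (Nat.cast_eq_zero.1 this) (by lia)
      · exact h3
  have hlead : F.coeff F.natDegree ≠ 0 := by simpa using hF
  have hd := h2 F.natDegree
  rw [coeff_eq_zero_of_natDegree_lt (by lia), mul_zero] at hd
  have hc : c = F.natDegree := by
    rcases mul_eq_zero.1 hd.symm with h3 | h3
    · exact sub_eq_zero.1 h3
    · exact absurd h3 hlead
  rcases Nat.even_or_odd' F.natDegree with ⟨m, hm | hm⟩
  · exact ⟨m, by rw [hc, hm]⟩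
  · exact absurd (hm ▸ hodd m) hlead

theorem ode_of_recursion {K : Type} [Field K] {F : K[X]} {τ : ℕ → K} {c : K}
    (hrec : ∀ k : ℕ, (k + 1 : K) * F.coeff (k + 1) =
      - ∑ i ∈ Finset.range (k + 1), τ (i + 1) * F.coeff (k - i))
    (h1 : τ 1 = 0) (h2 : τ 2 = -c) (hτ : ∀ i, τ (i + 3) = - τ (i + 1)) :
    (1 + X ^ 2) * derivative F = C c * X * F := by
  ext k
  rw [add_mul, one_mul, pow_two, mul_assoc, mul_assoc, coeff_add, coeff_derivative, coeff_C_mul,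
    mul_comm (F.coeff _)]
  rcases k with _ | _ | k
  · simpa [h1] using hrec 0
  · have := hrec 1
    rw [Finset.sum_range_succ] at this
    simp only [coeff_X_mul, mul_coeff_zero, coeff_X_zero, zero_mul]
    simp [h1, h2] at this ⊢
    exact this
  · have h3 := hrec (k + 2)
    have h4 := hrec k
    rw [Finset.sum_range_succ', Finset.sum_range_succ'] at h3
    simp only [coeff_X_mul, coeff_derivative, hτ, show ∀ i, k + 2 - (i + 1 + 1) = k - i by lia,
      show k + 2 - (0 + 1) = k + 1 by lia, neg_mul, Finset.sum_neg_distrib, zero_add, h1,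
      h2] at h3 ⊢
    push_cast at h3 h4 ⊢
    linear_combination h3 + h4

theorem exists_natCast_of_recursion {K : Type} [Field K] [CharZero K] {F : K[X]} {c : K}
    (h0 : F ≠ 0)
    (hrec : ∀ k : ℕ, (k + 1 : K) * F.coeff (k + 1) =
      - ∑ i ∈ Finset.range (k + 1), c * F.coeff (k - i)) : ∃ m : ℕ, c = m := by
  have h : ∀ k : ℕ, (k + 1 : K) * F.coeff (k + 1) = (k - c) * F.coeff k := by
    intro k
    rcases k with _ | k
    · simpa using hrec 0
    · have h3 := hrec (k + 1)
      have h4 := hrec k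
      rw [Finset.sum_range_succ'] at h3
      simp only [show ∀ i, k + 1 - (i + 1) = k - i by lia, Nat.sub_zero] at h3
      push_cast at h3 h4 ⊢
      linear_combination h3 - h4
  have hd := h F.natDegree
  rw [coeff_eq_zero_of_natDegree_lt (by lia), mul_zero] at hd
  rcases mul_eq_zero.1 hd.symm with h3 | h3
  · exact ⟨_, (sub_eq_zero.1 h3).symm⟩
  · exact absurd h3 (by simpa using h0)

/-- The square root of a polynomial with constant coefficient `1` has coefficients in the subalgebra
generated by those of the polynomial. -/
theorem coeff_mem_of_sq {K P : Type} [Field K] [CharZero K] [CommRing P] [Algebra K P]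
    (Z : Subalgebra K P) {Q D : P[X]} (h : D = Q ^ 2) (h0 : Q.coeff 0 = 1)
    (hD : ∀ k, D.coeff k ∈ Z) (k : ℕ) : Q.coeff k ∈ Z := by
  induction k using Nat.strong_induction_on with
  | _ k ih =>
    rcases k with _ | k
    · rw [h0]; exact one_mem _
    · have h1 : D.coeff (k + 1) = 2 * Q.coeff (k + 1) +
          ∑ i ∈ Finset.range k, Q.coeff (i + 1) * Q.coeff (k - i) := by
        rw [h, pow_two, coeff_mul, Finset.Nat.sum_antidiagonal_eq_sum_range_succ_mk,
          Finset.sum_range_succ, Finset.sum_range_succ']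
        simp only [Nat.sub_zero, Nat.sub_self, h0, Nat.reduceSubDiff]
        ring
      have h2 : Q.coeff (k + 1) = (2⁻¹ : K) • (D.coeff (k + 1) -
          ∑ i ∈ Finset.range k, Q.coeff (i + 1) * Q.coeff (k - i)) := by
        have h3 : (2 : P) * Q.coeff (k + 1) = (2 : K) • Q.coeff (k + 1) := by
          rw [two_mul, two_smul]
        rw [h1, add_sub_cancel_right, h3, smul_smul, inv_mul_cancel₀ two_ne_zero, one_smul]
      rw [h2]
      refine Z.smul_mem (sub_mem (hD _) (sum_mem fun i hi => mul_mem (ih _ ?_) (ih _ ?_))) _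
      · have := Finset.mem_range.1 hi; lia
      · lia

section

variable {K : Type} [Field K] {P : Type} [CommRing P] [Algebra K P] {n : ℕ}

/-- The scalars of a subalgebra of matrices. -/
def scalars (A : Subalgebra K (Matrix (Fin n) (Fin n) P)) : Subalgebra K P :=
  A.comap ((Algebra.ofId P (Matrix (Fin n) (Fin n) P)).restrictScalars K)

theorem mem_scalars {A : Subalgebra K (Matrix (Fin n) (Fin n) P)} {c : P} :
    c ∈ scalars A ↔ c • (1 : Matrix (Fin n) (Fin n) P) ∈ A := by
  rw [← Algebra.algebraMap_eq_smul_one]; rfl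

variable [LinearOrder K]

/-- A positive semidefinite trace on a trace algebra that is multiplicative on scalars. -/
structure IsTraceState (A : Subalgebra K (Matrix (Fin n) (Fin n) P)) (Φ : P →ₗ[K] K) : Prop where
  transpose_mem : ∀ h ∈ A, h.transpose ∈ A
  trace_mem : ∀ h ∈ A, h.trace ∈ scalars A
  one : Φ 1 = 1
  mul : ∀ c ∈ scalars A, ∀ d ∈ scalars A, Φ (c * d) = Φ c * Φ d
  nonneg : ∀ h ∈ A, 0 ≤ Φ (h * h.transpose).trace

end

theorem coeff_charpolyRev_mem {K : Type} [Field K] [CharZero K] {P : Type} [CommRing P]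
    [Algebra K P] {n : ℕ} {A : Subalgebra K (Matrix (Fin n) (Fin n) P)}
    (hA : ∀ h ∈ A, h.trace ∈ scalars A) {h : Matrix (Fin n) (Fin n) P} (hh : h ∈ A) (k : ℕ) :
    h.charpolyRev.coeff k ∈ scalars A := by
  induction k using Nat.strong_induction_on with
  | _ k ih =>
    rcases k with _ | k
    · rw [coeff_zero_eq_eval_zero, Matrix.eval_charpolyRev]; exact one_mem _
    · have h1 := charpolyRev_coeff_succ h k
      have h2 : h.charpolyRev.coeff (k + 1) = ((k + 1 : K)⁻¹) •
          (- ∑ i ∈ Finset.range (k+1), (h^(i+1)).trace * h.charpolyRev.coeff (k-i)) := by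
        have h3 : (k + 1 : P) * h.charpolyRev.coeff (k + 1) =
            (k + 1 : K) • h.charpolyRev.coeff (k + 1) := by
          rw [Algebra.smul_def]; simp
        rw [← h1, h3, smul_smul, inv_mul_cancel₀ (by exact_mod_cast k.succ_ne_zero), one_smul]
      rw [h2]
      exact (scalars A).smul_mem (neg_mem (sum_mem fun i _ =>
        mul_mem (hA _ (pow_mem hh _)) (ih _ (by lia)))) _

theorem coeff_charpoly_mem {K : Type} [Field K] [CharZero K] {P : Type} [CommRing P]
    [Algebra K P] {n : ℕ} {A : Subalgebra K (Matrix (Fin n) (Fin n) P)}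
    (hA : ∀ h ∈ A, h.trace ∈ scalars A) {h : Matrix (Fin n) (Fin n) P} (hh : h ∈ A) (k : ℕ) :
    h.charpoly.coeff k ∈ scalars A := by
  have := coeff_charpolyRev_mem hA hh (revAt h.charpoly.natDegree k)
  rwa [← Matrix.reverse_charpoly, coeff_reverse, revAt_invol] at this

end

section

namespace IsTraceState

variable {K : Type} [Field K] [LinearOrder K] {P : Type} [CommRing P]
  [Algebra K P] {n : ℕ} {A : Subalgebra K (Matrix (Fin n) (Fin n) P)} {Φ : P →ₗ[K] K}

/-- The radical of the trace form. -/
def radical (_ : IsTraceState A Φ) : Ideal A where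
  carrier := {x | ∀ y : A, Φ ((x : Matrix (Fin n) (Fin n) P) * y).trace = 0}
  add_mem' {a b} ha hb y := by
    have h1 := ha y
    have h2 := hb y
    rw [Subalgebra.coe_add, add_mul, Matrix.trace_add, map_add, h1, h2, add_zero]
  zero_mem' y := by simp
  smul_mem' c x hx y := by
    have h1 := hx (y * c)
    rw [Subalgebra.coe_mul] at h1
    rw [smul_eq_mul, Subalgebra.coe_mul, mul_assoc, Matrix.trace_mul_comm, mul_assoc, h1]

variable (H : IsTraceState A Φ)
include H

instance radical_isTwoSided : H.radical.IsTwoSided := ⟨fun {x} b hx y => by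
  have h1 := hx (b * y)
  rwa [Subalgebra.coe_mul, ← mul_assoc] at h1⟩

/-- The transpose as a linear map. -/
def transposeMap : A →ₗ[K] A where
  toFun x := ⟨(x : Matrix (Fin n) (Fin n) P).transpose, H.transpose_mem _ x.2⟩
  map_add' x y := by ext; rfl
  map_smul' c x := by ext; rfl

theorem coe_transposeMap (x : A) : (H.transposeMap x : Matrix (Fin n) (Fin n) P) =
    (x : Matrix (Fin n) (Fin n) P).transpose := rfl

/-- The trace state as a linear map. -/
def traceMap (_ : IsTraceState A Φ) : A →ₗ[K] K :=
  Φ ∘ₗ (Matrix.traceLinearMap (Fin n) K P) ∘ₗ A.val.toLinearMap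

theorem traceMap_apply (x : A) : H.traceMap x = Φ (x : Matrix (Fin n) (Fin n) P).trace := rfl

theorem transposeMap_mem {x : A} (hx : x ∈ H.radical) : H.transposeMap x ∈ H.radical := by
  intro y
  have h1 := hx (H.transposeMap y)
  rw [coe_transposeMap] at h1 ⊢
  rw [← Matrix.trace_transpose, Matrix.transpose_mul, Matrix.transpose_transpose,
    Matrix.trace_mul_comm, h1]

/-- The trace state on scalars as a ring homomorphism. -/
def scalarHom : scalars A →+* K where
  toFun c := Φ c.1
  map_one' := H.one
  map_mul' c d := H.mul _ c.2 _ d.2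
  map_zero' := map_zero Φ
  map_add' _ _ := map_add Φ _ _

theorem smul_one_sub_mem {c : P} (hc : c ∈ scalars A) :
    (⟨c • 1, mem_scalars.1 hc⟩ : A) - algebraMap K A (Φ c) ∈ H.radical := by
  intro y
  rw [Subalgebra.coe_sub, Subalgebra.coe_algebraMap, sub_mul, smul_mul_assoc, one_mul,
    ← Algebra.smul_def, Matrix.trace_sub, Matrix.trace_smul, Matrix.trace_smul, map_sub, map_smul Φ,
    smul_eq_mul, smul_eq_mul, H.mul c hc _ (H.trace_mem _ y.2), sub_self]

variable [IsStrictOrderedRing K]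

theorem traceMap_pos {x : A} (hx : x ∉ H.radical) : 0 < H.traceMap (H.transposeMap x * x) := by
  have hnn : ∀ z : A, 0 ≤ H.traceMap (H.transposeMap z * z) := by
    intro z
    have := H.nonneg _ (H.transpose_mem _ z.2)
    rwa [Matrix.transpose_transpose] at this
  have hcomm : ∀ x y, H.traceMap (x * y) = H.traceMap (y * x) := by
    intro x y
    rw [traceMap_apply, traceMap_apply, Subalgebra.coe_mul, Matrix.trace_mul_comm,
        Subalgebra.coe_mul]
  refine (hnn x).lt_of_ne' fun h0 => hx fun y => ?_
  have hT : ∀ z, H.traceMap (H.transposeMap z) = H.traceMap z := by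
    intro z
    simp only [traceMap_apply, coe_transposeMap, Matrix.trace_transpose]
  have hTT : ∀ z, H.transposeMap (H.transposeMap z) = z := by
    intro z; ext1; simp only [coe_transposeMap, Matrix.transpose_transpose]
  have hTm : ∀ z w, H.transposeMap (z * w) = H.transposeMap w * H.transposeMap z := by
    intro z w; ext1; simp only [coe_transposeMap, Subalgebra.coe_mul, Matrix.transpose_mul]
  set z := H.transposeMap y with hz
  have hb : H.traceMap (H.transposeMap z * x) = H.traceMap (H.transposeMap x * z) := by
    rw [← hT, hTm, hTT]
  have hgoal : H.traceMap (H.transposeMap x * z) = 0 := by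
    by_contra hne
    set b := H.traceMap (H.transposeMap x * z)
    set q := H.traceMap (H.transposeMap z * z)
    have h1 := hnn ((-(q + 1) / (2 * b)) • x + z)
    have h2 : H.traceMap (H.transposeMap ((-(q + 1) / (2 * b)) • x + z) *
        ((-(q + 1) / (2 * b)) • x + z)) = 2 * (-(q + 1) / (2 * b)) * b + q := by
      simp only [map_add, map_smul, add_mul, mul_add, smul_mul_assoc, mul_smul_comm, smul_eq_mul,
        h0, hb]
      ring
    rw [h2] at h1
    have h3 : 2 * (-(q + 1) / (2 * b)) * b + q = -1 := by field_simp; ring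
    rw [h3] at h1
    linarith
  rw [← hb, hz, hTT, hcomm] at hgoal
  exact hgoal

/-- The trace of the quotient by the radical. -/
def posTrace : PosTrace K (A ⧸ H.radical) :=
  { star := Submodule.mapQ (H.radical.restrictScalars K) (H.radical.restrictScalars K)
      H.transposeMap fun _ hx => H.transposeMap_mem hx
    tr := Submodule.liftQ (H.radical.restrictScalars K) H.traceMap fun x hx => by
      simpa [traceMap_apply] using hx 1
    star_mul := by
      intro x y
      obtain ⟨x, rfl⟩ := Ideal.Quotient.mk_surjective x
      obtain ⟨y, rfl⟩ := Ideal.Quotient.mk_surjective y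
      refine congrArg (Ideal.Quotient.mk H.radical) (?_ : H.transposeMap (x * y) =
        H.transposeMap y * H.transposeMap x)
      ext1; simp only [coe_transposeMap, Subalgebra.coe_mul, Matrix.transpose_mul]
    star_star := by
      intro x
      obtain ⟨x, rfl⟩ := Ideal.Quotient.mk_surjective x
      refine congrArg (Ideal.Quotient.mk H.radical) (?_ : H.transposeMap (H.transposeMap x) = x)
      ext1; simp only [coe_transposeMap, Matrix.transpose_transpose]
    tr_mul_comm := by
      intro x y
      obtain ⟨x, rfl⟩ := Ideal.Quotient.mk_surjective x
      obtain ⟨y, rfl⟩ := Ideal.Quotient.mk_surjective y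
      change H.traceMap (x * y) = H.traceMap (y * x)
      rw [traceMap_apply, traceMap_apply, Subalgebra.coe_mul, Matrix.trace_mul_comm,
        Subalgebra.coe_mul]
    tr_star := by
      intro x
      obtain ⟨x, rfl⟩ := Ideal.Quotient.mk_surjective x
      change H.traceMap (H.transposeMap x) = H.traceMap x
      simp only [traceMap_apply, coe_transposeMap, Matrix.trace_transpose]
    tr_pos := by
      intro x hx
      obtain ⟨x, rfl⟩ := Ideal.Quotient.mk_surjective x
      exact H.traceMap_pos fun h => hx (Ideal.Quotient.eq_zero_iff_mem.2 h) }

end IsTraceState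

end

section

theorem coeff_zero_charpolyRev {P : Type} [CommRing P] {n : ℕ} (M : Matrix (Fin n) (Fin n) P) :
    M.charpolyRev.coeff 0 = 1 := by
  rw [coeff_zero_eq_eval_zero, Matrix.eval_charpolyRev]

theorem exists_scalars_poly {K : Type} [Field K] {P : Type} [CommRing P] [Algebra K P] {n : ℕ}
    {A : Subalgebra K (Matrix (Fin n) (Fin n) P)} {Q : P[X]} (hQ : ∀ k, Q.coeff k ∈ scalars A) :
    ∃ D : (scalars A)[X], D.map (scalars A).val.toRingHom = Q := by
  have : Q ∈ Polynomial.lifts (scalars A).val.toRingHom := by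
    rw [lifts_iff_coeff_lifts]
    exact fun k => ⟨⟨_, hQ k⟩, rfl⟩
  simpa [Polynomial.mem_lifts] using this

namespace IsTraceState

variable {K : Type} [Field K] [LinearOrder K] [IsStrictOrderedRing K] {P : Type} [CommRing P]
  [Algebra K P] {n : ℕ} {A : Subalgebra K (Matrix (Fin n) (Fin n) P)} {Φ : P →ₗ[K] K}
  (H : IsTraceState A Φ)
include H

theorem isIntegral (s : A ⧸ H.radical) : IsIntegral K s := by
  obtain ⟨s, rfl⟩ := Ideal.Quotient.mk_surjective s
  obtain ⟨D, hD⟩ := exists_scalars_poly (coeff_charpoly_mem H.trace_mem s.2)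
  have hinj : Function.Injective (scalars A).val.toRingHom := Subtype.val_injective
  have hDm : D.Monic := by
    refine Polynomial.monic_of_injective hinj ?_
    rw [hD]; exact Matrix.charpoly_monic _
  refine ⟨D.map H.scalarHom, hDm.map _, ?_⟩
  have h0 : ∑ k ∈ Finset.range (D.natDegree + 1),
      (⟨(D.coeff k : P) • 1, mem_scalars.1 (D.coeff k).2⟩ : A) * s ^ k = 0 := by
    have h1 := Matrix.aeval_self_charpoly (s : Matrix (Fin n) (Fin n) P)
    rw [← hD, aeval_eq_sum_range, natDegree_map_eq_of_injective hinj] at h1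
    ext1
    rw [AddSubmonoidClass.coe_finsetSum, ZeroMemClass.coe_zero, ← h1]
    refine Finset.sum_congr rfl fun k _ => ?_
    rw [coeff_map, Subalgebra.coe_mul, Subalgebra.coe_pow, smul_mul_assoc, one_mul]
    rfl
  have h2 := congrArg (Ideal.Quotient.mk H.radical) h0
  rw [map_sum, map_zero] at h2
  rw [eval₂_eq_sum_range' _ (n := D.natDegree + 1) (by
    exact Nat.lt_succ_of_le (natDegree_map_le)), ← h2]
  refine Finset.sum_congr rfl fun k _ => ?_
  rw [map_mul, map_pow, coeff_map]
  congr 1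
  exact (Ideal.Quotient.eq.2 (H.smul_one_sub_mem (D.coeff k).2)).symm

theorem coeff_recursion (h : A) {F : K[X]}
    (hF : ∀ k, F.coeff k = Φ ((h : Matrix (Fin n) (Fin n) P).charpolyRev.coeff k)) (k : ℕ) :
    (k + 1 : K) * F.coeff (k + 1) = - ∑ i ∈ Finset.range (k + 1),
      H.posTrace.tr (Ideal.Quotient.mk H.radical h ^ (i + 1)) * F.coeff (k - i) := by
  have h1 := charpolyRev_coeff_succ (h : Matrix (Fin n) (Fin n) P) k
  have h2 : ∀ c : P, (k + 1 : P) * c = (k + 1 : K) • c := fun c => by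
    rw [Algebra.smul_def]; simp
  rw [h2] at h1
  have h3 := congrArg Φ h1
  rw [map_smul, map_neg, map_sum, smul_eq_mul, ← hF] at h3
  rw [h3]
  refine congrArg _ (Finset.sum_congr rfl fun i _ => ?_)
  rw [H.mul _ (H.trace_mem _ (pow_mem h.2 _)) _ (coeff_charpolyRev_mem H.trace_mem h.2 _), hF,
    ← map_pow]
  rfl

theorem exists_coeff_poly {Q : P[X]} (hQ : ∀ k, Q.coeff k ∈ scalars A) (h0 : Q.coeff 0 = 1) :
    ∃ F : K[X], (∀ k, F.coeff k = Φ (Q.coeff k)) ∧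
      (∀ k, (F ^ 2).coeff k = Φ ((Q ^ 2).coeff k)) ∧ F ≠ 0 := by
  obtain ⟨D, rfl⟩ := exists_scalars_poly hQ
  have key : ∀ (E : (scalars A)[X]) k,
      (E.map H.scalarHom).coeff k = Φ ((E.map (scalars A).val.toRingHom).coeff k) := by
    intro E k
    rw [coeff_map, coeff_map]; rfl
  refine ⟨D.map H.scalarHom, key D, ?_, ?_⟩
  · intro k
    rw [← Polynomial.map_pow, ← Polynomial.map_pow, key]
  · intro h
    have := key D 0
    rw [h0, H.one, h, coeff_zero] at this
    exact zero_ne_one this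

theorem exists_natCast_tr {e : A ⧸ H.radical} (he : e * e = e) :
    ∃ m : ℕ, H.posTrace.tr e = m := by
  obtain ⟨h, rfl⟩ := Ideal.Quotient.mk_surjective e
  obtain ⟨F, hF, -, hF0⟩ := H.exists_coeff_poly (coeff_charpolyRev_mem H.trace_mem h.2)
    (coeff_zero_charpolyRev _)
  refine exists_natCast_of_recursion hF0 fun k => ?_
  rw [H.coeff_recursion h hF]
  refine congrArg _ (Finset.sum_congr rfl fun i _ => ?_)
  rw [IsIdempotentElem.pow_succ_eq i he]

theorem ode_of_skew {h : A} {e : A ⧸ H.radical}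
    (h1 : H.posTrace.star (Ideal.Quotient.mk H.radical h) = - Ideal.Quotient.mk H.radical h)
    (h2 : Ideal.Quotient.mk H.radical h * Ideal.Quotient.mk H.radical h = -e) (he : e * e = e)
    {F : K[X]} (hF : ∀ k, F.coeff k = Φ ((h : Matrix (Fin n) (Fin n) P).charpolyRev.coeff k)) :
    (1 + X ^ 2) * derivative F = C (H.posTrace.tr e) * X * F := by
  set j := Ideal.Quotient.mk H.radical h with hj
  have hstar : ∀ i : ℕ, H.posTrace.star (j ^ i) = (-1) ^ i * j ^ i := by
    intro i
    induction i with
    | zero => simp [PosTrace.star_one]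
    | succ i ih =>
      rw [pow_succ j, H.posTrace.star_mul, ih, h1, pow_succ (-1 : A ⧸ H.radical), ← pow_succ j,
        pow_succ' j]
      rcases neg_one_pow_eq_or (A ⧸ H.radical) i with h | h <;> simp [h]
  have hodd : ∀ i : ℕ, H.posTrace.tr (j ^ (2 * i + 1)) = 0 := by
    intro i
    have := H.posTrace.tr_star (j ^ (2 * i + 1))
    rw [hstar, Odd.neg_one_pow ⟨i, rfl⟩, neg_one_mul, map_neg] at this
    linarith
  have heven : ∀ i : ℕ, j ^ (2 * (i + 1)) = (-1) ^ (i + 1) * e := by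
    intro i
    rw [pow_mul, pow_two, h2, neg_pow, IsIdempotentElem.pow_succ_eq i he]
  refine ode_of_recursion (τ := fun i => H.posTrace.tr (j ^ i))
    (fun k => H.coeff_recursion h hF k) (hodd 0) ?_ fun i => ?_
  · have := heven 0
    simp only [Nat.zero_add, mul_one, pow_one] at this
    simp only [this, neg_one_mul, map_neg]
  · rcases Nat.even_or_odd' i with ⟨l, rfl | rfl⟩
    · simp only [hodd, show 2 * l + 3 = 2 * (l + 1) + 1 by ring, neg_zero]
    · rw [show 2 * l + 1 + 3 = 2 * (l + 1 + 1) by ring, show 2 * l + 1 + 1 = 2 * (l + 1) by ring,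
        heven, heven, pow_succ _ (l + 1)]
      simp

theorem exists_skew_lift {s : A ⧸ H.radical} (hs : H.posTrace.star s = -s) :
    ∃ h : A, Ideal.Quotient.mk H.radical h = s ∧
      (h : Matrix (Fin n) (Fin n) P).transpose = -h := by
  obtain ⟨x, rfl⟩ := Ideal.Quotient.mk_surjective s
  refine ⟨(2⁻¹ : K) • (x - H.transposeMap x), ?_, ?_⟩
  · have h1 : Ideal.Quotient.mk H.radical ((2⁻¹ : K) • (x - H.transposeMap x)) =
        (2⁻¹ : K) • (Ideal.Quotient.mk H.radical x -
          H.posTrace.star (Ideal.Quotient.mk H.radical x)) := rfl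
    rw [h1, hs, sub_neg_eq_add, ← two_smul K, smul_smul, inv_mul_cancel₀ two_ne_zero, one_smul]
  · rw [Subalgebra.coe_smul, Subalgebra.coe_sub, coe_transposeMap, Matrix.transpose_smul,
      Matrix.transpose_sub, Matrix.transpose_transpose, ← smul_neg, neg_sub]

theorem isIntegralTrace [IsDomain P] [IsIntegrallyClosed P[X]] :
    H.posTrace.IsIntegralTrace where
  int s _ := H.isIntegral s
  nat e _ he := H.exists_natCast_tr he
  two e i _ he hi hie := by
    obtain ⟨h, rfl⟩ := Ideal.Quotient.mk_surjective i
    obtain ⟨F, hF, -, hF0⟩ := H.exists_coeff_poly (coeff_charpolyRev_mem H.trace_mem h.2)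
      (coeff_zero_charpolyRev _)
    exact exists_even_of_ode hF0 (H.ode_of_skew hi hie he hF)
  four e i j _ he hi hj hie hje hij := by
    obtain ⟨s, rfl, hs⟩ := H.exists_skew_lift hi
    obtain ⟨r, rfl, hr⟩ := H.exists_skew_lift hj
    have h2 : (2 : P) ≠ 0 := by
      have : Function.Injective (algebraMap K P) := FaithfulSMul.algebraMap_injective K P
      rw [← map_ofNat (algebraMap K P) 2, map_ne_zero_iff _ this]
      exact two_ne_zero
    obtain ⟨Q, hQ, hQ0⟩ : ∃ Q : P[X], ((s * r : A) : Matrix (Fin n) (Fin n) P).charpolyRev = Q ^ 2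
        ∧ Q.coeff 0 = 1 := by
      obtain ⟨Q, hQ⟩ := exists_sq_eq_charpolyRev h2 (s : Matrix (Fin n) (Fin n) P) r hs hr
      have h3 : Q.coeff 0 * Q.coeff 0 = 1 := by
        rw [← coeff_zero_charpolyRev
          ((s : Matrix (Fin n) (Fin n) P) * (r : Matrix (Fin n) (Fin n) P)), hQ, pow_two,
          mul_coeff_zero]
      rcases mul_self_eq_one_iff.1 h3 with h4 | h4
      · exact ⟨Q, hQ, h4⟩
      · exact ⟨-Q, by rw [neg_sq]; exact hQ, by rw [coeff_neg, h4, neg_neg]⟩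
    obtain ⟨F, -, hF, hF0⟩ := H.exists_coeff_poly (coeff_mem_of_sq (scalars A) hQ hQ0
      (coeff_charpolyRev_mem H.trace_mem (s * r).2)) hQ0
    have h4 := H.ode_of_skew (h := s * r) (e := e) (F := F ^ 2) (by
      rw [map_mul, H.posTrace.star_mul, hi, hj, neg_mul_neg, hij, neg_neg]) (by
      have hji : Ideal.Quotient.mk H.radical r * Ideal.Quotient.mk H.radical s =
          -(Ideal.Quotient.mk H.radical s * Ideal.Quotient.mk H.radical r) := by rw [hij, neg_neg]
      rw [map_mul, mul_assoc, ← mul_assoc (Ideal.Quotient.mk H.radical r), hji, neg_mul, mul_neg,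
        ← mul_assoc, ← mul_assoc, hie, mul_assoc, hje, neg_mul_neg, he])
      he (by rw [hQ]; exact hF)
    obtain ⟨m, hm⟩ := exists_even_of_ode (c := H.posTrace.tr e / 2) hF0 (by
      have h5 : (2 * F) * ((1 + X ^ 2) * derivative F) =
          (2 * F) * (C (H.posTrace.tr e / 2) * X * F) := by
        rw [derivative_pow] at h4
        have h6 : (C (H.posTrace.tr e) : K[X]) = 2 * C (H.posTrace.tr e / 2) := by
          rw [← C_ofNat, ← C_mul, mul_div_cancel₀ _ two_ne_zero]
        rw [h6] at h4
        simp only [Nat.cast_ofNat, C_ofNat, Nat.add_one_sub_one, pow_one] at h4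
        linear_combination h4
      exact mul_left_cancel₀ (mul_ne_zero two_ne_zero hF0) h5)
    refine ⟨m, ?_⟩
    push_cast at hm ⊢
    linear_combination 2 * hm

/-- The representation attached to a trace state. -/
theorem exists_rep [IsDomain P] [IsIntegrallyClosed P[X]] (hK : PolyIVT K) :
    ∃ ρ : A →ₐ[K] Matrix (Fin n) (Fin n) K,
      (∀ (h : A) (hT), ρ ⟨(h : Matrix (Fin n) (Fin n) P).transpose, hT⟩ = (ρ h).transpose) ∧
      (∀ h : A, (ρ h).trace = Φ (h : Matrix (Fin n) (Fin n) P).trace) ∧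
      ∀ c (hc : c ∈ scalars A), ρ ⟨c • 1, mem_scalars.1 hc⟩ = Φ c • 1 := by
  have hn : H.posTrace.tr 1 = n := by
    change Φ (1 : Matrix (Fin n) (Fin n) P).trace = n
    rw [Matrix.trace_one, Fintype.card_fin, ← nsmul_one, map_nsmul, H.one, nsmul_one]
  obtain ⟨ρ, h1, h2⟩ := H.isIntegralTrace.exists_matrix_rep hK hn
  refine ⟨ρ.comp (Ideal.Quotient.mkₐ K H.radical), fun h hT => ?_, fun h => ?_, fun c hc => ?_⟩
  · exact h1 (Ideal.Quotient.mk H.radical h)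
  · exact h2 (Ideal.Quotient.mk H.radical h)
  · have h3 : Ideal.Quotient.mk H.radical ⟨c • 1, mem_scalars.1 hc⟩ =
        algebraMap K (A ⧸ H.radical) (Φ c) := Ideal.Quotient.eq.2 (H.smul_one_sub_mem hc)
    exact (congrArg ρ h3).trans ((ρ.commutes _).trans (Algebra.algebraMap_eq_smul_one _))

end IsTraceState

end

section

variable {n g : ℕ}

theorem transpose_mem_traceRing {h : MatP n g} (hh : h ∈ traceRing n g) : hᵀ ∈ traceRing n g := by
  induction hh using Algebra.adjoin_induction with
  | mem x hx =>
    rcases hx with (⟨j, rfl⟩ | ⟨j, rfl⟩) | ⟨w, hw, rfl⟩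
    · exact Algebra.subset_adjoin (Or.inl (Or.inr ⟨j, rfl⟩))
    · exact Algebra.subset_adjoin (Or.inl (Or.inl ⟨j, rfl⟩))
    · refine Algebra.subset_adjoin (Or.inr ⟨w, hw, ?_⟩)
      rw [transpose_smul, transpose_one]
  | algebraMap r =>
    rw [Algebra.algebraMap_eq_smul_one, transpose_smul, transpose_one]
    exact Subalgebra.smul_mem _ (one_mem _) _
  | add x y _ _ hx hy => rw [transpose_add]; exact add_mem hx hy
  | mul x y _ _ hx hy => rw [transpose_mul]; exact mul_mem hy hx

theorem trace_smul_one_mem_traceRing {h : MatP n g} (hh : h ∈ traceRing n g) :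
    h.trace • (1 : MatP n g) ∈ traceRing n g := by
  have key : ∀ x ∈ Submonoid.closure (genSet n g ∪
      {m | ∃ w ∈ Submonoid.closure (genSet n g), m = (Matrix.trace w) • (1 : MatP n g)}),
      ∃ p : PolyRing n g, ∃ w ∈ Submonoid.closure (genSet n g),
        p • (1 : MatP n g) ∈ traceRing n g ∧ x = p • w := by
    intro x hx
    induction hx using Submonoid.closure_induction with
    | mem x hx =>
      rcases hx with hx | ⟨w, hw, rfl⟩
      · exact ⟨1, x, Submonoid.subset_closure hx, by rw [one_smul]; exact one_mem _,
          (one_smul _ _).symm⟩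
      · exact ⟨w.trace, 1, one_mem _, Algebra.subset_adjoin (Or.inr ⟨w, hw, rfl⟩), rfl⟩
    | one => exact ⟨1, 1, one_mem _, by rw [one_smul]; exact one_mem _, (one_smul _ _).symm⟩
    | mul x y _ _ hx hy =>
      obtain ⟨p, w, hw, hp, rfl⟩ := hx
      obtain ⟨q, v, hv, hq, rfl⟩ := hy
      refine ⟨p * q, w * v, mul_mem hw hv, ?_, ?_⟩
      · have := mul_mem hp hq
        rwa [smul_mul_smul_comm, one_mul] at this
      · rw [smul_mul_smul_comm]
  have hh' : h ∈ Submodule.span ℝ (Submonoid.closure (genSet n g ∪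
      {m | ∃ w ∈ Submonoid.closure (genSet n g), m = (Matrix.trace w) • (1 : MatP n g)}) :
        Set (MatP n g)) := by
    rw [← Algebra.adjoin_eq_span]; exact hh
  induction hh' using Submodule.span_induction with
  | mem x hx =>
    obtain ⟨p, w, hw, hp, rfl⟩ := key x hx
    have := mul_mem hp (show w.trace • (1 : MatP n g) ∈ traceRing n g from
      Algebra.subset_adjoin (Or.inr ⟨w, hw, rfl⟩))
    rwa [smul_mul_smul_comm, one_mul, ← smul_eq_mul, ← trace_smul] at this
  | zero => rw [trace_zero, zero_smul]; exact zero_mem _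
  | add x y hx hy h1 h2 =>
    rw [← Algebra.adjoin_eq_span] at hx hy
    rw [trace_add, add_smul]; exact add_mem (h1 hx) (h2 hy)
  | smul r x hx h1 =>
    rw [← Algebra.adjoin_eq_span] at hx
    rw [trace_smul, smul_assoc]; exact Subalgebra.smul_mem _ (h1 hx) _

/-- Evaluation of matrices of polynomials as a ring homomorphism. -/
def evalHom (X : Fin g → Matrix (Fin n) (Fin n) ℝ) : MatP n g →+* Matrix (Fin n) (Fin n) ℝ :=
  (MvPolynomial.eval fun v : Fin g × Fin n × Fin n => X v.1 v.2.1 v.2.2).mapMatrix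

theorem evalMat_eq (X : Fin g → Matrix (Fin n) (Fin n) ℝ) (h : MatP n g) :
    evalMat n g X h = evalHom X h := rfl

theorem evalHom_transpose (X : Fin g → Matrix (Fin n) (Fin n) ℝ) (h : MatP n g) :
    evalHom X hᵀ = (evalHom X h)ᵀ := rfl

theorem evalHom_smul_one (X : Fin g → Matrix (Fin n) (Fin n) ℝ) (p : PolyRing n g) :
    evalHom X (p • (1 : MatP n g)) =
      MvPolynomial.eval (fun v : Fin g × Fin n × Fin n => X v.1 v.2.1 v.2.2) p • 1 := by
  ext i j
  by_cases h : i = j <;> simp [evalHom, h]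

theorem trace_evalHom (X : Fin g → Matrix (Fin n) (Fin n) ℝ) (h : MatP n g) :
    (evalHom X h).trace =
      MvPolynomial.eval (fun v : Fin g × Fin n × Fin n => X v.1 v.2.1 v.2.2) h.trace := by
  simp [evalHom, Matrix.trace, map_sum]

theorem isCyclicPreordering_nonneg (hn : 0 < n) (S : Set (MatP n g)) :
    IsCyclicPreordering n g {t | (t ∈ traceRing n g ∧ tᵀ = t) ∧
      ∀ X ∈ KSet n g S, (evalMat n g X t).PosSemidef} := by
  refine ⟨⟨fun q hq => hq.1, ?_, ?_, ?_, ?_⟩, ?_⟩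
  · refine ⟨⟨one_mem _, transpose_one⟩, fun X _ => ?_⟩
    rw [evalMat_eq, map_one]
    exact PosSemidef.one
  · rintro a ⟨⟨ha1, ha2⟩, ha3⟩ b ⟨⟨hb1, hb2⟩, hb3⟩
    refine ⟨⟨add_mem ha1 hb1, by rw [transpose_add, ha2, hb2]⟩, fun X hX => ?_⟩
    rw [evalMat_eq, map_add]
    exact (ha3 X hX).add (hb3 X hX)
  · rintro h hh q ⟨⟨hq1, hq2⟩, hq3⟩
    refine ⟨⟨mul_mem (mul_mem hh hq1) (transpose_mem_traceRing hh), ?_⟩, fun X hX => ?_⟩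
    · rw [transpose_mul, transpose_mul, transpose_transpose, hq2, mul_assoc]
    · rw [evalMat_eq, map_mul, map_mul, evalHom_transpose, ← conjTranspose_eq_transpose_of_trivial]
      exact (hq3 X hX).mul_mul_conjTranspose_same _
  · rintro q ⟨⟨hq1, hq2⟩, hq3⟩
    refine ⟨⟨trace_smul_one_mem_traceRing hq1, by rw [transpose_smul, transpose_one]⟩,
      fun X hX => ?_⟩
    rw [evalMat_eq, evalHom_smul_one, ← trace_evalHom]
    exact PosSemidef.one.smul (hq3 X hX).trace_nonneg
  · rintro _ ⟨⟨⟨ha1, ha2⟩, ha3⟩, -, p, rfl⟩ _ ⟨⟨⟨hb1, hb2⟩, hb3⟩, -, q, rfl⟩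
    refine ⟨⟨mul_mem ha1 hb1, ?_⟩, fun X hX => ?_⟩
    · rw [transpose_mul, ha2, hb2, smul_mul_smul_comm, smul_mul_smul_comm, mul_comm]
    · have h1 := (ha3 X hX).diag_nonneg (i := ⟨0, hn⟩)
      have h2 := (hb3 X hX).diag_nonneg (i := ⟨0, hn⟩)
      rw [evalMat_eq, evalHom_smul_one, Matrix.smul_apply, one_apply_eq, smul_eq_mul, mul_one]
        at h1 h2
      rw [evalMat_eq, map_mul, evalHom_smul_one, evalHom_smul_one, smul_mul_smul_comm, one_mul]
      exact PosSemidef.one.smul (mul_nonneg h1 h2)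

theorem posSemidef_of_mem_TtrS (hn : 0 < n) {S : Set (MatP n g)}
    (hS : ∀ s ∈ S, s ∈ traceRing n g ∧ sᵀ = s) {t : MatP n g} (ht : t ∈ TtrS n g S)
    {X : Fin g → Matrix (Fin n) (Fin n) ℝ} (hX : X ∈ KSet n g S) :
    (evalMat n g X t).PosSemidef :=
  (ht _ (isCyclicPreordering_nonneg hn S) fun s hs => ⟨hS s hs, fun _ hY => hY s hs⟩).2 X hX

/-- A symmetric real matrix with a positivity certificate is positive semidefinite. -/
theorem posSemidef_of_certificate {M t₁ t₂ : Matrix (Fin n) (Fin n) ℝ} (hM : Mᵀ = M)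
    (h₁ : t₁.PosSemidef) (h₂ : t₂.PosSemidef) {k : ℕ} (h : M * t₁ = M ^ (2 * k) + t₂) :
    M.PosSemidef := by
  have hH : M.IsHermitian := by
    rw [IsHermitian, conjTranspose_eq_transpose_of_trivial, hM]
  rw [hH.posSemidef_iff_eigenvalues_nonneg]
  intro i
  by_contra hlt
  have hlt' : hH.eigenvalues i < 0 := not_le.1 hlt
  set l := hH.eigenvalues i
  set v : Fin n → ℝ := (hH.eigenvectorBasis i).ofLp with hv
  have hMv : M *ᵥ v = l • v := hH.mulVec_eigenvectorBasis i
  have hpow : ∀ m : ℕ, M ^ m *ᵥ v = l ^ m • v := by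
    intro m
    induction m with
    | zero => simp
    | succ m ih => rw [pow_succ, ← mulVec_mulVec, hMv, mulVec_smul, ih, smul_smul, pow_succ']
  have hv0 : v ≠ 0 := fun h0 => hH.eigenvectorBasis.toBasis.ne_zero i (by
    rw [OrthonormalBasis.coe_toBasis]; ext j; exact congrFun h0 j)
  have hvv : 0 < v ⬝ᵥ v := by
    simpa using dotProduct_star_self_pos_iff.2 hv0
  have h3 := congrArg (fun N => v ⬝ᵥ (N *ᵥ v)) h
  simp only [add_mulVec, dotProduct_add, hpow, dotProduct_smul, smul_eq_mul] at h3
  rw [← mulVec_mulVec, dotProduct_mulVec, ← mulVec_transpose, hM, hMv, smul_dotProduct,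
    smul_eq_mul] at h3
  have h4 := h₁.dotProduct_mulVec_nonneg v
  have h5 := h₂.dotProduct_mulVec_nonneg v
  rw [star_trivial] at h4 h5
  have h6 : 0 < l ^ (2 * k) * (v ⬝ᵥ v) := by
    have h7 : l ≠ 0 := hlt'.ne
    rw [pow_mul]
    exact mul_pos (pow_pos (by positivity) k) hvv
  linarith [mul_nonpos_of_nonpos_of_nonneg hlt'.le h4]

end

section

/-- A quadratic form with coefficients in a subring of an ordered field that is positive
semidefinite over the subring is so over the field. -/
theorem quadraticForm_nonneg_of_subring {K : Type} [Field K] [LinearOrder K]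
    [IsStrictOrderedRing K] (R : Subring K) {m : ℕ} (G : Matrix (Fin m) (Fin m) K)
    (hG : ∀ i j, G i j = G j i) (hR : ∀ i j, G i j ∈ R)
    (h : ∀ c : Fin m → K, (∀ i, c i ∈ R) → 0 ≤ ∑ i, ∑ j, c i * c j * G i j) (c : Fin m → K) :
    0 ≤ ∑ i, ∑ j, c i * c j * G i j := by
  induction m with
  | zero => simp
  | succ m ih =>
    have key : ∀ c : Fin (m + 1) → K, ∑ i, ∑ j, c i * c j * G i j =
        c 0 ^ 2 * G 0 0 + 2 * c 0 * ∑ j : Fin m, c j.succ * G 0 j.succ +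
          ∑ i : Fin m, ∑ j : Fin m, c i.succ * c j.succ * G i.succ j.succ := by
      intro c
      simp only [Fin.sum_univ_succ, Finset.sum_add_distrib, Finset.mul_sum]
      rw [show ∑ i : Fin m, c i.succ * c 0 * G i.succ 0 = ∑ i : Fin m, c 0 * c i.succ * G 0 i.succ
        from Finset.sum_congr rfl fun i _ => by rw [hG i.succ 0]; ring,
        show ∑ i : Fin m, 2 * c 0 * (c i.succ * G 0 i.succ) =
          ∑ i : Fin m, c 0 * c i.succ * G 0 i.succ + ∑ i : Fin m, c 0 * c i.succ * G 0 i.succ by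
          rw [← Finset.sum_add_distrib]; exact Finset.sum_congr rfl fun i _ => by ring]
      ring
    have hcons : ∀ (t : K) (d : Fin m → K), t ∈ R → (∀ i, d i ∈ R) →
        0 ≤ t ^ 2 * G 0 0 + 2 * t * ∑ j : Fin m, d j * G 0 j.succ +
          ∑ i : Fin m, ∑ j : Fin m, d i * d j * G i.succ j.succ := by
      intro t d ht hd
      have := h (Fin.cons t d) (Fin.cases ht hd)
      rw [key] at this
      simpa using this
    have h00 : 0 ≤ G 0 0 := by
      simpa using hcons 1 0 (one_mem _) fun _ => zero_mem _
    rw [key]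
    rcases h00.eq_or_lt with h0 | h0
    · have hg : ∀ j : Fin m, G 0 j.succ = 0 := by
        intro j
        by_contra hne
        have h1 := hcons (-(G j.succ j.succ ^ 2 + 1)) (Pi.single j (G 0 j.succ))
          (neg_mem (add_mem (pow_mem (hR _ _) _) (one_mem _))) (fun i => by
            by_cases hij : i = j
            · subst hij; simpa using hR _ _
            · simp [hij])
        simp only [← h0, Pi.single_apply, ite_mul, zero_mul, mul_ite, mul_zero, Finset.sum_ite_eq',
          Finset.mem_univ, if_true] at h1
        have h2 : 0 < G 0 j.succ ^ 2 := by positivity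
        nlinarith [sq_nonneg (G j.succ j.succ - 1), sq_nonneg (G j.succ j.succ)]
      simp only [← h0, hg, mul_zero, Finset.sum_const_zero, zero_add]
      refine ih (Matrix.of fun i j => G i.succ j.succ) (fun i j => hG _ _) (fun i j => hR _ _)
        (fun d hd => ?_) fun i => c i.succ
      simpa [hg] using hcons 0 d (zero_mem _) hd
    · have hid : ∀ (t : K) (d : Fin m → K), G 0 0 * (t ^ 2 * G 0 0 +
          2 * t * ∑ j : Fin m, d j * G 0 j.succ +
          ∑ i : Fin m, ∑ j : Fin m, d i * d j * G i.succ j.succ) =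
          (t * G 0 0 + ∑ j : Fin m, d j * G 0 j.succ) ^ 2 + ∑ i : Fin m, ∑ j : Fin m,
            d i * d j * (G 0 0 * G i.succ j.succ - G 0 i.succ * G 0 j.succ) := by
        intro t d
        have h1 : ∑ i : Fin m, ∑ j : Fin m,
            d i * d j * (G 0 0 * G i.succ j.succ - G 0 i.succ * G 0 j.succ) =
            G 0 0 * ∑ i : Fin m, ∑ j : Fin m, d i * d j * G i.succ j.succ -
            (∑ j : Fin m, d j * G 0 j.succ) * ∑ j : Fin m, d j * G 0 j.succ := by
          rw [Finset.sum_mul_sum, Finset.mul_sum, ← Finset.sum_sub_distrib]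
          refine Finset.sum_congr rfl fun i _ => ?_
          rw [Finset.mul_sum, ← Finset.sum_sub_distrib]
          exact Finset.sum_congr rfl fun j _ => by ring
        rw [h1]; ring
      have h2 := ih (Matrix.of fun i j => G 0 0 * G i.succ j.succ - G 0 i.succ * G 0 j.succ)
        (fun i j => by simp only [Matrix.of_apply, hG i.succ j.succ]; ring)
        (fun i j => sub_mem (mul_mem (hR _ _) (hR _ _)) (mul_mem (hR _ _) (hR _ _)))
        (fun d hd => by
          simp only [Matrix.of_apply]
          have h3 := hcons (-∑ j : Fin m, d j * G 0 j.succ) (fun i => G 0 0 * d i)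
            (neg_mem (sum_mem fun j _ => mul_mem (hd _) (hR _ _)))
            (fun i => mul_mem (hR _ _) (hd _))
          have h4 := hid (-∑ j : Fin m, d j * G 0 j.succ) (fun i => G 0 0 * d i)
          have h5 : -(∑ j : Fin m, d j * G 0 j.succ) * G 0 0 +
              ∑ j : Fin m, G 0 0 * d j * G 0 j.succ = 0 := by
            simp only [mul_assoc, ← Finset.mul_sum]; ring
          have h6 : ∑ i : Fin m, ∑ j : Fin m, G 0 0 * d i * (G 0 0 * d j) *
              (G 0 0 * G i.succ j.succ - G 0 i.succ * G 0 j.succ) = G 0 0 ^ 2 *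
              ∑ i : Fin m, ∑ j : Fin m, d i * d j *
              (G 0 0 * G i.succ j.succ - G 0 i.succ * G 0 j.succ) := by
            simp only [Finset.mul_sum]
            exact Finset.sum_congr rfl fun i _ => Finset.sum_congr rfl fun j _ => by ring
          rw [h5, h6] at h4
          have h7 := mul_nonneg h0.le h3
          rw [h4, zero_pow two_ne_zero, zero_add] at h7
          exact nonneg_of_mul_nonneg_right h7 (by positivity)) fun i => c i.succ
      simp only [Matrix.of_apply] at h2
      refine nonneg_of_mul_nonneg_right (a := G 0 0) ?_ h0
      rw [hid]
      exact add_nonneg (sq_nonneg _) h2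

variable {n g : ℕ}

theorem isCyclicPreordering_TtrS (hn : 0 < n) {S : Set (MatP n g)}
    (hS : ∀ s ∈ S, s ∈ traceRing n g ∧ sᵀ = s) : IsCyclicPreordering n g (TtrS n g S) := by
  refine ⟨⟨fun q hq => ?_, fun T hT _ => hT.1.2.1, fun a ha b hb T hT hST => ?_,
    fun h hh q hq T hT hST => ?_, fun q hq T hT hST => ?_⟩, fun a ha b hb T hT hST => ?_⟩
  · exact (hq _ (isCyclicPreordering_nonneg hn S)
      fun s hs => ⟨hS s hs, fun _ hY => hY s hs⟩).1
  · exact hT.1.2.2.1 a (ha T hT hST) b (hb T hT hST)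
  · exact hT.1.2.2.2.1 h hh q (hq T hT hST)
  · exact hT.1.2.2.2.2 q (hq T hT hST)
  · exact hT.2 a ⟨ha.1 T hT hST, ha.2⟩ b ⟨hb.1 T hT hST, hb.2⟩

open Polynomial in
/-- In the absence of a certificate, the scalars of the trace ring have an ordered real closed
point at which the given element has a negative eigenvalue. -/
theorem exists_field_of_no_certificate (hn : 0 < n) {S : Set (MatP n g)}
    (hS : ∀ s ∈ S, s ∈ traceRing n g ∧ sᵀ = s) {a : MatP n g} (haT : a ∈ traceRing n g)
    (haSym : aᵀ = a) (hno : ¬ ∃ t₁ ∈ TtrS n g S, ∃ t₂ ∈ TtrS n g S, ∃ k : ℕ,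
      a * t₁ = a ^ (2 * k) + t₂ ∧ t₁ * a = a ^ (2 * k) + t₂) :
    ∃ (K : Type) (_ : Field K) (_ : LinearOrder K) (_ : IsStrictOrderedRing K)
      (φ : scalars (traceRing n g) →+* K) (α : K), PolyIVT K ∧ α < 0 ∧
      (∀ t : scalars (traceRing n g), (t : PolyRing n g) • (1 : MatP n g) ∈ TtrS n g S → 0 ≤ φ t) ∧
      ∀ f : (scalars (traceRing n g))[X], aeval a f = 0 → f.eval₂ φ α = 0 := by
  have hT := isCyclicPreordering_TtrS hn hS
  set Z := scalars (traceRing n g)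
  have hmem : ∀ q : Z[X], aeval a q ∈ traceRing n g := by
    intro q
    rw [aeval_eq_sum_range]
    refine sum_mem fun i _ => ?_
    have : q.coeff i • a ^ i = ((q.coeff i : PolyRing n g) • (1 : MatP n g)) * a ^ i := by
      rw [smul_mul_assoc, one_mul]; rfl
    rw [this]
    exact mul_mem (mem_scalars.1 (q.coeff i).2) (pow_mem haT _)
  have hsym : ∀ q : Z[X], (aeval a q)ᵀ = aeval a q := by
    intro q
    rw [aeval_eq_sum_range, transpose_sum]
    refine Finset.sum_congr rfl fun i _ => ?_
    rw [transpose_smul, transpose_pow, haSym]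
  let Γ : Submonoid Z[X] :=
    { carrier := {x | ∃ t : Z, (t : PolyRing n g) • (1 : MatP n g) ∈ TtrS n g S ∧
        ∃ q : Z[X], x = C t * q ^ 2}
      one_mem' := ⟨1, by rw [OneMemClass.coe_one, one_smul]; exact hT.1.2.1, 1, by simp⟩
      mul_mem' := by
        rintro _ _ ⟨t, ht, q, rfl⟩ ⟨u, hu, r, rfl⟩
        refine ⟨t * u, ?_, q * r, by rw [C_mul]; ring⟩
        have := hT.2 _ ⟨ht, mem_scalars.1 t.2, _, rfl⟩ _ ⟨hu, mem_scalars.1 u.2, _, rfl⟩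
        rwa [smul_mul_smul_comm, one_mul] at this }
  have hzero : (0 : MatP n g) ∈ TtrS n g S := by
    have := hT.1.2.2.2.1 0 (zero_mem _) 1 hT.1.2.1
    rwa [zero_mul, zero_mul] at this
  have hΓ : ∀ d ∈ Subsemiring.closure (Γ : Set Z[X]), aeval a d ∈ TtrS n g S := by
    intro d hd
    rw [Subsemiring.mem_closure_iff, Submonoid.closure_eq] at hd
    induction hd using AddSubmonoid.closure_induction with
    | mem x hx =>
      obtain ⟨t, ht, q, rfl⟩ := hx
      have h1 := hT.1.2.2.2.1 _ (hmem q) _ ht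
      rw [hsym] at h1
      have h2 : aeval a (C t * q ^ 2) =
          aeval a q * ((t : PolyRing n g) • (1 : MatP n g)) * aeval a q := by
        rw [mul_smul_comm, mul_one, smul_mul_assoc, map_mul, aeval_C, pow_two, map_mul,
          ← Algebra.smul_def]
        rfl
      rwa [h2]
    | zero => rwa [map_zero]
    | add x y _ _ hx hy => rw [map_add]; exact hT.1.2.2.1 _ hx _ hy
  let M : Set Z[X] := {f | ∃ d ∈ Subsemiring.closure (Γ : Set Z[X]), aeval a f = aeval a d}
  have hM : IsPreord M :=
    { add := by
        rintro _ _ ⟨d, hd, h1⟩ ⟨e, he, h2⟩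
        exact ⟨d + e, add_mem hd he, by rw [map_add, map_add, h1, h2]⟩
      mul := by
        rintro _ _ ⟨d, hd, h1⟩ ⟨e, he, h2⟩
        exact ⟨d * e, mul_mem hd he, by rw [map_mul, map_mul, h1, h2]⟩
      sq := fun x => ⟨x * x, Subsemiring.subset_closure
        ⟨1, by rw [OneMemClass.coe_one, one_smul]; exact hT.1.2.1, x, by rw [C_1]; ring⟩, rfl⟩ }
  obtain ⟨K, i1, i2, i3, ψ, hK, hψ, hneg⟩ := hM.exists_field X (by
    rintro t₁ ⟨d, hd, h1⟩ t₂ ⟨e, he, h2⟩ k h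
    have h3 := congrArg (aeval a) h
    rw [map_mul, map_add, map_pow, aeval_X, h1, h2] at h3
    refine hno ⟨_, hΓ d hd, _, hΓ e he, k, h3, ?_⟩
    have h4 := congrArg (aeval a) (mul_comm d X)
    rw [map_mul, map_mul, aeval_X] at h4
    rw [← h3, h4])
  refine ⟨K, i1, i2, i3, ψ.comp C, ψ X, hK, hneg, fun t ht => hψ _ ⟨C t,
    Subsemiring.subset_closure ⟨t, ht, 1, by simp⟩, rfl⟩, fun f hf => ?_⟩
  have h1 : f.eval₂ (ψ.comp C) (ψ X) = ψ f := by
    rw [← hom_eval₂, eval₂_C_X]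
  have h2 : ∀ f : Z[X], aeval a f = 0 → 0 ≤ ψ f := fun f hf =>
    hψ f ⟨0, zero_mem _, by rw [hf, map_zero]⟩
  have h3 := h2 (-f) ((map_neg (aeval a) f).trans (by rw [hf, neg_zero]))
  rw [show ψ (-f) = -ψ f from map_neg ψ f] at h3
  rw [h1]
  exact le_antisymm (neg_nonneg.1 h3) (h2 f hf)

end

section

variable {n g : ℕ} {K : Type} [Field K] [Algebra ℝ K]

/-- Extension of scalars for matrices of polynomials. -/
def baseChange (n g : ℕ) (K : Type) [Field K] [Algebra ℝ K] :
    MatP n g →+* Matrix (Fin n) (Fin n) (MvPolynomial (Fin g × Fin n × Fin n) K) :=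
  (MvPolynomial.map (algebraMap ℝ K)).mapMatrix

theorem baseChange_transpose (h : MatP n g) : baseChange n g K hᵀ = (baseChange n g K h)ᵀ := rfl

theorem trace_baseChange (h : MatP n g) :
    (baseChange n g K h).trace = MvPolynomial.map (algebraMap ℝ K) h.trace := by
  simp [baseChange, Matrix.trace, map_sum]

theorem baseChange_smul_one (p : PolyRing n g) :
    baseChange n g K (p • (1 : MatP n g)) = MvPolynomial.map (algebraMap ℝ K) p • 1 := by
  ext1 i j
  by_cases h : i = j <;> simp [baseChange, h]

/-- The trace ring with scalars extended to a field. -/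
def traceRingExt (n g : ℕ) (K : Type) [Field K] [Algebra ℝ K] :
    Subalgebra K (Matrix (Fin n) (Fin n) (MvPolynomial (Fin g × Fin n × Fin n) K)) :=
  Algebra.adjoin K (baseChange n g K '' traceRing n g)

theorem baseChange_mem {h : MatP n g} (hh : h ∈ traceRing n g) :
    baseChange n g K h ∈ traceRingExt n g K := Algebra.subset_adjoin ⟨h, hh, rfl⟩

theorem mem_span_of_mem_traceRingExt
    {x : Matrix (Fin n) (Fin n) (MvPolynomial (Fin g × Fin n × Fin n) K)}
    (hx : x ∈ traceRingExt n g K) : x ∈ Submodule.span K (baseChange n g K '' traceRing n g) := by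
  have h1 : (baseChange n g K '' traceRing n g) =
      ((traceRing n g).toSubsemiring.toSubmonoid.map (baseChange n g K).toMonoidHom : Set _) := rfl
  rw [traceRingExt, h1] at hx
  rw [h1]
  rw [← Submonoid.closure_eq ((traceRing n g).toSubsemiring.toSubmonoid.map
    (baseChange n g K).toMonoidHom), ← Algebra.adjoin_eq_span]
  exact hx

theorem transpose_mem_traceRingExt
    {x : Matrix (Fin n) (Fin n) (MvPolynomial (Fin g × Fin n × Fin n) K)}
    (hx : x ∈ traceRingExt n g K) : xᵀ ∈ traceRingExt n g K := by
  have hx' := mem_span_of_mem_traceRingExt hx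
  clear hx
  induction hx' using Submodule.span_induction with
  | mem x hx =>
    obtain ⟨h, hh, rfl⟩ := hx
    exact baseChange_mem (transpose_mem_traceRing hh)
  | zero => rw [transpose_zero]; exact zero_mem _
  | add x y _ _ h1 h2 => rw [transpose_add]; exact add_mem h1 h2
  | smul r x _ h1 => rw [transpose_smul]; exact Subalgebra.smul_mem _ h1 _

theorem trace_mem_span
    {x : Matrix (Fin n) (Fin n) (MvPolynomial (Fin g × Fin n × Fin n) K)}
    (hx : x ∈ traceRingExt n g K) :
    x.trace ∈ Submodule.span K
      (MvPolynomial.map (algebraMap ℝ K) '' (scalars (traceRing n g) : Set (PolyRing n g))) := by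
  have hx' := mem_span_of_mem_traceRingExt hx
  clear hx
  induction hx' using Submodule.span_induction with
  | mem x hx =>
    obtain ⟨h, hh, rfl⟩ := hx
    exact Submodule.subset_span ⟨h.trace, mem_scalars.2 (trace_smul_one_mem_traceRing hh),
      (trace_baseChange h).symm⟩
  | zero => rw [trace_zero]; exact zero_mem _
  | add x y _ _ h1 h2 => rw [trace_add]; exact add_mem h1 h2
  | smul r x _ h1 => rw [trace_smul]; exact Submodule.smul_mem _ _ h1

theorem scalars_traceRingExt_subset (hn : 0 < n) [CharZero K]
    {c : MvPolynomial (Fin g × Fin n × Fin n) K} (hc : c ∈ scalars (traceRingExt n g K)) :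
    c ∈ Submodule.span K
      (MvPolynomial.map (algebraMap ℝ K) '' (scalars (traceRing n g) : Set (PolyRing n g))) := by
  have h1 := trace_mem_span (mem_scalars.1 hc)
  have h2 : c = (n : K)⁻¹ • (c • (1 : Matrix (Fin n) (Fin n)
      (MvPolynomial (Fin g × Fin n × Fin n) K))).trace := by
    rw [trace_smul, trace_one, Fintype.card_fin, smul_eq_mul, mul_comm, ← nsmul_eq_mul,
      ← Nat.cast_smul_eq_nsmul K, smul_smul, inv_mul_cancel₀ (by exact_mod_cast hn.ne'), one_smul]
  rw [h2]
  exact Submodule.smul_mem _ _ h1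

theorem span_le_scalars_traceRingExt {c : MvPolynomial (Fin g × Fin n × Fin n) K}
    (hc : c ∈ Submodule.span K
      (MvPolynomial.map (algebraMap ℝ K) '' (scalars (traceRing n g) : Set (PolyRing n g)))) :
    c ∈ scalars (traceRingExt n g K) := by
  induction hc using Submodule.span_induction with
  | mem x hx =>
    obtain ⟨p, hp, rfl⟩ := hx
    rw [mem_scalars, ← baseChange_smul_one]
    exact baseChange_mem (mem_scalars.1 hp)
  | zero => exact zero_mem _
  | add x y _ _ h1 h2 => exact add_mem h1 h2
  | smul r x _ h1 => exact Subalgebra.smul_mem _ h1 _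

/-- A linear functional on the scalars of the trace ring extends to all polynomials, with scalars
extended. -/
theorem exists_linear_extension (φ : scalars (traceRing n g) →ₐ[ℝ] K) :
    ∃ Φ : MvPolynomial (Fin g × Fin n × Fin n) K →ₗ[K] K, ∀ p : scalars (traceRing n g),
      Φ (MvPolynomial.map (algebraMap ℝ K) p) = φ p := by
  obtain ⟨φ', hφ'⟩ := LinearMap.exists_extend
    (p := Subalgebra.toSubmodule (scalars (traceRing n g))) φ.toLinearMap
  let Φ := (MvPolynomial.basisMonomials (Fin g × Fin n × Fin n) K).constr K
    fun m => φ' (MvPolynomial.monomial m 1)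
  have key : ∀ p : PolyRing n g, Φ (MvPolynomial.map (algebraMap ℝ K) p) = φ' p := by
    intro p
    induction p using MvPolynomial.induction_on' with
    | monomial m r =>
      have h1 : MvPolynomial.map (algebraMap ℝ K) (MvPolynomial.monomial m r) =
          algebraMap ℝ K r • (MvPolynomial.basisMonomials (Fin g × Fin n × Fin n) K) m := by
        rw [MvPolynomial.map_monomial, MvPolynomial.coe_basisMonomials,
          MvPolynomial.smul_monomial, smul_eq_mul, mul_one]
      have h2 : MvPolynomial.monomial m r = r • (MvPolynomial.monomial m 1 : PolyRing n g) := by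
        rw [MvPolynomial.smul_monomial, smul_eq_mul, mul_one]
      rw [h1, map_smul, h2, map_smul, Module.Basis.constr_basis, algebraMap_smul]
    | add p q hp hq => rw [map_add, map_add, map_add, hp, hq]
  exact ⟨Φ, fun p => (key p).trans (LinearMap.congr_fun hφ' p)⟩

variable [LinearOrder K] [IsStrictOrderedRing K]

theorem nonneg_trace_conj {φ : scalars (traceRing n g) →ₐ[ℝ] K}
    {Φ : MvPolynomial (Fin g × Fin n × Fin n) K →ₗ[K] K}
    (hΦ : ∀ p : scalars (traceRing n g), Φ (MvPolynomial.map (algebraMap ℝ K) p) = φ p)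
    {s : MatP n g} (hs : s ∈ traceRing n g) (hsT : sᵀ = s)
    (hpos : ∀ h ∈ traceRing n g, ∀ hm, 0 ≤ φ ⟨(h * s * hᵀ).trace, hm⟩)
    {x : Matrix (Fin n) (Fin n) (MvPolynomial (Fin g × Fin n × Fin n) K)}
    (hx : x ∈ traceRingExt n g K) : 0 ≤ Φ (x * baseChange n g K s * xᵀ).trace := by
  obtain ⟨m, c, y, rfl⟩ := Submodule.mem_span_set'.1 (mem_span_of_mem_traceRingExt hx)
  have hy : ∀ i, ∃ h ∈ traceRing n g, baseChange n g K h = y i := fun i => (y i).2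
  choose h hh hyh using hy
  have hm : ∀ i j, (h i * s * (h j)ᵀ).trace ∈ scalars (traceRing n g) := fun i j =>
    mem_scalars.2 (trace_smul_one_mem_traceRing
      (mul_mem (mul_mem (hh i) hs) (transpose_mem_traceRing (hh j))))
  let G : Matrix (Fin m) (Fin m) K := of fun i j => φ ⟨_, hm i j⟩
  have hG : Φ ((∑ i, c i • (y i).1) * baseChange n g K s * (∑ i, c i • (y i).1)ᵀ).trace =
      ∑ i, ∑ j, c i * c j * G i j := by
    simp only [← hyh, transpose_sum, transpose_smul, Finset.sum_mul, Finset.mul_sum,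
      smul_mul_assoc, mul_smul_comm, trace_sum, trace_smul, map_sum, map_smul, smul_eq_mul]
    rw [Finset.sum_comm]
    refine Finset.sum_congr rfl fun i _ => Finset.sum_congr rfl fun j _ => ?_
    rw [← baseChange_transpose, ← map_mul, ← map_mul, trace_baseChange, hΦ ⟨_, hm i j⟩]
    simp only [G, of_apply]
    ring
  rw [hG]
  refine quadraticForm_nonneg_of_subring φ.toRingHom.range G (fun i j => ?_) (fun i j => ⟨_, rfl⟩)
    (fun d hd => ?_) c
  · simp only [G, of_apply]
    congr 2
    rw [← trace_transpose, transpose_mul, transpose_mul, transpose_transpose, hsT, mul_assoc]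
  · choose z hz using hd
    have hzm : ∑ i, (z i : PolyRing n g) • h i ∈ traceRing n g := by
      refine sum_mem fun i _ => ?_
      have := mul_mem (mem_scalars.1 (z i).2) (hh i)
      rwa [smul_mul_assoc, one_mul] at this
    have h1 := hpos _ hzm (mem_scalars.2 (trace_smul_one_mem_traceRing
      (mul_mem (mul_mem hzm hs) (transpose_mem_traceRing hzm))))
    refine h1.trans_eq ?_
    have h2 : (⟨((∑ i, (z i : PolyRing n g) • h i) * s *
        (∑ i, (z i : PolyRing n g) • h i)ᵀ).trace, mem_scalars.2 (trace_smul_one_mem_traceRing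
      (mul_mem (mul_mem hzm hs) (transpose_mem_traceRing hzm)))⟩ : scalars (traceRing n g)) =
        ∑ i, ∑ j, z i * z j * ⟨_, hm i j⟩ := by
      ext1
      simp only [transpose_sum, transpose_smul, Finset.sum_mul, Finset.mul_sum,
        smul_mul_assoc, mul_smul_comm, trace_sum, trace_smul, smul_eq_mul,
        AddSubmonoidClass.coe_finsetSum, Subalgebra.coe_mul]
      rw [Finset.sum_comm]
      refine Finset.sum_congr rfl fun i _ => Finset.sum_congr rfl fun j _ => ?_
      ring
    rw [h2]
    simp only [map_sum, map_mul]
    refine Finset.sum_congr rfl fun i _ => Finset.sum_congr rfl fun j _ => ?_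
    rw [← hz i, ← hz j]
    rfl

theorem isTraceState_traceRingExt (hn : 0 < n) {φ : scalars (traceRing n g) →ₐ[ℝ] K}
    {Φ : MvPolynomial (Fin g × Fin n × Fin n) K →ₗ[K] K}
    (hΦ : ∀ p : scalars (traceRing n g), Φ (MvPolynomial.map (algebraMap ℝ K) p) = φ p)
    (hpos : ∀ h ∈ traceRing n g, ∀ hm, 0 ≤ φ ⟨(h * hᵀ).trace, hm⟩) :
    IsTraceState (traceRingExt n g K) Φ where
  transpose_mem _ := transpose_mem_traceRingExt
  trace_mem _ hx := span_le_scalars_traceRingExt (trace_mem_span hx)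
  one := by
    have := hΦ 1
    rwa [OneMemClass.coe_one, map_one (MvPolynomial.map (algebraMap ℝ K)), map_one φ] at this
  mul c hc d hd := by
    have hc' := scalars_traceRingExt_subset hn hc
    have hd' := scalars_traceRingExt_subset hn hd
    clear hc hd
    induction hc', hd' using Submodule.span_induction₂ with
    | mem_mem x y hx hy =>
      obtain ⟨p, hp, rfl⟩ := hx
      obtain ⟨q, hq, rfl⟩ := hy
      have h1 := hΦ (⟨p, hp⟩ * ⟨q, hq⟩)
      rw [map_mul, ← hΦ, ← hΦ] at h1
      rw [← map_mul]
      exact h1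
    | zero_left y _ => simp
    | zero_right x _ => simp
    | add_left x y z _ _ _ h1 h2 => rw [add_mul, map_add, map_add, h1, h2, add_mul]
    | add_right x y z _ _ _ h1 h2 => rw [mul_add, map_add, map_add, h1, h2, mul_add]
    | smul_left r x y _ _ h1 => rw [smul_mul_assoc, map_smul, map_smul, h1, smul_mul_assoc]
    | smul_right r x y _ _ h1 => rw [mul_smul_comm, map_smul, map_smul, h1, mul_smul_comm]
  nonneg x hx := by
    have := nonneg_trace_conj hΦ (one_mem _) transpose_one
      (fun h hh hm => by simpa only [mul_one] using hpos h hh (by simpa only [mul_one] using hm)) hx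
    rwa [map_one, mul_one] at this

end

section

/-- Transposition and the trace of matrices over an ordered field. -/
def matrixPosTrace (n : ℕ) (K : Type) [Field K] [LinearOrder K] [IsStrictOrderedRing K] :
    PosTrace K (Matrix (Fin n) (Fin n) K) where
  star := (transposeLinearEquiv (Fin n) (Fin n) K K).toLinearMap
  tr := traceLinearMap (Fin n) K K
  star_mul := transpose_mul
  star_star := transpose_transpose
  tr_mul_comm := trace_mul_comm
  tr_star := trace_transpose
  tr_pos x hx := by
    change 0 < (xᵀ * x).trace
    have h1 : (xᵀ * x).trace = ∑ i, ∑ j, x j i ^ 2 := by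
      simp [Matrix.trace, mul_apply, sq]
    rw [h1]
    have h2 : ∃ i j, x j i ≠ 0 := by
      by_contra! h
      exact hx (by ext i j; exact h j i)
    obtain ⟨i, j, hij⟩ := h2
    exact Finset.sum_pos' (fun _ _ => Finset.sum_nonneg fun _ _ => sq_nonneg _)
      ⟨i, Finset.mem_univ _, Finset.sum_pos' (fun _ _ => sq_nonneg _)
        ⟨j, Finset.mem_univ _, by positivity⟩⟩

variable {n g : ℕ} {K : Type} [Field K] [Algebra ℝ K]

/-- Evaluation of matrices of polynomials at a point over an extension field of `ℝ`. -/
def pointHom (x : Fin g × Fin n × Fin n → K) : MatP n g →+* Matrix (Fin n) (Fin n) K :=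
  (MvPolynomial.eval₂Hom (algebraMap ℝ K) x).mapMatrix

theorem trace_pointHom (x : Fin g × Fin n × Fin n → K) (h : MatP n g) :
    (pointHom x h).trace = MvPolynomial.eval₂Hom (algebraMap ℝ K) x h.trace := by
  simp [pointHom, Matrix.trace, map_sum]

theorem pointHom_smul_one (x : Fin g × Fin n × Fin n → K) (p : PolyRing n g) :
    pointHom x (p • (1 : MatP n g)) = MvPolynomial.eval₂Hom (algebraMap ℝ K) x p • 1 := by
  ext1 i j
  by_cases h : i = j <;> simp [pointHom, h]

/-- A representation compatible with transposes and traces is evaluation at a point. -/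
theorem rep_eq_pointHom (ρ : traceRingExt n g K →ₐ[K] Matrix (Fin n) (Fin n) K)
    (h1 : ∀ (h : traceRingExt n g K) (hT), ρ ⟨(h : Matrix (Fin n) (Fin n) _)ᵀ, hT⟩ = (ρ h)ᵀ)
    (h2 : ∀ c (hc : c ∈ scalars (traceRingExt n g K)) (h : traceRingExt n g K),
      (h : Matrix (Fin n) (Fin n) _).trace = c → ρ ⟨c • 1, mem_scalars.1 hc⟩ = (ρ h).trace • 1) :
    ∃ x : Fin g × Fin n × Fin n → K, ∀ h (hh : h ∈ traceRing n g),
      ρ ⟨baseChange n g K h, baseChange_mem hh⟩ = pointHom x h := by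
  have hgen : ∀ j, genMat n g j ∈ traceRing n g := fun j =>
    Algebra.subset_adjoin (Or.inl (Or.inl ⟨j, rfl⟩))
  have hgenSet : genSet n g ⊆ traceRing n g := fun w hw => Algebra.subset_adjoin (Or.inl hw)
  have hword : ∀ w ∈ Submonoid.closure (genSet n g), w ∈ traceRing n g := fun w hw =>
    (Submonoid.closure_le (S := (traceRing n g).toSubsemiring.toSubmonoid)).2 hgenSet hw
  let x : Fin g × Fin n × Fin n → K := fun v =>
    ρ ⟨baseChange n g K (genMat n g v.1), baseChange_mem (hgen v.1)⟩ v.2.1 v.2.2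
  have hx : ∀ j, ρ ⟨baseChange n g K (genMat n g j), baseChange_mem (hgen j)⟩ =
      pointHom x (genMat n g j) := fun j => by
    ext a b
    simp [pointHom, genMat, x]
  obtain ⟨ρ', hρ'⟩ : ∃ ρ' : traceRing n g →+* Matrix (Fin n) (Fin n) K,
      ∀ h (hh : h ∈ traceRing n g), ρ ⟨baseChange n g K h, baseChange_mem hh⟩ = ρ' ⟨h, hh⟩ :=
    ⟨ρ.toRingHom.comp (((baseChange n g K).comp (traceRing n g).subtype).codRestrict
      (traceRingExt n g K) fun h => baseChange_mem h.2), fun _ _ => rfl⟩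
  have hwords : ∀ w (hw : w ∈ Submonoid.closure (genSet n g)),
      ρ' ⟨w, hword w hw⟩ = pointHom x w := by
    intro w hw
    induction hw using Submonoid.closure_induction with
    | mem w hw =>
      rcases hw with ⟨j, rfl⟩ | ⟨j, rfl⟩
      · exact (hρ' _ _).symm.trans (hx j)
      · refine (hρ' _ _).symm.trans ((h1 ⟨baseChange n g K (genMat n g j), baseChange_mem (hgen j)⟩
          (transpose_mem_traceRingExt (baseChange_mem (hgen j)))).trans ?_)
        rw [hx]
        rfl
    | one => exact (map_one ρ').trans (map_one (pointHom x)).symm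
    | mul w v hw hv h3 h4 =>
      rw [map_mul (pointHom x), ← h3, ← h4, ← map_mul ρ', MulMemClass.mk_mul_mk]
  suffices key : ∀ h ∈ traceRing n g, ∃ hm : h ∈ traceRing n g, ρ' ⟨h, hm⟩ = pointHom x h from
    ⟨x, fun h hh => (hρ' h hh).trans (key h hh).2⟩
  intro h hh
  induction hh using Algebra.adjoin_induction with
  | mem m hm =>
    rcases hm with hm | ⟨w, hw, rfl⟩
    · exact ⟨hgenSet hm, hwords m (Submonoid.subset_closure hm)⟩
    · have hm := trace_smul_one_mem_traceRing (hword w hw)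
      refine ⟨hm, ?_⟩
      have hc : MvPolynomial.map (algebraMap ℝ K) w.trace ∈ scalars (traceRingExt n g K) := by
        rw [mem_scalars, ← baseChange_smul_one]
        exact baseChange_mem hm
      have h3 := h2 _ hc ⟨baseChange n g K w, baseChange_mem (hword w hw)⟩ (trace_baseChange w)
      rw [hρ' _ (hword w hw), hwords w hw, trace_pointHom, ← pointHom_smul_one] at h3
      rw [← h3, ← hρ' _ hm]
      congr 2
      exact baseChange_smul_one _
  | algebraMap r =>
    refine ⟨Subalgebra.algebraMap_mem _ r, ?_⟩
    have h3 : (⟨baseChange n g K (algebraMap ℝ (MatP n g) r),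
        baseChange_mem (Subalgebra.algebraMap_mem _ r)⟩ : traceRingExt n g K) =
        algebraMap K _ (algebraMap ℝ K r) := by
      ext1
      change baseChange n g K (algebraMap ℝ (MatP n g) r) = algebraMap K (Matrix _ _ _) _
      have : algebraMap ℝ (MatP n g) r = (MvPolynomial.C r : PolyRing n g) • 1 := by
        ext i j
        by_cases h : i = j <;> simp [algebraMap_matrix_apply, h, MvPolynomial.algebraMap_eq]
      rw [this, baseChange_smul_one, MvPolynomial.map_C]
      ext i j
      by_cases h : i = j <;> simp [algebraMap_matrix_apply, h, MvPolynomial.algebraMap_eq]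
    rw [← hρ' _ (Subalgebra.algebraMap_mem _ r), h3, AlgHom.commutes]
    ext i j
    by_cases h : i = j <;>
      simp [algebraMap_matrix_apply, h, pointHom, MvPolynomial.algebraMap_eq]
  | add y z _ _ h3 h4 =>
    obtain ⟨hy, h3⟩ := h3
    obtain ⟨hz, h4⟩ := h4
    refine ⟨add_mem hy hz, ?_⟩
    rw [map_add (pointHom x), ← h3, ← h4, ← map_add ρ', AddMemClass.mk_add_mk]
  | mul y z _ _ h3 h4 =>
    obtain ⟨hy, h3⟩ := h3
    obtain ⟨hz, h4⟩ := h4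
    refine ⟨mul_mem hy hz, ?_⟩
    rw [map_mul (pointHom x), ← h3, ← h4, ← map_mul ρ', MulMemClass.mk_mul_mk]

variable [LinearOrder K] [IsStrictOrderedRing K]

theorem exists_point (hn : 0 < n) (hK : PolyIVT K) (φ : scalars (traceRing n g) →ₐ[ℝ] K)
    {S : Set (MatP n g)} (hS : ∀ s ∈ S, s ∈ traceRing n g ∧ sᵀ = s)
    (hone : ∀ h ∈ traceRing n g, ∀ hm, 0 ≤ φ ⟨(h * hᵀ).trace, hm⟩)
    (hpos : ∀ s ∈ S, ∀ h ∈ traceRing n g, ∀ hm, 0 ≤ φ ⟨(h * s * hᵀ).trace, hm⟩) :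
    ∃ x : Fin g × Fin n × Fin n → K,
      (∀ c : scalars (traceRing n g),
        MvPolynomial.eval₂Hom (algebraMap ℝ K) x (c : PolyRing n g) = φ c) ∧
      ∀ s ∈ S, ∃ L : Multiset K, (∀ l ∈ L, 0 ≤ l) ∧
        aeval (pointHom x s) (L.map fun l => X - C l).prod = 0 := by
  obtain ⟨Φ, hΦ⟩ := exists_linear_extension φ
  have H := isTraceState_traceRingExt hn hΦ hone
  obtain ⟨ρ, h1, h2, h3⟩ := H.exists_rep hK
  obtain ⟨x, hx⟩ := rep_eq_pointHom ρ h1 fun c hc h hhc => by rw [h3 c hc, h2, hhc]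
  refine ⟨x, fun c => ?_, fun s hs => ?_⟩
  · have hc : MvPolynomial.map (algebraMap ℝ K) (c : PolyRing n g) ∈
        scalars (traceRingExt n g K) := by
      rw [mem_scalars, ← baseChange_smul_one]
      exact baseChange_mem (mem_scalars.1 c.2)
    have h4 := hx _ (mem_scalars.1 c.2)
    rw [pointHom_smul_one] at h4
    have h5 := h3 _ hc
    simp only [← baseChange_smul_one] at h5
    rw [h5, hΦ] at h4
    have h6 := congrFun (congrFun h4 ⟨0, hn⟩) ⟨0, hn⟩
    simpa using h6.symm
  · obtain ⟨hsm, hsT⟩ := hS s hs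
    have hps : (pointHom x s)ᵀ = pointHom x s := by
      conv_rhs => rw [← hsT]
      rfl
    refine (matrixPosTrace n K).exists_nonneg_roots hK hps (Matrix.isIntegral _) fun r => ?_
    let b : traceRingExt n g K := ⟨baseChange n g K s, baseChange_mem hsm⟩
    have hb : ρ b = pointHom x s := hx s hsm
    let y := aeval b r
    have hy : ρ y = aeval (pointHom x s) r := by rw [← hb, aeval_algHom_apply]
    have hyT : (y : Matrix (Fin n) (Fin n) _)ᵀ ∈ traceRingExt n g K :=
      transpose_mem_traceRingExt y.2
    have h4 := nonneg_trace_conj hΦ hsm hsT (hpos s hs) hyT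
    rw [transpose_transpose, mul_assoc] at h4
    have h5 := h2 (⟨_, hyT⟩ * (b * y))
    rw [map_mul, map_mul, h1, hy, hb] at h5
    exact h4.trans_eq h5.symm

end

section

variable {n g : ℕ}

/-- The value of the characteristic polynomial of `a` at a new variable. -/
def charValue {κ : Type} (a : MatP n g) (k : κ) :
    MvPolynomial ((Fin g × Fin n × Fin n) ⊕ κ) ℝ :=
  (a.charpoly.map (MvPolynomial.rename Sum.inl).toRingHom).eval (MvPolynomial.X (Sum.inr k))

/-- The product of the differences of `s` and new variables. -/
def prodSub {κ : Type} (s : MatP n g) {m : ℕ} (v : Fin m → κ) :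
    Matrix (Fin n) (Fin n) (MvPolynomial ((Fin g × Fin n × Fin n) ⊕ κ) ℝ) :=
  aeval ((MvPolynomial.rename Sum.inl).toRingHom.mapMatrix s)
    (∏ i, (X - C (MvPolynomial.X (Sum.inr (v i)))) :
      (MvPolynomial ((Fin g × Fin n × Fin n) ⊕ κ) ℝ)[X])

theorem mapMatrix_aeval {R R' : Type} [CommRing R] [CommRing R'] (f : R →+* R')
    (M : Matrix (Fin n) (Fin n) R) (p : R[X]) :
    f.mapMatrix (aeval M p) = aeval (f.mapMatrix M) (p.map f) := by
  refine map_aeval_eq_aeval_map ?_ p M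
  ext r i j
  by_cases h : i = j <;> simp [algebraMap_matrix_apply, h]

variable {K : Type} [Field K] [Algebra ℝ K]

theorem eval₂Hom_comp_rename {κ : Type} (y : (Fin g × Fin n × Fin n) ⊕ κ → K) :
    (MvPolynomial.eval₂Hom (algebraMap ℝ K) y).comp
      (MvPolynomial.rename (R := ℝ) Sum.inl).toRingHom =
      MvPolynomial.eval₂Hom (algebraMap ℝ K) (y ∘ Sum.inl) :=
  RingHom.ext fun p => MvPolynomial.eval₂Hom_rename _ _ _ p

theorem eval₂Hom_charValue {κ : Type} (y : (Fin g × Fin n × Fin n) ⊕ κ → K) (a : MatP n g) (k : κ) :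
    MvPolynomial.eval₂Hom (algebraMap ℝ K) y (charValue a k) =
      (pointHom (y ∘ Sum.inl) a).charpoly.eval (y (Sum.inr k)) := by
  rw [charValue, pointHom, RingHom.mapMatrix_apply, charpoly_map, ← eval₂Hom_comp_rename,
    ← Polynomial.map_map, Polynomial.eval_map, Polynomial.eval_map, hom_eval₂, eval₂_map,
    MvPolynomial.coe_eval₂Hom, MvPolynomial.eval₂_X]

theorem mapMatrix_prodSub {κ : Type} (y : (Fin g × Fin n × Fin n) ⊕ κ → K) (s : MatP n g) {m : ℕ}
    (v : Fin m → κ) :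
    (MvPolynomial.eval₂Hom (algebraMap ℝ K) y).mapMatrix (prodSub s v) =
      aeval (pointHom (y ∘ Sum.inl) s) (∏ i, (X - C (y (Sum.inr (v i))))) := by
  rw [prodSub, mapMatrix_aeval, pointHom, ← eval₂Hom_comp_rename, ← RingHom.mapMatrix_comp,
    Polynomial.map_prod]
  simp

theorem posSemidef_of_aeval_prod {M : Matrix (Fin n) (Fin n) ℝ} (hM : Mᵀ = M) {m : ℕ}
    {l : Fin m → ℝ} (hl : ∀ i, 0 ≤ l i) (h : aeval M (∏ i, (X - C (l i))) = 0) :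
    M.PosSemidef := by
  have hH : M.IsHermitian := hM
  refine hH.posSemidef_iff_eigenvalues_nonneg.2 fun i => ?_
  have : Nonempty (Fin n) := ⟨i⟩
  have h1 := spectrum.subset_polynomial_aeval M (∏ i, (X - C (l i)))
    ⟨_, hH.eigenvalues_mem_spectrum_real i, rfl⟩
  rw [h, spectrum.zero_eq, Set.mem_singleton_iff] at h1
  simp only [eval_prod, eval_sub, eval_X, eval_C, Finset.prod_eq_zero_iff, sub_eq_zero] at h1
  obtain ⟨j, -, hj⟩ := h1
  rw [Pi.zero_apply, hj]
  exact hl j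

theorem nonneg_of_charpoly_eval {M : Matrix (Fin n) (Fin n) ℝ} (hM : M.PosSemidef) {r : ℝ}
    (h : M.charpoly.eval r = 0) : 0 ≤ r := by
  have h1 := mem_spectrum_iff_isRoot_charpoly.2 h
  rw [hM.isHermitian.spectrum_real_eq_range_eigenvalues] at h1
  obtain ⟨i, rfl⟩ := h1
  exact hM.eigenvalues_nonneg i

theorem charpoly_pointHom_eval {φ : scalars (traceRing n g) →ₐ[ℝ] K} {a : MatP n g}
    (haT : a ∈ traceRing n g) {α : K}
    (hα : ∀ f : (scalars (traceRing n g))[X], aeval a f = 0 → f.eval₂ (φ : _ →+* K) α = 0)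
    {x : Fin g × Fin n × Fin n → K} (hx : ∀ c : scalars (traceRing n g),
        MvPolynomial.eval₂Hom (algebraMap ℝ K) x (c : PolyRing n g) = φ c) :
    (pointHom x a).charpoly.eval α = 0 := by
  obtain ⟨D, hD⟩ := exists_scalars_poly (coeff_charpoly_mem
    (fun h hh => mem_scalars.2 (trace_smul_one_mem_traceRing hh)) haT)
  have h1 : aeval a D = 0 := by
    rw [← aeval_map_algebraMap (PolyRing n g)]
    exact (congrArg (aeval a) hD).trans (aeval_self_charpoly a)
  rw [pointHom, RingHom.mapMatrix_apply, charpoly_map, ← hD, Polynomial.map_map,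
    Polynomial.eval_map, ← hα D h1]
  congr 1
  exact RingHom.ext hx

theorem exists_real_of_point [LinearOrder K] [IsStrictOrderedRing K] (hK : PolyIVT K)
    {S : Set (MatP n g)} (hSfin : S.Finite) (hS : ∀ s ∈ S, sᵀ = s) (a : MatP n g) {α : K}
    (hα : α < 0) {x : Fin g × Fin n × Fin n → K}
    (ha : (pointHom x a).charpoly.eval α = 0)
    (hL : ∀ s ∈ S, ∃ L : Multiset K, (∀ l ∈ L, 0 ≤ l) ∧
        aeval (pointHom x s) (L.map fun l => X - C l).prod = 0) :
    ∃ Y ∈ KSet n g S, ¬ (evalMat n g Y a).PosSemidef := by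
  classical
  have hL' : ∀ s : S, ∃ (m : ℕ) (l : Fin m → K), (∀ i, 0 ≤ l i) ∧
      aeval (pointHom x s.1) (∏ i, (X - C (l i))) = 0 := by
    intro s
    obtain ⟨L, h1, h2⟩ := hL s s.2
    refine ⟨L.toList.length, fun i => L.toList[i.1], fun i => h1 _ ?_, ?_⟩
    · exact Multiset.mem_toList.1 (List.getElem_mem _)
    · rw [Fin.prod_univ_fun_getElem L.toList fun l => X - C l, ← Multiset.prod_coe,
        ← Multiset.map_coe, Multiset.coe_toList, h2]
  choose m l hl hprod using hL'
  have : Fintype S := hSfin.fintype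
  let y : (Fin g × Fin n × Fin n) ⊕ Option (Σ s : S, Fin (m s)) → K :=
    Sum.elim x fun o => o.elim α fun p => l p.1 p.2
  let v : ∀ s : S, Fin (m s) → Option (Σ s : S, Fin (m s)) := fun s i => some ⟨s, i⟩
  obtain ⟨y', hy'⟩ := exists_real_point hK (algebraMap ℝ K)
    ({charValue a none, MvPolynomial.X (Sum.inr none)} ∪
      (Finset.univ.image fun p : Σ s : S, Fin (m s) => MvPolynomial.X (Sum.inr (some p))) ∪
      (Finset.univ.image fun p : S × Fin n × Fin n => prodSub p.1.1 (v p.1) p.2.1 p.2.2)) y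
  let Y : Fin g → Matrix (Fin n) (Fin n) ℝ := fun j => of fun b c => y' (Sum.inl (j, b, c))
  have hY : ∀ h, evalMat n g Y h = pointHom (y' ∘ Sum.inl) h := fun h => rfl
  have hev : ∀ p, MvPolynomial.eval y' p = MvPolynomial.eval₂Hom (algebraMap ℝ ℝ) y' p :=
    fun p => rfl
  have h1 : (pointHom (y' ∘ Sum.inl) a).charpoly.eval (y' (Sum.inr none)) = 0 := by
    have h := hy' (charValue a none) (by simp)
    rw [eval₂Hom_charValue, show y ∘ Sum.inl = x from rfl, show y (Sum.inr none) = α from rfl, ha,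
      sign_zero, sign_eq_zero_iff, hev, eval₂Hom_charValue] at h
    exact h
  have h2 : y' (Sum.inr none) < 0 := by
    have h := hy' (MvPolynomial.X (Sum.inr none)) (by simp)
    rw [MvPolynomial.eval_X, MvPolynomial.coe_eval₂Hom, MvPolynomial.eval₂_X,
      show y (Sum.inr none) = α from rfl, sign_neg hα] at h
    exact sign_eq_neg_one_iff.1 h
  have h3 : ∀ p, 0 ≤ y' (Sum.inr (some p)) := by
    intro p
    have h := hy' (MvPolynomial.X (Sum.inr (some p))) (by simp)
    rw [MvPolynomial.eval_X, MvPolynomial.coe_eval₂Hom, MvPolynomial.eval₂_X] at h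
    rw [← sign_nonneg_iff, h, sign_nonneg_iff]
    exact hl p.1 p.2
  have h4 : ∀ s : S, (MvPolynomial.eval₂Hom (algebraMap ℝ ℝ) y').mapMatrix (prodSub s.1 (v s)) =
      0 := by
    intro s
    ext b c
    have h := hy' (prodSub s.1 (v s) b c) (by
      refine Finset.mem_union_right _ (Finset.mem_image.2 ⟨(s, b, c), Finset.mem_univ _, rfl⟩))
    have h5 := congrFun (congrFun ((mapMatrix_prodSub y s.1 (v s)).trans (hprod s)) b) c
    rw [RingHom.mapMatrix_apply, map_apply] at h5 ⊢
    rw [h5, Matrix.zero_apply, sign_zero, sign_eq_zero_iff] at h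
    exact h
  refine ⟨Y, fun s hs => ?_, fun h => h2.not_ge (nonneg_of_charpoly_eval h h1)⟩
  have h5 := h4 ⟨s, hs⟩
  rw [mapMatrix_prodSub] at h5
  refine posSemidef_of_aeval_prod ?_ (fun i => h3 ⟨⟨s, hs⟩, i⟩) h5
  conv_rhs => rw [← hS s hs]
  rfl

theorem exists_real_of_no_certificate (hn : 0 < n) {S : Set (MatP n g)} (hSfin : S.Finite)
    (hS : ∀ s ∈ S, s ∈ traceRing n g ∧ sᵀ = s) {a : MatP n g} (haT : a ∈ traceRing n g)
    (haSym : aᵀ = a) (hno : ¬ ∃ t₁ ∈ TtrS n g S, ∃ t₂ ∈ TtrS n g S, ∃ k : ℕ,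
      a * t₁ = a ^ (2 * k) + t₂ ∧ t₁ * a = a ^ (2 * k) + t₂) :
    ∃ Y ∈ KSet n g S, ¬ (evalMat n g Y a).PosSemidef := by
  obtain ⟨K, _, _, _, φ₀, α, hK, hα, hpos, hroot⟩ :=
    exists_field_of_no_certificate hn hS haT haSym hno
  let _ : Algebra ℝ K := (φ₀.comp (algebraMap ℝ _)).toAlgebra
  let φ : scalars (traceRing n g) →ₐ[ℝ] K := { φ₀ with commutes' := fun _ => rfl }
  obtain ⟨⟨-, hone, -, hconj, htrace⟩, -⟩ := isCyclicPreordering_TtrS hn hS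
  obtain ⟨x, hx, hL⟩ := exists_point hn hK φ hS
    (fun h hh hm => hpos ⟨_, hm⟩ (by
      have := htrace _ (hconj h hh 1 hone)
      rwa [mul_one] at this))
    (fun s hs h hh hm => hpos ⟨_, hm⟩ (htrace _ (hconj h hh s fun T _ hT => hT hs)))
  exact exists_real_of_point hK hSfin (fun s hs => (hS s hs).2) a hα
    (charpoly_pointHom_eval (φ := φ) haT hroot hx) hL

end

end TracePos

/-- Krivine-Stengle Positivstellensatz for trace polynomials, positive semidefinite
case. -/
theorem stmt0 (n g : ℕ) (hn : 0 < n) (hg : 0 < g)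
    (S : Set (MatP n g)) (hSfin : S.Finite)
    (hS : ∀ s ∈ S, s ∈ traceRing n g ∧ sᵀ = s)
    (a : MatP n g) (haT : a ∈ traceRing n g) (haSym : aᵀ = a) :
    (∀ X ∈ KSet n g S, (evalMat n g X a).PosSemidef) ↔
      ∃ t₁ ∈ TtrS n g S, ∃ t₂ ∈ TtrS n g S, ∃ k : ℕ,
        a * t₁ = a ^ (2 * k) + t₂ ∧ t₁ * a = a ^ (2 * k) + t₂ := by
  constructor
  · intro h
    by_contra hno
    obtain ⟨Y, hY, hYa⟩ := TracePos.exists_real_of_no_certificate hn hSfin hS haT haSym hno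
    exact hYa (h Y hY)
  · rintro ⟨t₁, ht₁, t₂, ht₂, k, h, -⟩ X hX
    have h1 := congrArg (TracePos.evalHom X) h
    rw [map_mul, map_add, map_pow] at h1
    refine TracePos.posSemidef_of_certificate ?_ (TracePos.posSemidef_of_mem_TtrS hn hS ht₁ hX)
      (TracePos.posSemidef_of_mem_TtrS hn hS ht₂ hX) h1
    exact congrArg (TracePos.evalHom X) haSym
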